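/- Let m, m₁, m₂ ∈ ℝ. Let φ ∈ C^∞(ℝ^n_y × ℝ^n_ξ) be real-valued and a ∈ C^∞(ℝ^n_x × ℝ^n_y × ℝ^n_ξ). Assume: |det ∂_y∂_ξ φ(y,ξ)| ≥ C₀ > 0 for all (y,ξ); |∂_x^α ∂_y^β ∂_ξ^γ a(x,y,ξ)| ≤ C_{αβγ} ⟨x⟩^{m₁−|α|} ⟨y⟩^{m₂} for all multi-indices α, β, γ; |∂_ξ^β φ(y,ξ)| ≤ C_β ⟨y⟩ for all |β| ≥ 1; and |∂_y^α ∂_ξ^β φ(y,ξ)| ≤ C_{αβ} for all |α| ≥ 1 and |β| ≥ 1. Assume further that a(x,y,ξ) = 0 whenever ξ lies outside some compact set K. Then the operator Tu(x) = ∫_{ℝ^n}∫_{ℝ^n} e^{i(x·ξ + φ(y,ξ))} a(x,y,ξ) u(y) dy dξ, defined for Schwartz u, satisfies ‖⟨x⟩^m Tu‖_{L²(ℝ^n)} ≤ C ‖⟨y⟩^{m+m₁+m₂} u‖_{L²(ℝ^n)}, i.e. T is bounded from L²_{m+m₁+m₂}(ℝ^n) to L²_m(ℝ^n), where C depends only on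 n, m, m₁, m₂, C₀ and finitely many of the constants C_{αβγ}, C_β, C_{αβ}, and is independent of K. -/

import Mathlib

open MeasureTheory Complex SchwartzMap
open scoped BigOperators ENNReal Real RealInnerProductSpace

noncomputable section

/-- The derivative of `g` along the direction `v`. -/
def dLine {W F : Type*} [NormedAddCommGroup W] [NormedSpace ℝ W]
    [NormedAddCommGroup F] [NormedSpace ℝ F] (v : W) (g : W → F) : W → F :=
  fun z => fderiv ℝ g z v

/-- The iterated partial derivative `∂^α` along the coordinate directions `dirs`,
with multiplicities given by the multi-index `α`. -/
def mderiv {n : ℕ} {W F : Type*} [NormedAddCommGroup W] [NormedSpace ℝ W]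
    [NormedAddCommGroup F] [NormedSpace ℝ F]
    (dirs : Fin n → W) (α : Fin n → ℕ) (g : W → F) : W → F :=
  ((List.ofFn fun i => (dLine (dirs i) (F := F))^[α i]).foldr (· ∘ ·) id) g

/-- The length `|α|` of a multi-index. -/
def mdeg {n : ℕ} (α : Fin n → ℕ) : ℕ := ∑ i, α i

/-- The first-factor coordinate directions in `ℝ^n × ℝ^n`. -/
def dX {n : ℕ} (i : Fin n) : EuclideanSpace ℝ (Fin n) × EuclideanSpace ℝ (Fin n) :=
  (EuclideanSpace.single i 1, 0)

/-- The second-factor coordinate directions in `ℝ^n × ℝ^n`. -/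
def dY {n : ℕ} (j : Fin n) : EuclideanSpace ℝ (Fin n) × EuclideanSpace ℝ (Fin n) :=
  (0, EuclideanSpace.single j 1)

/-- The entry `∂²φ/∂u_i∂v_j` of the mixed Hessian of a function of two `ℝ^n` variables. -/
def mixedHessXY {n : ℕ}
    (φ : EuclideanSpace ℝ (Fin n) × EuclideanSpace ℝ (Fin n) → ℝ) (i j : Fin n) :
    EuclideanSpace ℝ (Fin n) × EuclideanSpace ℝ (Fin n) → ℝ :=
  dLine (dX i) (dLine (dY j) φ)

/-- The Japanese bracket `⟨x⟩ = (1+|x|²)^{1/2}`. -/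
def jap {n : ℕ} (x : EuclideanSpace ℝ (Fin n)) : ℝ := Real.sqrt (1 + ‖x‖ ^ 2)

/-- The `x`-coordinate directions in `ℝ^n × ℝ^n × ℝ^n`. -/
def d3X {n : ℕ} (i : Fin n) :
    EuclideanSpace ℝ (Fin n) × EuclideanSpace ℝ (Fin n) × EuclideanSpace ℝ (Fin n) :=
  (EuclideanSpace.single i 1, 0, 0)

/-- The `y`-coordinate directions in `ℝ^n × ℝ^n × ℝ^n`. -/
def d3Y {n : ℕ} (j : Fin n) :
    EuclideanSpace ℝ (Fin n) × EuclideanSpace ℝ (Fin n) × EuclideanSpace ℝ (Fin n) :=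
  (0, EuclideanSpace.single j 1, 0)

/-- The `ξ`-coordinate directions in `ℝ^n × ℝ^n × ℝ^n`. -/
def d3Xi {n : ℕ} (k : Fin n) :
    EuclideanSpace ℝ (Fin n) × EuclideanSpace ℝ (Fin n) × EuclideanSpace ℝ (Fin n) :=
  (0, 0, EuclideanSpace.single k 1)



section FBsec
variable {W F G ι κ J : Type*} [NormedAddCommGroup W] [NormedSpace ℝ W]
  [NormedAddCommGroup F] [NormedSpace ℝ F] [NormedAddCommGroup G] [NormedSpace ℝ G]

/-- Smoothness. -/
def Sm (f : W → F) : Prop := ContDiff ℝ (⊤ : ℕ∞) f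

theorem Sm.cd {f : W → F} (h : Sm f) : ContDiff ℝ (⊤ : ℕ∞) f := h

theorem Sm.diff {f : W → F} (h : Sm f) : Differentiable ℝ f :=
  ContDiff.differentiable h (by simp)

theorem Sm.cont {f : W → F} (h : Sm f) : Continuous f := ContDiff.continuous h

theorem Sm.dLine {f : W → F} (h : Sm f) (v : W) : Sm (dLine v f) := by
  have h1 : ContDiff ℝ (⊤ : ℕ∞) (fderiv ℝ f) := by
    apply ContDiff.fderiv_right (m := (⊤ : ℕ∞)) (n := (⊤ : ℕ∞)) h
    exact_mod_cast le_top
  exact ContDiff.clm_apply h1 contDiff_const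

theorem dLine_comm {f : W → F} (h : Sm f) (v w : W) :
    dLine v (dLine w f) = dLine w (dLine v f) := by
  have h1 : ContDiff ℝ (⊤ : ℕ∞) (fderiv ℝ f) := by
    apply ContDiff.fderiv_right (m := (⊤ : ℕ∞)) (n := (⊤ : ℕ∞)) h
    exact_mod_cast le_top
  have h2 : Differentiable ℝ (fderiv ℝ f) := ContDiff.differentiable h1 (by simp)
  funext z
  have key : ∀ a b : W, dLine a (dLine b f) z = fderiv ℝ (fderiv ℝ f) z a b := by
    intro a b
    unfold _root_.dLine
    rw [fderiv_clm_apply (h2 z) (differentiableAt_const b)]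
    simp
  rw [key, key]
  have := (ContDiffAt.isSymmSndFDerivAt (n := (⊤ : ℕ∞)) (ContDiff.contDiffAt h) (by
    simp
    have h2 : ((2 : ℕ∞) : WithTop ℕ∞) ≤ ((⊤ : ℕ∞) : WithTop ℕ∞) := WithTop.coe_le_coe.2 le_top
    exact h2) : IsSymmSndFDerivAt ℝ f z)
  exact this v w

theorem dLine_add {f g : W → F} (hf : Sm f) (hg : Sm g) (v : W) :
    dLine v (fun z => f z + g z) = fun z => dLine v f z + dLine v g z := by
  funext z; unfold dLine; rw [fderiv_fun_add (hf.diff z) (hg.diff z)]; rfl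

theorem dLine_sub {f g : W → F} (hf : Sm f) (hg : Sm g) (v : W) :
    dLine v (fun z => f z - g z) = fun z => dLine v f z - dLine v g z := by
  funext z; unfold dLine; rw [fderiv_fun_sub (hf.diff z) (hg.diff z)]; rfl

theorem dLine_const (c : F) (v : W) : dLine v (fun _ : W => c) = fun _ => 0 := by
  funext z; unfold dLine; simp

theorem dLine_clm (L : F →L[ℝ] G) {f : W → F} (hf : Sm f) (v : W) :
    dLine v (fun z => L (f z)) = fun z => L (dLine v f z) := by
  funext z; unfold dLine
  have := (L.hasFDerivAt.comp z (hf.diff z).hasFDerivAt).fderiv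
  simp only [Function.comp_def] at this
  rw [this]; rfl

theorem dLine_sum {s : Finset κ} {f : κ → W → F} (hf : ∀ k, Sm (f k)) (v : W) :
    dLine v (fun z => ∑ k ∈ s, f k z) = fun z => ∑ k ∈ s, dLine v (f k) z := by
  funext z; unfold dLine; rw [fderiv_fun_sum (fun k _ => (hf k).diff z)]; simp

theorem dLine_mul {R : Type*} [NormedCommRing R] [NormedAlgebra ℝ R] {f g : W → R}
    (hf : Sm f) (hg : Sm g) (v : W) :
    dLine v (fun z => f z * g z) = fun z => dLine v f z * g z + f z * dLine v g z := by
  funext z; unfold dLine; rw [fderiv_fun_mul (hf.diff z) (hg.diff z)]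
  simp; ring

theorem dLine_inv {f : W → ℝ} (hf : Sm f) (h0 : ∀ z, f z ≠ 0) (v : W) :
    dLine v (fun z => (f z)⁻¹) = fun z => (-1 : ℝ) * (((f z)⁻¹ * (f z)⁻¹) * dLine v f z) := by
  funext z; unfold dLine
  have := ((hasDerivAt_inv (h0 z)).comp_hasFDerivAt z (hf.diff z).hasFDerivAt).fderiv
  simp only [Function.comp_def] at this
  rw [this]; simp; left; field_simp

theorem Sm.add {f g : W → F} (hf : Sm f) (hg : Sm g) : Sm (fun z => f z + g z) :=
  ContDiff.add hf hg
theorem Sm.sub {f g : W → F} (hf : Sm f) (hg : Sm g) : Sm (fun z => f z - g z) :=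
  ContDiff.sub hf hg
theorem Sm.const (c : F) : Sm (fun _ : W => c) := contDiff_const
theorem Sm.clm (L : F →L[ℝ] G) {f : W → F} (hf : Sm f) : Sm (fun z => L (f z)) :=
  L.contDiff.comp hf
theorem Sm.sum {s : Finset κ} {f : κ → W → F} (hf : ∀ k, Sm (f k)) :
    Sm (fun z => ∑ k ∈ s, f k z) := ContDiff.sum (fun k _ => hf k)
theorem Sm.mul {R : Type*} [NormedCommRing R] [NormedAlgebra ℝ R] {f g : W → R}
    (hf : Sm f) (hg : Sm g) : Sm (fun z => f z * g z) := ContDiff.mul hf hg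
theorem Sm.inv {f : W → ℝ} (hf : Sm f) (h0 : ∀ z, f z ≠ 0) : Sm (fun z => (f z)⁻¹) :=
  ContDiff.inv hf h0

/-- Uniform symbol estimates for a family of functions. -/
def FB (v : J → W) (g : J → W → ℝ) : ℕ → (ι → W → ℝ) → (ι → W → F) → Prop
  | 0, w, f => ∃ C : ℝ, ∀ i z, ‖f i z‖ ≤ C * w i z
  | N + 1, w, f => (∃ C : ℝ, ∀ i z, ‖f i z‖ ≤ C * w i z) ∧
      ∀ j, FB v g N (fun i z => g j z * w i z) (fun i => dLine (v j) (f i))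

variable {v : J → W} {g : J → W → ℝ} {N M : ℕ} {w w' : ι → W → ℝ}

theorem FB.zero {f : ι → W → F} (h : FB v g N w f) : ∃ C : ℝ, ∀ i z, ‖f i z‖ ≤ C * w i z := by
  cases N with
  | zero => exact h
  | succ N => exact h.1

theorem FB.le {f : ι → W → F} (h : FB v g N w f) (hM : M ≤ N) : FB v g M w f := by
  induction M generalizing N w f with
  | zero => exact h.zero
  | succ M ih =>
    cases N with
    | zero => omega
    | succ N => exact ⟨h.1, fun j => ih (h.2 j) (by omega)⟩

theorem FB.dLine {f : ι → W → F} (h : FB v g (N + 1) w f) (j : J) :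
    FB v g N (fun i z => g j z * w i z) (fun i => dLine (v j) (f i)) := h.2 j

/-- a positive bound -/
theorem FB.bound {f : ι → W → F} (h : FB v g N w f) (hw : ∀ i z, 0 ≤ w i z) :
    ∃ C : ℝ, 0 < C ∧ ∀ i z, ‖f i z‖ ≤ C * w i z := by
  obtain ⟨C, hC⟩ := h.zero
  refine ⟨|C| + 1, by positivity, fun i z => (hC i z).trans ?_⟩
  exact mul_le_mul_of_nonneg_right (by linarith [le_abs_self C]) (hw i z)

theorem FB.mono {f : ι → W → F} (h : FB v g N w f) (hg : ∀ j z, 0 ≤ g j z)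
    (hw : ∀ i z, 0 ≤ w i z) (c : ℝ) (hc : ∀ i z, w i z ≤ c * w' i z) : FB v g N w' f := by
  induction N generalizing w w' f with
  | zero =>
    obtain ⟨C, hC, h⟩ := h.bound hw
    exact ⟨C * c, fun i z => (h i z).trans (by
      rw [mul_assoc]; exact mul_le_mul_of_nonneg_left (hc i z) hC.le)⟩
  | succ N ih =>
    obtain ⟨C, hC, hb⟩ := h.bound hw
    refine ⟨⟨C * c, fun i z => (hb i z).trans (by
      rw [mul_assoc]; exact mul_le_mul_of_nonneg_left (hc i z) hC.le)⟩, fun j => ?_⟩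
    refine ih (h.2 j) (fun i z => mul_nonneg (hg j z) (hw i z)) (fun i z => ?_)
    calc g j z * w i z ≤ g j z * (c * w' i z) := mul_le_mul_of_nonneg_left (hc i z) (hg j z)
      _ = c * (g j z * w' i z) := by ring

theorem FB.congrw {f : ι → W → F} (h : FB v g N w f)
    (hc : ∀ i z, w i z = w' i z) : FB v g N w' f := by
  have : w = w' := by funext i z; exact hc i z
  rwa [← this]

theorem FB.reindex {f : ι → W → F} (h : FB v g N w f) (r : κ → ι) :
    FB v g N (fun k => w (r k)) (fun k => f (r k)) := by
  induction N generalizing w f with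
  | zero => obtain ⟨C, hC⟩ := h; exact ⟨C, fun k z => hC _ z⟩
  | succ N ih =>
    obtain ⟨C, hC⟩ := h.1
    exact ⟨⟨C, fun k z => hC _ z⟩, fun j => ih (h.2 j)⟩

theorem FB.add {f f' : ι → W → F} (hf : ∀ i, Sm (f i)) (hf' : ∀ i, Sm (f' i))
    (h : FB v g N w f) (h' : FB v g N w f') :
    FB v g N w (fun i z => f i z + f' i z) := by
  induction N generalizing w f f' with
  | zero =>
    obtain ⟨C, hC⟩ := h; obtain ⟨C', hC'⟩ := h'
    exact ⟨C + C', fun i z => (norm_add_le _ _).trans (by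
      rw [add_mul]; exact add_le_add (hC i z) (hC' i z))⟩
  | succ N ih =>
    obtain ⟨C, hC⟩ := h.1; obtain ⟨C', hC'⟩ := h'.1
    refine ⟨⟨C + C', fun i z => (norm_add_le _ _).trans (by
      rw [add_mul]; exact add_le_add (hC i z) (hC' i z))⟩, fun j => ?_⟩
    have := ih (fun i => (hf i).dLine (v j)) (fun i => (hf' i).dLine (v j)) (h.2 j) (h'.2 j)
    simp_rw [dLine_add (hf _) (hf' _)]
    exact this

theorem FB.clm (L : F →L[ℝ] G) {f : ι → W → F} (hf : ∀ i, Sm (f i))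
    (h : FB v g N w f) : FB v g N w (fun i z => L (f i z)) := by
  induction N generalizing w f with
  | zero =>
    obtain ⟨C, hC⟩ := h
    exact ⟨‖L‖ * C, fun i z => (L.le_opNorm _).trans (by
      rw [mul_assoc]; exact mul_le_mul_of_nonneg_left (hC i z) (norm_nonneg _))⟩
  | succ N ih =>
    obtain ⟨C, hC⟩ := h.1
    refine ⟨⟨‖L‖ * C, fun i z => (L.le_opNorm _).trans (by
      rw [mul_assoc]; exact mul_le_mul_of_nonneg_left (hC i z) (norm_nonneg _))⟩, fun j => ?_⟩
    have := ih (fun i => (hf i).dLine (v j)) (h.2 j)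
    simp_rw [dLine_clm L (hf _)]
    exact this

theorem FB.zero_fun (hw : ∀ i z, 0 ≤ w i z) (hg : ∀ j z, 0 ≤ g j z) :
    FB v g N w (fun _ _ => (0 : F)) := by
  induction N generalizing w with
  | zero => exact ⟨1, fun i z => by simpa using hw i z⟩
  | succ N ih =>
    refine ⟨⟨1, fun i z => by simpa using hw i z⟩, fun j => ?_⟩
    simp_rw [dLine_const]
    exact ih (fun i z => mul_nonneg (hg j z) (hw i z))

theorem FB.const (c : F) (hw : ∀ i z, 0 ≤ w i z) (h1 : ∀ i z, 1 ≤ w i z)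
    (hg : ∀ j z, 0 ≤ g j z) :
    FB v g N w (fun _ _ => c) := by
  have h0 : ∃ C : ℝ, ∀ (i : ι) (z : W), ‖c‖ ≤ C * w i z :=
    ⟨‖c‖, fun i z => le_mul_of_one_le_right (norm_nonneg _) (h1 i z)⟩
  cases N with
  | zero => exact h0
  | succ N =>
    refine ⟨h0, fun j => ?_⟩
    simp_rw [dLine_const]
    exact FB.zero_fun (fun i z => mul_nonneg (hg j z) (hw i z)) hg

theorem FB.sum {s : Finset κ} {f : κ → ι → W → F} (hf : ∀ k i, Sm (f k i))
    (hw : ∀ i z, 0 ≤ w i z) (hg : ∀ j z, 0 ≤ g j z)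
    (h : ∀ k, FB v g N w (f k)) : FB v g N w (fun i z => ∑ k ∈ s, f k i z) := by
  classical
  induction s using Finset.induction_on with
  | empty => simpa using FB.zero_fun hw hg
  | insert k s hk ih =>
    simp_rw [Finset.sum_insert hk]
    exact FB.add (hf k) (fun i => Sm.sum (fun k => hf k i)) (h k) ih

theorem FB.mul {R : Type*} [NormedCommRing R] [NormedAlgebra ℝ R] {f f' : ι → W → R}
    (hf : ∀ i, Sm (f i)) (hf' : ∀ i, Sm (f' i))
    (h : FB v g N w f) (h' : FB v g N w' f') :
    FB v g N (fun i z => w i z * w' i z) (fun i z => f i z * f' i z) := by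
  have h0 : ∃ C : ℝ, ∀ (i : ι) (z : W), ‖f i z * f' i z‖ ≤ C * (w i z * w' i z) := by
    obtain ⟨C, hC⟩ := h.zero; obtain ⟨C', hC'⟩ := h'.zero
    refine ⟨C * C', fun i z => (norm_mul_le _ _).trans ?_⟩
    calc ‖f i z‖ * ‖f' i z‖ ≤ (C * w i z) * (C' * w' i z) :=
          mul_le_mul (hC i z) (hC' i z) (norm_nonneg _) ((norm_nonneg _).trans (hC i z))
      _ = _ := by ring
  induction N generalizing w w' f f' with
  | zero => exact h0
  | succ N ih =>
    refine ⟨h0, fun j => ?_⟩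
    simp_rw [dLine_mul (hf _) (hf' _)]
    have b0 : ∀ {w w' : ι → W → ℝ} {f f' : ι → W → R}, FB v g N w f → FB v g N w' f' →
        ∃ C : ℝ, ∀ (i : ι) (z : W), ‖f i z * f' i z‖ ≤ C * (w i z * w' i z) := by
      intro w w' f f' h h'
      obtain ⟨C, hC⟩ := h.zero; obtain ⟨C', hC'⟩ := h'.zero
      refine ⟨C * C', fun i z => (norm_mul_le _ _).trans ?_⟩
      calc ‖f i z‖ * ‖f' i z‖ ≤ (C * w i z) * (C' * w' i z) :=
            mul_le_mul (hC i z) (hC' i z) (norm_nonneg _) ((norm_nonneg _).trans (hC i z))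
        _ = _ := by ring
    have A := ih (fun i => (hf i).dLine (v j)) hf' (h.2 j) (h'.le (Nat.le_succ N))
      (b0 (h.2 j) (h'.le (Nat.le_succ N)))
    have B := ih hf (fun i => (hf' i).dLine (v j)) (h.le (Nat.le_succ N)) (h'.2 j)
      (b0 (h.le (Nat.le_succ N)) (h'.2 j))
    refine FB.add (fun i => ((hf i).dLine _).mul (hf' i))
      (fun i => (hf i).mul ((hf' i).dLine _)) (A.congrw ?_) (B.congrw ?_)
    · intro i z; ring
    · intro i z; ring

theorem FB.inv {f : ι → W → ℝ} (hf : ∀ i, Sm (f i)) (h : FB v g N w f)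
    (hw : ∀ i z, 0 < w i z) (c : ℝ) (hc : 0 < c) (hl : ∀ i z, c * w i z ≤ f i z) :
    FB v g N (fun i z => (w i z)⁻¹) (fun i z => (f i z)⁻¹) := by
  have hpos : ∀ i z, 0 < f i z := fun i z => lt_of_lt_of_le (mul_pos hc (hw i z)) (hl i z)
  have h0 : ∃ C : ℝ, ∀ (i : ι) (z : W), ‖(f i z)⁻¹‖ ≤ C * (w i z)⁻¹ := by
    refine ⟨c⁻¹, fun i z => ?_⟩
    rw [Real.norm_of_nonneg (inv_nonneg.2 (hpos i z).le), ← mul_inv]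
    exact inv_anti₀ (mul_pos hc (hw i z)) (hl i z)
  have hs : ∀ i, Sm (fun z => (f i z)⁻¹) := fun i => (hf i).inv (fun z => (hpos i z).ne')
  induction N with
  | zero => exact h0
  | succ N ih =>
    refine ⟨h0, fun j => ?_⟩
    have I := ih (h.le (Nat.le_succ N))
    simp_rw [dLine_inv (hf _) (fun z => (hpos _ z).ne')]
    have := FB.clm ((-1 : ℝ) • ContinuousLinearMap.id ℝ ℝ)
      (fun i => ((hs i).mul (hs i)).mul ((hf i).dLine (v j)))
      ((FB.mul hs hs I I).mul (fun i => (hs i).mul (hs i)) (fun i => (hf i).dLine (v j)) (h.2 j))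
    simp only [smul_apply, ContinuousLinearMap.id_apply, smul_eq_mul] at this
    refine this.congrw (fun i z => ?_)
    have := (hw i z).ne'
    field_simp

theorem dLine_comp {W' : Type*} [NormedAddCommGroup W'] [NormedSpace ℝ W']
    {f : W → F} (hf : Sm f) {A : W' → W} {L : W' →L[ℝ] W} (hA : ∀ z, HasFDerivAt A L z) (u : W') :
    dLine u (fun z => f (A z)) = fun z => dLine (L u) f (A z) := by
  funext z; unfold dLine
  have := ((hf.diff (A z)).hasFDerivAt.comp z (hA z)).fderiv
  simp only [Function.comp_def] at this
  rw [this]; rfl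

theorem Sm.affine {W' : Type*} [NormedAddCommGroup W'] [NormedSpace ℝ W']
    {A : W' → W} {L : W' →L[ℝ] W} (hA : ∀ z, HasFDerivAt A L z) : Sm A := by
  have : A = fun z => A 0 + L z := by
    have h : ∀ z, HasFDerivAt (fun z => A z - L z) (0 : W' →L[ℝ] W) z := fun z => by
      have := (hA z).sub (L.hasFDerivAt (x := z))
      rw [sub_self] at this
      exact this
    funext z
    have := is_const_of_fderiv_eq_zero (𝕜 := ℝ) (f := fun z => A z - L z)
      (fun z => (h z).differentiableAt) (fun z => (h z).fderiv) z 0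
    simp at this
    rw [← this]; abel
  rw [this]
  exact contDiff_const.add L.contDiff

theorem Sm.compA {W' : Type*} [NormedAddCommGroup W'] [NormedSpace ℝ W']
    {f : W → F} (hf : Sm f) {A : W' → W} {L : W' →L[ℝ] W} (hA : ∀ z, HasFDerivAt A L z) :
    Sm (fun z => f (A z)) := ContDiff.comp hf (Sm.affine hA)

theorem FB.comp {W' J' : Type*} [NormedAddCommGroup W'] [NormedSpace ℝ W']
    {v' : J' → W'} {g' : J' → W' → ℝ} {f : ι → W → F} (hf : ∀ i, Sm (f i)) (h : FB v g N w f)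
    (hw : ∀ i z, 0 ≤ w i z) (hg : ∀ j z, 0 ≤ g j z) (hg' : ∀ j z, 0 ≤ g' j z)
    (r : κ → ι) (A : κ → W' → W) (L : W' →L[ℝ] W) (hA : ∀ k z, HasFDerivAt (A k) L z)
    (σ : J' → J) (hσ : ∀ j, L (v' j) = v (σ j)) (hgg : ∀ k j z, g (σ j) (A k z) ≤ g' j z) :
    FB v' g' N (fun k z => w (r k) (A k z)) (fun k z => f (r k) (A k z)) := by
  induction N generalizing w f with
  | zero => obtain ⟨C, hC⟩ := h; exact ⟨C, fun k z => hC _ _⟩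
  | succ N ih =>
    obtain ⟨C, hC⟩ := h.1
    refine ⟨⟨C, fun k z => hC _ _⟩, fun j => ?_⟩
    have := ih (fun i => (hf i).dLine (v (σ j))) (h.2 (σ j))
      (fun i z => mul_nonneg (hg _ z) (hw i z))
    simp_rw [dLine_comp (hf _) (hA _), hσ]
    refine this.mono hg' (fun k z => mul_nonneg (hg _ _) (hw _ _)) 1 (fun k z => ?_)
    rw [one_mul]
    exact mul_le_mul_of_nonneg_right (hgg k j z) (hw _ _)

end FBsec

section Had
open Filter Topology

theorem hadamard_inj {V : Type*} [NormedAddCommGroup V] [NormedSpace ℝ V] [CompleteSpace V]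
    (F : V → V) (hF : Continuous F) (D G : V → V →L[ℝ] V)
    (hDG : ∀ x u, D x (G x u) = u) (hGD : ∀ x u, G x (D x u) = u) (hG : Continuous G)
    (B M : ℝ) (hB : 0 < B) (hM : 0 < M) (hGB : ∀ x, ‖G x‖ ≤ B)
    (hT : ∀ x x', ‖F x' - F x - D x (x' - x)‖ ≤ M * ‖x' - x‖ ^ 2) (x x₁ : V) :
    ‖x - x₁‖ ≤ 2 * B * ‖F x - F x₁‖ := by
  set z := F x₁ with hz
  set e : V → ℝ := fun x => ‖F x - z‖ with he
  have hec : Continuous e := (hF.sub continuous_const).norm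
  have he0 : ∀ x, 0 ≤ e x := fun x => norm_nonneg _
  set h : V → ℝ := fun x => (1 + 2 * M * B ^ 2 * e x)⁻¹ with hh
  have hden : ∀ x, 0 < 1 + 2 * M * B ^ 2 * e x := fun x => by have := he0 x; positivity
  have hhc : Continuous h := Continuous.inv₀ (by fun_prop) (fun x => (hden x).ne')
  have hh0 : ∀ x, 0 < h x := fun x => inv_pos.2 (hden x)
  have hh1 : ∀ x, h x ≤ 1 := fun x => inv_le_one_of_one_le₀ (by
    have := he0 x; have : 0 ≤ 2 * M * B ^ 2 * e x := by positivity
    linarith)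
  have hhe : ∀ x, M * B ^ 2 * (h x * e x) ≤ 1 / 2 := fun x => by
    have h1 : h x * (1 + 2 * M * B ^ 2 * e x) = 1 := inv_mul_cancel₀ (hden x).ne'
    nlinarith [hh0 x]
  set Nw : V → V := fun x => x - h x • G x (F x - z) with hNw
  have hNc : Continuous Nw := by
    apply Continuous.sub continuous_id
    apply hhc.smul
    exact hG.clm_apply (hF.sub continuous_const)
  have hstep : ∀ x, ‖Nw x - x‖ ≤ B * (h x * e x) := fun x => by
    have : Nw x - x = -(h x • G x (F x - z)) := by simp [hNw]
    rw [this, norm_neg, norm_smul, Real.norm_of_nonneg (hh0 x).le]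
    calc h x * ‖G x (F x - z)‖ ≤ h x * (B * e x) := by
          gcongr
          exact (G x).le_of_opNorm_le (hGB x) _
      _ = _ := by ring
  have hdec : ∀ x, e (Nw x) ≤ e x - h x * e x / 2 := fun x => by
    have h1 : F (Nw x) - z = (F (Nw x) - F x - D x (Nw x - x)) + (1 - h x) • (F x - z) := by
      have : Nw x - x = -(h x • G x (F x - z)) := by simp [hNw]
      rw [this, map_neg, map_smul, hDG, sub_smul, one_smul]; abel
    have h2 : e (Nw x) ≤ M * (B * (h x * e x)) ^ 2 + (1 - h x) * e x := by
      simp only [he]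
      rw [h1]
      refine (norm_add_le _ _).trans (add_le_add ((hT _ _).trans ?_) ?_)
      · gcongr; exact hstep x
      · rw [norm_smul, Real.norm_of_nonneg (by linarith [hh1 x])]
    have h3 : M * (B * (h x * e x)) ^ 2 ≤ 1 / 2 * (h x * e x) := by
      calc M * (B * (h x * e x)) ^ 2 = (M * B ^ 2 * (h x * e x)) * (h x * e x) := by ring
        _ ≤ _ := mul_le_mul_of_nonneg_right (hhe x) (mul_nonneg (hh0 x).le (he0 x))
    linarith
  have hsd : ∀ x, ‖Nw x - x‖ ≤ 2 * B * (e x - e (Nw x)) := fun x => by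
    refine (hstep x).trans ?_
    have := hdec x
    nlinarith
  have hlim : ∀ x, ∃ P, F P = z ∧ ‖x - P‖ ≤ 2 * B * e x ∧
      Tendsto (fun k => Nw^[k] x) atTop (𝓝 P) := by
    intro x
    set s : ℕ → V := fun k => Nw^[k] x with hs
    set d : ℕ → ℝ := fun k => 2 * B * (e (s k) - e (s (k + 1))) with hd
    have hss : ∀ k, s (k + 1) = Nw (s k) := fun k => Function.iterate_succ_apply' _ _ _
    have hdist : ∀ k, dist (s k) (s (k + 1)) ≤ d k := fun k => by
      rw [dist_comm, dist_eq_norm, hd]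
      simp only
      rw [hss]; exact hsd _
    have hd0 : ∀ k, 0 ≤ d k := fun k => dist_nonneg.trans (hdist k)
    have hsum : ∀ k, ∑ i ∈ Finset.range k, d i ≤ 2 * B * e x := fun k => by
      rw [hd, ← Finset.mul_sum, Finset.sum_range_sub']
      have : s 0 = x := rfl
      rw [this]
      have := he0 (s k)
      nlinarith
    have hsm : Summable d := summable_of_sum_range_le hd0 hsum
    obtain ⟨P, hP⟩ := cauchySeq_tendsto_of_complete (cauchySeq_of_dist_le_of_summable d hdist hsm)
    refine ⟨P, ?_, ?_, hP⟩
    · have h1 : Tendsto (fun k => s (k + 1)) atTop (𝓝 P) := hP.comp (tendsto_add_atTop_nat 1)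
      have h2 : Tendsto (fun k => s (k + 1)) atTop (𝓝 (Nw P)) := by
        simp_rw [hss]; exact (hNc.tendsto P).comp hP
      have h3 : Nw P = P := tendsto_nhds_unique h2 h1
      have h4 := hdec P
      rw [h3] at h4
      have h5 : e P = 0 := by
        have := mul_nonneg (hh0 P).le (he0 P)
        have h6 : h P * e P = 0 := by linarith
        exact (mul_eq_zero.1 h6).resolve_left (hh0 P).ne'
      exact sub_eq_zero.1 (norm_eq_zero.1 h5)
    · rw [← dist_eq_norm]
      refine (dist_le_tsum_of_dist_le_of_tendsto₀ d hdist hsm hP).trans ?_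
      exact hsm.tsum_le_of_sum_range_le hsum
  choose P hPz hPd hPt using hlim
  have hsep : ∀ p p', F p = z → F p' = z → ‖p' - p‖ < (B * M)⁻¹ → p' = p := by
    intro p p' h1 h2 h3
    have h4 := hT p p'
    rw [h1, h2, sub_self, zero_sub, norm_neg] at h4
    have h5 : ‖p' - p‖ ≤ B * ‖D p (p' - p)‖ := by
      have := (G p).le_of_opNorm_le (hGB p) (D p (p' - p))
      rwa [hGD] at this
    have h6 : ‖p' - p‖ ≤ (B * M * ‖p' - p‖) * ‖p' - p‖ := by
      calc _ ≤ _ := h5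
        _ ≤ B * (M * ‖p' - p‖ ^ 2) := by gcongr
        _ = _ := by ring
    have h7 : B * M * ‖p' - p‖ < 1 := by
      calc B * M * ‖p' - p‖ < B * M * (B * M)⁻¹ := by gcongr
        _ = 1 := mul_inv_cancel₀ (by positivity)
    by_contra hne
    have : 0 < ‖p' - p‖ := norm_pos_iff.2 (sub_ne_zero.2 hne)
    nlinarith
  have hloc : IsLocallyConstant P := by
    rw [IsLocallyConstant.iff_eventually_eq]
    intro x
    have hδ : 0 < (B * M)⁻¹ := by positivity
    have hU : IsOpen {q | ‖q - P x‖ + 2 * B * e q < (B * M)⁻¹} :=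
      isOpen_lt (by fun_prop) continuous_const
    have hpU : P x ∈ {q | ‖q - P x‖ + 2 * B * e q < (B * M)⁻¹} := by
      simp only [Set.mem_ofPred_eq, sub_self, norm_zero, he, hPz]
      simpa using hδ
    obtain ⟨k, hk⟩ := ((hPt x).eventually (hU.mem_nhds hpU)).exists
    have := (hNc.iterate k).continuousAt.eventually (hU.mem_nhds hk)
    filter_upwards [this] with y hy
    have hPy : P (Nw^[k] y) = P y := by
      refine tendsto_nhds_unique (hPt (Nw^[k] y)) ?_
      have := (hPt y).comp (tendsto_add_atTop_nat k)
      refine this.congr (fun j => ?_)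
      simp [Function.iterate_add_apply]
    apply hsep _ _ (hPz x) (hPz y)
    have h1 := hPd (Nw^[k] y)
    rw [hPy] at h1
    have h2 : ‖P y - P x‖ ≤ ‖Nw^[k] y - P y‖ + ‖Nw^[k] y - P x‖ := by
      have : P y - P x = (Nw^[k] y - P x) - (Nw^[k] y - P y) := by abel
      rw [this]; exact (norm_sub_le _ _).trans (by rw [add_comm])
    have h3 : ‖Nw^[k] y - P x‖ + 2 * B * e (Nw^[k] y) < (B * M)⁻¹ := hy
    linarith
  have hc : P x = P x₁ := hloc.apply_eq_of_preconnectedSpace x x₁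
  have h1 : P x₁ = x₁ := by
    have := hPd x₁
    simp only [he, ← hz, sub_self, norm_zero, mul_zero] at this
    exact (sub_eq_zero.1 (norm_eq_zero.1 (le_antisymm this (norm_nonneg _)))).symm
  have := hPd x
  rwa [hc, h1] at this

end Had

section HadE
variable {n : ℕ}

/-- Euclidean space -/
abbrev En (n : ℕ) := EuclideanSpace ℝ (Fin n)

/-- coordinate vectors -/
def e1 (i : Fin n) : En n := EuclideanSpace.single i 1

theorem En_sum (u : En n) : u = ∑ k, u k • e1 k := by
  have := (EuclideanSpace.basisFun (Fin n) ℝ).sum_repr u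
  simpa [e1] using this.symm

theorem En_norm_le (u : En n) : ‖u‖ ≤ ∑ k, |u k| := by
  conv_lhs => rw [En_sum u]
  refine (norm_sum_le _ _).trans (le_of_eq ?_)
  refine Finset.sum_congr rfl (fun k _ => ?_)
  simp [norm_smul, e1]

theorem En_coord_le (u : En n) (k : Fin n) : |u k| ≤ ‖u‖ := by
  simpa using PiLp.norm_apply_le u k

theorem fderiv_eq_sum {F : Type*} [NormedAddCommGroup F] [NormedSpace ℝ F] (f : En n → F)
    (x u : En n) : fderiv ℝ f x u = ∑ k, u k • dLine (e1 k) f x := by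
  conv_lhs => rw [En_sum u]
  simp [dLine]

theorem fderiv_norm_le_of_partials {F : Type*} [NormedAddCommGroup F] [NormedSpace ℝ F]
    {f : En n → F} {A : ℝ} (x : En n) (h : ∀ k, ‖dLine (e1 k) f x‖ ≤ A) :
    ‖fderiv ℝ f x‖ ≤ n * |A| := by
  refine ContinuousLinearMap.opNorm_le_bound _ (by positivity) (fun u => ?_)
  rw [fderiv_eq_sum]
  refine (norm_sum_le _ _).trans ?_
  calc ∑ k, ‖u k • dLine (e1 k) f x‖ ≤ ∑ _k : Fin n, ‖u‖ * |A| := by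
        refine Finset.sum_le_sum (fun k _ => ?_)
        rw [norm_smul]
        exact mul_le_mul (En_coord_le u k) ((h k).trans (le_abs_self A)) (norm_nonneg _)
          (norm_nonneg _)
    _ = _ := by simp; ring

theorem lip_of_partials {F : Type*} [NormedAddCommGroup F] [NormedSpace ℝ F]
    {f : En n → F} (hf : Differentiable ℝ f) {A : ℝ} (h : ∀ x k, ‖dLine (e1 k) f x‖ ≤ A)
    (x y : En n) : ‖f y - f x‖ ≤ n * |A| * ‖y - x‖ :=
  Convex.norm_image_sub_le_of_norm_fderiv_le (fun z _ => hf z)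
    (fun z _ => fderiv_norm_le_of_partials z (h z)) convex_univ (Set.mem_univ x) (Set.mem_univ y)

theorem taylor_of_partials {f : En n → ℝ} (hf : Sm f) {A : ℝ}
    (h : ∀ x k l, ‖dLine (e1 l) (dLine (e1 k) f) x‖ ≤ A) (x y : En n) :
    |f y - f x - fderiv ℝ f x (y - x)| ≤ n * (n * |A|) * ‖y - x‖ ^ 2 := by
  have h1 : ∀ x y : En n, ‖fderiv ℝ f y - fderiv ℝ f x‖ ≤ n * (n * |A|) * ‖y - x‖ := by
    intro x y
    refine ContinuousLinearMap.opNorm_le_bound _ (by positivity) (fun u => ?_)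
    rw [sub_apply, fderiv_eq_sum, fderiv_eq_sum, ← Finset.sum_sub_distrib]
    refine (norm_sum_le _ _).trans ?_
    calc ∑ k, ‖u k • dLine (e1 k) f y - u k • dLine (e1 k) f x‖
        ≤ ∑ _k : Fin n, ‖u‖ * (n * |A| * ‖y - x‖) := by
          refine Finset.sum_le_sum (fun k _ => ?_)
          rw [← smul_sub, norm_smul]
          exact mul_le_mul (En_coord_le u k)
            (lip_of_partials (hf.dLine (e1 k)).diff (fun x l => h x k l) x y)
            (norm_nonneg _) (norm_nonneg _)
      _ = _ := by simp; ring
  have := (convex_closedBall x ‖y - x‖).norm_image_sub_le_of_norm_hasFDerivWithin_le' (𝕜 := ℝ)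
    (f := f) (f' := fderiv ℝ f) (φ := fderiv ℝ f x) (C := n * (n * |A|) * ‖y - x‖) (x := x) (y := y)
    (fun z _ => (hf.diff z).hasFDerivAt.hasFDerivWithinAt)
    (fun z hz => (h1 x z).trans (by
      have hz' : ‖z - x‖ ≤ ‖y - x‖ := by simpa [dist_eq_norm] using hz
      gcongr))
    (by simp) (by simp [dist_eq_norm])
  rw [Real.norm_eq_abs] at this
  refine this.trans (le_of_eq (by ring))

/-- the candidate inverse -/
def matG (M : Matrix (Fin n) (Fin n) ℝ) : En n →L[ℝ] En n :=
  Matrix.toEuclideanCLM (𝕜 := ℝ) (M.det⁻¹ • M.adjugate)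

theorem toE_cont : Continuous (fun M : Matrix (Fin n) (Fin n) ℝ =>
    (Matrix.toEuclideanCLM (𝕜 := ℝ) M : En n →L[ℝ] En n)) :=
  LinearMap.continuous_of_finiteDimensional
    ({ toFun := fun M => Matrix.toEuclideanCLM (𝕜 := ℝ) M
       map_add' := fun M M' => map_add _ M M'
       map_smul' := fun c M => map_smul _ c M } :
      Matrix (Fin n) (Fin n) ℝ →ₗ[ℝ] (En n →L[ℝ] En n))

theorem matG_cont : ContinuousOn (matG (n := n)) {M | M.det ≠ 0} := by
  apply toE_cont.comp_continuousOn
  refine ContinuousOn.smul (f := fun M : Matrix (Fin n) (Fin n) ℝ => M.det⁻¹)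
    (g := fun M : Matrix (Fin n) (Fin n) ℝ => M.adjugate) ?_ ?_
  · exact ContinuousOn.inv₀ (Continuous.matrix_det continuous_id).continuousOn (fun M h => h)
  · exact (Continuous.matrix_adjugate continuous_id).continuousOn

theorem matG_bound (n : ℕ) (A C₀ : ℝ) (hC₀ : 0 < C₀) : ∃ B : ℝ, 0 < B ∧
    ∀ M : Matrix (Fin n) (Fin n) ℝ, (∀ i j, |M i j| ≤ A) → C₀ ≤ |M.det| → ‖matG M‖ ≤ B := by
  have hK : IsCompact {M : Matrix (Fin n) (Fin n) ℝ | (∀ i j, |M i j| ≤ A) ∧ C₀ ≤ |M.det|} := by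
    have h1 : IsCompact (Set.pi Set.univ fun _ : Fin n => Set.pi Set.univ fun _ : Fin n =>
        Set.Icc (-A) A) :=
      isCompact_univ_pi (fun _ => isCompact_univ_pi (fun _ => isCompact_Icc))
    have h2 : IsClosed {M : Matrix (Fin n) (Fin n) ℝ | C₀ ≤ |M.det|} :=
      isClosed_le continuous_const (Continuous.matrix_det continuous_id).abs
    refine (h1.inter_right h2).of_isClosed_subset ?_ ?_
    · refine IsClosed.inter ?_ h2
      have h3 : ({M | ∀ i j, |M i j| ≤ A} : Set (Matrix (Fin n) (Fin n) ℝ)) =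
          ⋂ i, ⋂ j, {M : Matrix (Fin n) (Fin n) ℝ | |M i j| ≤ A} := by ext M; simp
      change IsClosed {M : Matrix (Fin n) (Fin n) ℝ | ∀ i j, |M i j| ≤ A}
      rw [h3]
      exact isClosed_iInter fun i => isClosed_iInter fun j =>
        isClosed_le (continuous_id.matrix_elem i j).abs continuous_const
    · intro M hM
      refine ⟨?_, hM.2⟩
      simp only [Set.mem_pi, Set.mem_univ, forall_true_left, Set.mem_Icc]
      intro i j
      exact abs_le.1 (hM.1 i j)
  have hc : ContinuousOn (fun M : Matrix (Fin n) (Fin n) ℝ => matG M)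
      {M : Matrix (Fin n) (Fin n) ℝ | (∀ i j, |M i j| ≤ A) ∧ C₀ ≤ |M.det|} :=
    matG_cont.mono (fun M hM h0 => by
      have := hM.2
      rw [h0] at this
      simp at this
      linarith)
  obtain ⟨B, hB⟩ := hK.exists_bound_of_continuousOn hc
  exact ⟨|B| + 1, by positivity, fun M h1 h2 => (hB M ⟨h1, h2⟩).trans
    (by linarith [le_abs_self B])⟩

theorem hadE (n : ℕ) (A C₀ : ℝ) (hC₀ : 0 < C₀) : ∃ c : ℝ, 0 < c ∧ ∀ f : Fin n → En n → ℝ,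
    (∀ j, Sm (f j)) → (∀ j k x, |dLine (e1 k) (f j) x| ≤ A) →
    (∀ j k l x, |dLine (e1 l) (dLine (e1 k) (f j)) x| ≤ A) →
    (∀ x, C₀ ≤ |Matrix.det (Matrix.of fun k j => dLine (e1 k) (f j) x)|) →
    ∀ x x', ‖x - x'‖ ^ 2 ≤ c * ∑ j, (f j x - f j x') ^ 2 := by
  obtain ⟨B, hB, hGB⟩ := matG_bound n A C₀ hC₀
  refine ⟨(2 * B) ^ 2, by positivity, fun f hf h1 h2 hdet x x' => ?_⟩
  let H : En n → Matrix (Fin n) (Fin n) ℝ := fun x => Matrix.of fun j k => dLine (e1 k) (f j) x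
  have hHdet : ∀ x, C₀ ≤ |(H x).det| := fun x => by
    rw [← Matrix.det_transpose]; exact hdet x
  have hH0 : ∀ x, (H x).det ≠ 0 := fun x h0 => by
    have := hHdet x; rw [h0] at this; simp at this; linarith
  have hHc : Continuous H := continuous_matrix (fun j k => ((hf j).dLine (e1 k)).cont)
  let F : En n → En n := fun x => WithLp.toLp 2 (fun j => f j x)
  have hFc : Continuous F := by
    apply (PiLp.continuous_toLp 2 _).comp
    exact continuous_pi (fun j => (hf j).cont)
  have hDG : ∀ (M : Matrix (Fin n) (Fin n) ℝ) (u : En n), M.det ≠ 0 →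
      Matrix.toEuclideanCLM (𝕜 := ℝ) M (matG M u) = u := by
    intro M u h0
    have : Matrix.toEuclideanCLM (𝕜 := ℝ) M * matG M = 1 := by
      rw [matG, ← map_mul, Matrix.mul_smul, Matrix.mul_adjugate, smul_smul,
        inv_mul_cancel₀ h0, one_smul, map_one]
    exact congrArg (fun L : En n →L[ℝ] En n => L u) this
  have hGD : ∀ (M : Matrix (Fin n) (Fin n) ℝ) (u : En n), M.det ≠ 0 →
      matG M (Matrix.toEuclideanCLM (𝕜 := ℝ) M u) = u := by
    intro M u h0
    have : matG M * Matrix.toEuclideanCLM (𝕜 := ℝ) M = 1 := by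
      rw [matG, ← map_mul, Matrix.smul_mul, Matrix.adjugate_mul, smul_smul,
        inv_mul_cancel₀ h0, one_smul, map_one]
    exact congrArg (fun L : En n →L[ℝ] En n => L u) this
  have hDF : ∀ x u j, (Matrix.toEuclideanCLM (𝕜 := ℝ) (H x) u) j = fderiv ℝ (f j) x u := by
    intro x u j
    rw [fderiv_eq_sum]
    simp [H, Matrix.mulVec, dotProduct, mul_comm]
  have key := hadamard_inj F hFc (fun x => Matrix.toEuclideanCLM (𝕜 := ℝ) (H x))
    (fun x => matG (H x)) (fun x u => hDG _ u (hH0 x)) (fun x u => hGD _ u (hH0 x))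
    (matG_cont.comp_continuous hHc hH0) B (n * (n * (n * |A|)) + 1) hB (by positivity)
    (fun x => hGB _ (fun i j => h1 i j x) (hHdet x)) ?_ x x'
  · have h3 : ‖F x - F x'‖ ^ 2 = ∑ j, (f j x - f j x') ^ 2 := by
      rw [EuclideanSpace.real_norm_sq_eq]; simp [F]
    rw [← h3, ← mul_pow]
    gcongr
  · intro x x'
    refine (En_norm_le _).trans ?_
    calc ∑ j, |(F x' - F x - Matrix.toEuclideanCLM (𝕜 := ℝ) (H x) (x' - x)) j|
        ≤ ∑ _j : Fin n, n * (n * |A|) * ‖x' - x‖ ^ 2 := by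
          refine Finset.sum_le_sum (fun j _ => ?_)
          rw [PiLp.sub_apply, hDF, PiLp.sub_apply]
          exact taylor_of_partials (hf j) (fun x k l => h2 j k l x) x x'
      _ = n * (n * (n * |A|)) * ‖x' - x‖ ^ 2 := by simp; ring
      _ ≤ _ := by nlinarith [sq_nonneg ‖x' - x‖]

end HadE

section Jap
variable {n : ℕ}

theorem jap_sq (x : En n) : jap x ^ 2 = 1 + ‖x‖ ^ 2 := by
  unfold jap; rw [Real.sq_sqrt (by positivity)]

theorem jap_one_le (x : En n) : 1 ≤ jap x := by
  unfold jap; rw [Real.one_le_sqrt]; nlinarith [sq_nonneg ‖x‖]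

theorem jap_pos (x : En n) : 0 < jap x := lt_of_lt_of_le one_pos (jap_one_le x)

theorem norm_le_jap (x : En n) : ‖x‖ ≤ jap x := by
  unfold jap; exact Real.le_sqrt_of_sq_le (by linarith)

theorem jap_le (x : En n) : jap x ≤ 1 + ‖x‖ := by
  unfold jap; rw [Real.sqrt_le_left (by positivity)]; nlinarith [norm_nonneg x]

theorem le_jap (x : En n) : 1 + ‖x‖ ≤ 2 * jap x := by
  linarith [jap_one_le x, norm_le_jap x]

theorem jap_add_le (x y : En n) : jap (x + y) ≤ 2 * (jap x * jap y) := by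
  have h1 := jap_le (x + y)
  have h2 := norm_add_le x y
  have h3 := norm_le_jap x
  have h4 := norm_le_jap y
  have h5 : jap (x + y) ^ 2 ≤ (2 * (jap x * jap y)) ^ 2 := by
    rw [mul_pow, mul_pow, jap_sq, jap_sq, jap_sq]
    have : ‖x + y‖ ^ 2 ≤ (‖x‖ + ‖y‖) ^ 2 := by gcongr
    nlinarith [sq_nonneg (‖x‖ - ‖y‖), sq_nonneg (‖x‖ * ‖y‖)]
  exact le_of_sq_le_sq h5 (by have := jap_pos x; have := jap_pos y; positivity)
where
  le_of_sq_le_sq {a b : ℝ} (h : a ^ 2 ≤ b ^ 2) (hb : 0 ≤ b) : a ≤ b :=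
    abs_le_of_sq_le_sq' h hb |>.2

theorem jap_neg (x : En n) : jap (-x) = jap x := by unfold jap; rw [norm_neg]

theorem jap_sub_comm (x y : En n) : jap (x - y) = jap (y - x) := by
  rw [← jap_neg, neg_sub]

/-- Peetre -/
theorem jap_peetre (y p p' : En n) : (jap (y - p'))⁻¹ ≤ 2 * (jap (p - p'))⁻¹ * jap (y - p) := by
  have h := jap_add_le (p - y) (y - p')
  rw [sub_add_sub_cancel, jap_sub_comm p y] at h
  have h1 := jap_pos (p - p')
  have h2 := jap_pos (y - p')
  rw [inv_le_iff_one_le_mul₀ h2]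
  calc (1 : ℝ) = (jap (p - p'))⁻¹ * jap (p - p') := by field_simp
    _ ≤ (jap (p - p'))⁻¹ * (2 * (jap (y - p) * jap (y - p'))) := by gcongr
    _ = _ := by ring

theorem jap_cont : Continuous (jap (n := n)) := by
  unfold jap; fun_prop

theorem Sm_coord (j : Fin n) : Sm (fun x : En n => x j) :=
  (EuclideanSpace.proj (𝕜 := ℝ) j : En n →L[ℝ] ℝ).contDiff

theorem dLine_coord (k j : Fin n) :
    dLine (e1 k) (fun x : En n => x j) = fun _ => if j = k then 1 else 0 := by
  funext x
  unfold dLine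
  have : (fun x : En n => x j) = (EuclideanSpace.proj (𝕜 := ℝ) j : En n →L[ℝ] ℝ) := rfl
  rw [this, ContinuousLinearMap.fderiv]
  simp [e1]

theorem Sm_jap_rpow (q : ℝ) : Sm (fun x : En n => jap x ^ q) := by
  have h1 : Sm (fun x : En n => 1 + ‖x‖ ^ 2) := by
    unfold Sm; exact contDiff_const.add (contDiff_norm_sq ℝ)
  unfold Sm jap
  refine ContDiff.rpow_const_of_ne (ContDiff.sqrt h1 (fun x => by positivity)) (fun x => ?_)
  positivity

theorem dLine_jap_rpow (q : ℝ) (j : Fin n) :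
    dLine (e1 j) (fun x : En n => jap x ^ q) = fun x => q * (x j * jap x ^ (q - 2)) := by
  funext x
  unfold dLine
  have e : (fun x : En n => jap x ^ q) = fun x : En n => (1 + ‖x‖ ^ 2) ^ (q / 2) := by
    funext x
    rw [← jap_sq, ← Real.rpow_natCast, ← Real.rpow_mul (jap_pos x).le]
    congr 1; push_cast; ring
  have h1 : HasFDerivAt (fun x : En n => 1 + ‖x‖ ^ 2) (2 • (innerSL ℝ x)) x :=
    (hasStrictFDerivAt_norm_sq x).hasFDerivAt.const_add 1
  have h2 := h1.rpow_const (p := q / 2) (Or.inl (by positivity))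
  rw [e, h2.fderiv]
  simp only [smul_apply, innerSL_apply_apply, smul_eq_mul]
  have h3 : (1 + ‖x‖ ^ 2) ^ (q / 2 - 1) = jap x ^ (q - 2) := by
    rw [← jap_sq, ← Real.rpow_natCast, ← Real.rpow_mul (jap_pos x).le]
    congr 1; push_cast; ring
  have h4 : inner ℝ x (e1 j) = x j := by
    rw [e1, EuclideanSpace.inner_single_right]; simp
  rw [h3, h4]; simp; ring

/-- the isotropic gauge -/
def gj : Fin n → En n → ℝ := fun _ x => (jap x)⁻¹
/-- the trivial gauge -/
def g1 {J W : Type*} : J → W → ℝ := fun _ _ => 1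

theorem gj_nonneg (j : Fin n) (x : En n) : 0 ≤ gj j x := inv_nonneg.2 (jap_pos x).le
theorem g1_nonneg {J W : Type*} (j : J) (x : W) : 0 ≤ g1 j x := zero_le_one

theorem FB_coord {ι : Type*} (N : ℕ) (j : Fin n) :
    FB e1 gj N (fun (_ : ι) x => jap x) (fun (_ : ι) x => x j) := by
  have h0 : ∃ C : ℝ, ∀ (_ : ι) (x : En n), ‖x j‖ ≤ C * jap x :=
    ⟨1, fun _ x => by rw [one_mul]; exact (En_coord_le x j).trans (norm_le_jap x)⟩
  cases N with
  | zero => exact h0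
  | succ N =>
    refine ⟨h0, fun k => ?_⟩
    simp_rw [dLine_coord]
    refine FB.const _ (fun i x => ?_) (fun i x => ?_) gj_nonneg
    · exact mul_nonneg (gj_nonneg k x) (jap_pos x).le
    · simp [gj, inv_mul_cancel₀ (jap_pos x).ne']

theorem FB_jap {ι : Type*} (N : ℕ) (q : ℝ) :
    FB e1 gj N (fun (_ : ι) x => jap x ^ q) (fun (_ : ι) (x : En n) => jap x ^ q) := by
  have h0 : ∀ q : ℝ, ∃ C : ℝ, ∀ (_ : ι) (x : En n), ‖jap x ^ q‖ ≤ C * jap x ^ q := fun q =>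
    ⟨1, fun _ x => by rw [one_mul, Real.norm_of_nonneg (Real.rpow_nonneg (jap_pos x).le _)]⟩
  induction N generalizing q with
  | zero => exact h0 q
  | succ N ih =>
    refine ⟨h0 q, fun j => ?_⟩
    simp_rw [dLine_jap_rpow]
    have := FB.clm (q • ContinuousLinearMap.id ℝ ℝ) (fun _ => (Sm_coord j).mul (Sm_jap_rpow (q - 2)))
      (FB.mul (fun _ => Sm_coord j) (fun _ => Sm_jap_rpow (q - 2)) (FB_coord (ι := ι) N j) (ih (q - 2)))
    simp only [smul_apply, ContinuousLinearMap.id_apply, smul_eq_mul] at this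
    refine this.congrw (fun i x => ?_)
    have hx := jap_pos x
    rw [gj]
    rw [show q - 2 = q + (-2 : ℝ) by ring, Real.rpow_add hx, Real.rpow_neg hx.le]
    have : jap x ^ (2 : ℝ) = jap x ^ 2 := by norm_cast
    rw [this]
    field_simp

end Jap

section Conv
variable {n : ℕ} {W F ι J : Type*} [NormedAddCommGroup W] [NormedSpace ℝ W]
  [NormedAddCommGroup F] [NormedSpace ℝ F]

/-- iterated derivative along a list of directions -/
def ld (v : J → W) (l : List J) (f : W → F) : W → F := l.foldr (fun j h => dLine (v j) h) f

theorem ld_append_singleton (v : J → W) (l : List J) (j : J) (f : W → F) :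
    ld v (l ++ [j]) f = ld v l (dLine (v j) f) := by
  unfold ld; rw [List.foldr_append]; rfl

theorem Sm.ld {v : J → W} {l : List J} {f : W → F} (h : Sm f) : Sm (ld v l f) := by
  induction l with
  | nil => exact h
  | cons j l ih => exact Sm.dLine ih (v j)

/-- product of gauges -/
def gl (g : J → W → ℝ) (l : List J) (z : W) : ℝ := (l.map (fun j => g j z)).prod

theorem FB_of_ld {v : J → W} {g : J → W → ℝ} {N : ℕ} {w : ι → W → ℝ} {f : ι → W → F}
    (h : ∀ l : List J, l.length ≤ N → ∃ C : ℝ, ∀ i z, ‖ld v l (f i) z‖ ≤ C * (gl g l z * w i z)) :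
    FB v g N w f := by
  have h0 : ∃ C : ℝ, ∀ i z, ‖f i z‖ ≤ C * w i z := by
    obtain ⟨C, hC⟩ := h [] (by simp)
    exact ⟨C, fun i z => by simpa [ld, gl] using hC i z⟩
  induction N generalizing w f with
  | zero => exact h0
  | succ N ih =>
    refine ⟨h0, fun j => ?_⟩
    have key : ∀ l : List J, l.length ≤ N → ∃ C : ℝ, ∀ i z,
        ‖ld v l (dLine (v j) (f i)) z‖ ≤ C * (gl g l z * (g j z * w i z)) := by
      intro l hl
      obtain ⟨C, hC⟩ := h (l ++ [j]) (by simpa using hl)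
      refine ⟨C, fun i z => ?_⟩
      have := hC i z
      rw [ld_append_singleton] at this
      refine this.trans (le_of_eq ?_)
      simp only [gl, List.map_append, List.map_cons, List.map_nil, List.prod_append, List.prod_singleton]; ring
    refine ih key ?_
    obtain ⟨C, hC⟩ := key [] (by simp)
    exact ⟨C, fun i z => by simpa [ld, gl] using hC i z⟩

theorem Sm.iter {v : W} {k : ℕ} {f : W → F} (h : Sm f) : Sm ((_root_.dLine v (F := F))^[k] f) := by
  induction k generalizing f with
  | zero => exact h
  | succ k ih => exact ih (h.dLine v)

theorem dLine_iter_comm {v u : W} {k : ℕ} {f : W → F} (h : Sm f) :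
    dLine u ((dLine v (F := F))^[k] f) = (dLine v (F := F))^[k] (dLine u f) := by
  induction k generalizing f with
  | zero => rfl
  | succ k ih =>
    rw [Function.iterate_succ_apply, Function.iterate_succ_apply, ih (h.dLine v), dLine_comm h]

/-- list version of `mderiv` -/
def mop (dirs : Fin n → W) (α : Fin n → ℕ) (l : List (Fin n)) (f : W → F) : W → F :=
  ((l.map fun i => (dLine (dirs i) (F := F))^[α i]).foldr (· ∘ ·) id) f

theorem mderiv_eq_mop (dirs : Fin n → W) (α : Fin n → ℕ) (f : W → F) :
    mderiv dirs α f = mop dirs α (List.finRange n) f := by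
  unfold mderiv mop; rw [List.ofFn_eq_map]

theorem mop_cons (dirs : Fin n → W) (α : Fin n → ℕ) (i : Fin n) (l : List (Fin n)) (f : W → F) :
    mop dirs α (i :: l) f = (dLine (dirs i) (F := F))^[α i] (mop dirs α l f) := rfl

theorem Sm.mop {dirs : Fin n → W} {α : Fin n → ℕ} {l : List (Fin n)} {f : W → F} (h : Sm f) :
    Sm (mop dirs α l f) := by
  induction l with
  | nil => exact h
  | cons i l ih => rw [mop_cons]; exact Sm.iter ih

theorem dLine_mop {dirs : Fin n → W} {α : Fin n → ℕ} {l : List (Fin n)} {f : W → F} (h : Sm f)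
    (u : W) : dLine u (_root_.mop dirs α l f) = _root_.mop dirs α l (dLine u f) := by
  induction l with
  | nil => rfl
  | cons i l ih => rw [mop_cons, mop_cons, dLine_iter_comm h.mop, ih]

theorem mop_notMem {dirs : Fin n → W} {α : Fin n → ℕ} {l : List (Fin n)} {f : W → F} {i : Fin n}
    (hi : i ∉ l) (k : ℕ) : mop dirs (Function.update α i k) l f = mop dirs α l f := by
  induction l with
  | nil => rfl
  | cons j l ih =>
    rw [List.mem_cons, not_or] at hi
    rw [mop_cons, mop_cons, ih hi.2, Function.update_of_ne (Ne.symm hi.1)]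

theorem mop_succ {dirs : Fin n → W} {α : Fin n → ℕ} {l : List (Fin n)} {f : W → F} {i : Fin n}
    (h : Sm f) (hl : l.Nodup) (hi : i ∈ l) :
    mop dirs (Function.update α i (α i + 1)) l f = dLine (dirs i) (mop dirs α l f) := by
  induction l with
  | nil => simp at hi
  | cons j l ih =>
    rw [List.nodup_cons] at hl
    rw [mop_cons, mop_cons]
    by_cases hij : i = j
    · subst hij
      rw [Function.update_self, mop_notMem hl.1, Function.iterate_succ_apply']
    · rw [ih hl.2 (by simpa [hij] using hi), Function.update_of_ne (Ne.symm hij),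
        dLine_iter_comm h.mop]

theorem Sm.mderiv {dirs : Fin n → W} {α : Fin n → ℕ} {f : W → F} (h : Sm f) :
    Sm (mderiv dirs α f) := by rw [mderiv_eq_mop]; exact h.mop

theorem mderiv_succ {dirs : Fin n → W} {α : Fin n → ℕ} {f : W → F} (i : Fin n) (h : Sm f) :
    dLine (dirs i) (mderiv dirs α f) = mderiv dirs (Function.update α i (α i + 1)) f := by
  rw [mderiv_eq_mop, mderiv_eq_mop, mop_succ h (List.nodup_finRange n) (List.mem_finRange i)]

theorem dLine_mderiv {dirs : Fin n → W} {α : Fin n → ℕ} {f : W → F} (h : Sm f) (u : W) :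
    dLine u (mderiv dirs α f) = mderiv dirs α (dLine u f) := by
  rw [mderiv_eq_mop, mderiv_eq_mop, dLine_mop h]

theorem mderiv_zero (dirs : Fin n → W) (f : W → F) : mderiv dirs 0 f = f := by
  rw [mderiv_eq_mop]
  induction (List.finRange n) with
  | nil => rfl
  | cons i l ih => rw [mop_cons, ih]; rfl

theorem mdeg_update (α : Fin n → ℕ) (i : Fin n) :
    mdeg (Function.update α i (α i + 1)) = mdeg α + 1 := by
  unfold mdeg
  rw [Finset.sum_update_of_mem (Finset.mem_univ i), ← Finset.sum_sdiff (Finset.subset_univ {i}) (f := α)]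
  simp; ring

theorem mdeg_zero : mdeg (0 : Fin n → ℕ) = 0 := by simp [mdeg]

/-- directions in the two-factor space -/
def v2 : Fin n ⊕ Fin n → En n × En n := Sum.elim dX dY
/-- directions in the three-factor space -/
def v3 : Fin n ⊕ (Fin n ⊕ Fin n) → En n × En n × En n := Sum.elim d3X (Sum.elim d3Y d3Xi)
/-- gauge on the three-factor space -/
def g3 : Fin n ⊕ (Fin n ⊕ Fin n) → En n × En n × En n → ℝ :=
  Sum.elim (fun _ z => (jap z.1)⁻¹) (fun _ _ => 1)

theorem g3_nonneg (j : Fin n ⊕ (Fin n ⊕ Fin n)) (z : En n × En n × En n) : 0 ≤ g3 j z := by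
  cases j with
  | inl j => exact inv_nonneg.2 (jap_pos _).le
  | inr j => exact zero_le_one

theorem ld3_eq {a : En n × En n × En n → F} (ha : Sm a) (l : List (Fin n ⊕ (Fin n ⊕ Fin n))) :
    ∃ α β γ : Fin n → ℕ, mdeg α ≤ l.length ∧ mdeg β ≤ l.length ∧ mdeg γ ≤ l.length ∧
      (∀ z : En n × En n × En n, gl g3 l z = (jap z.1) ^ (-(mdeg α : ℝ))) ∧
      ld v3 l a = mderiv d3X α (mderiv d3Y β (mderiv d3Xi γ a)) := by
  induction l with
  | nil =>
    refine ⟨0, 0, 0, by simp [mdeg_zero], by simp [mdeg_zero], by simp [mdeg_zero],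
      fun z => by simp [gl, mdeg_zero], ?_⟩
    simp [mderiv_zero, ld]
  | cons j l ih =>
    obtain ⟨α, β, γ, h1, h2, h3, h4, h5⟩ := ih
    have hl : ld v3 (j :: l) a = dLine (v3 j) (ld v3 l a) := rfl
    have hg : ∀ z : En n × En n × En n, gl g3 (j :: l) z = g3 j z * gl g3 l z := fun z => by
      simp [gl]
    rcases j with i | i | i
    · refine ⟨Function.update α i (α i + 1), β, γ, ?_, by simp; omega, by simp; omega, ?_, ?_⟩
      · rw [mdeg_update]; simp; omega
      · intro z
        rw [hg, h4, mdeg_update]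
        push_cast
        rw [neg_add, add_comm, Real.rpow_add (jap_pos z.1), Real.rpow_neg_one]; rfl
      · rw [hl, h5]; exact mderiv_succ i (ha.mderiv.mderiv)
    · refine ⟨α, Function.update β i (β i + 1), γ, by simp; omega, ?_, by simp; omega, ?_, ?_⟩
      · rw [mdeg_update]; simp; omega
      · intro z; rw [hg, h4]; simp [g3]
      · rw [hl, h5, dLine_mderiv ha.mderiv.mderiv, ← mderiv_succ i ha.mderiv]; rfl
    · refine ⟨α, β, Function.update γ i (γ i + 1), by simp; omega, by simp; omega, ?_, ?_, ?_⟩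
      · rw [mdeg_update]; simp; omega
      · intro z; rw [hg, h4]; simp [g3]
      · rw [hl, h5, dLine_mderiv ha.mderiv.mderiv, dLine_mderiv ha.mderiv, ← mderiv_succ i ha]; rfl

theorem ld2_eq {f : En n × En n → F} (hf : Sm f) (l : List (Fin n ⊕ Fin n)) (j : Fin n) :
    ∃ α β : Fin n → ℕ, mdeg α ≤ l.length ∧ 1 ≤ mdeg β ∧ mdeg β ≤ l.length + 1 ∧
      ld v2 l (dLine (dY j) f) = mderiv dX α (mderiv dY β f) := by
  induction l with
  | nil =>
    refine ⟨0, Function.update 0 j (0 + 1), by simp [mdeg_zero], ?_, ?_, ?_⟩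
    · have := mdeg_update (0 : Fin n → ℕ) j
      simp only [Pi.zero_apply] at this
      rw [this]; omega
    · have := mdeg_update (0 : Fin n → ℕ) j
      simp only [Pi.zero_apply] at this
      rw [this]; simp [mdeg_zero]
    · have := mderiv_succ (dirs := dY) (α := (0 : Fin n → ℕ)) j hf
      simp only [Pi.zero_apply] at this
      rw [mderiv_zero, ← this, mderiv_zero]; rfl
  | cons i l ih =>
    obtain ⟨α, β, h1, h2, h3, h5⟩ := ih
    have hl : ld v2 (i :: l) (dLine (dY j) f) = dLine (v2 i) (ld v2 l (dLine (dY j) f)) := rfl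
    rcases i with i | i
    · refine ⟨Function.update α i (α i + 1), β, ?_, h2, by simp; omega, ?_⟩
      · rw [mdeg_update]; simp; omega
      · rw [hl, h5]; exact mderiv_succ i hf.mderiv
    · refine ⟨α, Function.update β i (β i + 1), by simp; omega, ?_, ?_, ?_⟩
      · rw [mdeg_update]; omega
      · rw [mdeg_update]; simp; omega
      · rw [hl, h5, dLine_mderiv hf.mderiv, ← mderiv_succ i hf]; rfl

end Conv

section Phase
variable {n : ℕ} {ι κ : Type*}

/-- Phase function assumptions for a family. -/
structure Ph (N : ℕ) (φ : ι → En n × En n → ℝ) : Prop where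
  sm : ∀ i, Sm (φ i)
  d1 : ∀ j, FB v2 g1 N (fun _ z => jap z.1) (fun i => dLine (dY j) (φ i))
  d2 : ∀ k j, FB v2 g1 N (fun _ _ => 1) (fun i => dLine (dX k) (dLine (dY j) (φ i)))
  det : ∃ C₀ : ℝ, 0 < C₀ ∧ ∀ i z,
    C₀ ≤ |Matrix.det (Matrix.of fun k j => dLine (dX k) (dLine (dY j) (φ i)) z)|

theorem Ph.reindex {N : ℕ} {φ : ι → En n × En n → ℝ} (h : Ph N φ) (r : κ → ι) :
    Ph N (fun k => φ (r k)) where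
  sm k := h.sm (r k)
  d1 j := (h.d1 j).reindex r
  d2 k j := (h.d2 k j).reindex r
  det := by
    obtain ⟨C, hC, h⟩ := h.det
    exact ⟨C, hC, fun k z => h (r k) z⟩

theorem Ph.le {N M : ℕ} {φ : ι → En n × En n → ℝ} (h : Ph N φ) (hM : M ≤ N) : Ph M φ where
  sm := h.sm
  d1 j := (h.d1 j).le hM
  d2 k j := (h.d2 k j).le hM
  det := h.det

theorem hasF_left (ξ : En n) (y : En n) :
    HasFDerivAt (fun y : En n => (y, ξ)) (ContinuousLinearMap.inl ℝ (En n) (En n)) y :=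
  hasFDerivAt_prodMk_left y ξ

theorem hasF_right (y : En n) (ξ : En n) :
    HasFDerivAt (fun ξ : En n => (y, ξ)) (ContinuousLinearMap.inr ℝ (En n) (En n)) ξ :=
  hasFDerivAt_prodMk_right y ξ

theorem inl_e1 (k : Fin n) : ContinuousLinearMap.inl ℝ (En n) (En n) (e1 k) = dX k := rfl
theorem inr_e1 (k : Fin n) : ContinuousLinearMap.inr ℝ (En n) (En n) (e1 k) = dY k := rfl

theorem dLine_left {F : Type*} [NormedAddCommGroup F] [NormedSpace ℝ F]
    {f : En n × En n → F} (hf : Sm f) (k : Fin n) (ξ : En n) :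
    dLine (e1 k) (fun y => f (y, ξ)) = fun y => dLine (dX k) f (y, ξ) := by
  rw [dLine_comp hf (hasF_left ξ), inl_e1]

theorem dLine_right {F : Type*} [NormedAddCommGroup F] [NormedSpace ℝ F]
    {f : En n × En n → F} (hf : Sm f) (k : Fin n) (y : En n) :
    dLine (e1 k) (fun ξ => f (y, ξ)) = fun ξ => dLine (dY k) f (y, ξ) := by
  rw [dLine_comp hf (hasF_right y), inr_e1]

theorem Sm.left {F : Type*} [NormedAddCommGroup F] [NormedSpace ℝ F]
    {f : En n × En n → F} (hf : Sm f) (ξ : En n) : Sm (fun y => f (y, ξ)) :=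
  hf.compA (hasF_left ξ)

theorem Sm.right {F : Type*} [NormedAddCommGroup F] [NormedSpace ℝ F]
    {f : En n × En n → F} (hf : Sm f) (y : En n) : Sm (fun ξ => f (y, ξ)) :=
  hf.compA (hasF_right y)

theorem le_sum_abs {J : Type*} [Fintype J] (C : J → ℝ) (j : J) : C j ≤ ∑ j, |C j| :=
  (le_abs_self _).trans (Finset.single_le_sum (f := fun j => |C j|) (fun _ _ => abs_nonneg _)
    (Finset.mem_univ j))

theorem Ph.unif {N : ℕ} {φ : ι → En n × En n → ℝ} (h : Ph (N + 1) φ) : ∃ A : ℝ,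
    (∀ i k j z, |dLine (dX k) (dLine (dY j) (φ i)) z| ≤ A) ∧
    (∀ i l k j z, |dLine (v2 l) (dLine (dX k) (dLine (dY j) (φ i))) z| ≤ A) := by
  have h1 := fun k j => (h.d2 k j).zero
  choose C hC using h1
  have h2 := fun l k j => ((h.d2 k j).dLine l).zero
  choose C' hC' using h2
  refine ⟨max (∑ k, abs (∑ j, |C k j|)) (∑ l, abs (∑ k, abs (∑ j, |C' l k j|))), ?_, ?_⟩
  · intro i k j z
    refine le_trans ?_ (le_max_left _ _)
    have := hC k j i z
    rw [mul_one] at this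
    exact (this.trans (le_sum_abs (C k) j)).trans (le_sum_abs (fun k => ∑ j, |C k j|) k)
  · intro i l k j z
    refine le_trans ?_ (le_max_right _ _)
    have := hC' l k j i z
    rw [mul_one, g1, mul_one] at this
    exact ((this.trans (le_sum_abs (C' l k) j)).trans
      (le_sum_abs (fun k => ∑ j, |C' l k j|) k)).trans
      (le_sum_abs (fun l => ∑ k, abs (∑ j, |C' l k j|)) l)

theorem Ph.injY {N : ℕ} {φ : ι → En n × En n → ℝ} (h : Ph (N + 1) φ) : ∃ c : ℝ, 0 < c ∧
    ∀ i y y' ξ, ‖y - y'‖ ^ 2 ≤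
      c * ∑ j, (dLine (dY j) (φ i) (y, ξ) - dLine (dY j) (φ i) (y', ξ)) ^ 2 := by
  obtain ⟨A, h1, h2⟩ := h.unif
  obtain ⟨C₀, hC₀, hd⟩ := h.det
  obtain ⟨c, hc, H⟩ := hadE n A C₀ hC₀
  refine ⟨c, hc, fun i y y' ξ => ?_⟩
  have s1 : ∀ j, Sm (dLine (dY j) (φ i)) := fun j => (h.sm i).dLine _
  have e1' : ∀ j k, dLine (e1 k) (fun y => dLine (dY j) (φ i) (y, ξ)) =
      fun y => dLine (dX k) (dLine (dY j) (φ i)) (y, ξ) := fun j k => dLine_left (s1 j) k ξ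
  refine H (fun j y => dLine (dY j) (φ i) (y, ξ)) (fun j => (s1 j).left ξ) ?_ ?_ ?_ y y'
  · intro j k x; rw [e1']; exact h1 i k j _
  · intro j k l x; rw [e1', dLine_left ((s1 j).dLine _)]; exact h2 i (Sum.inl l) k j _
  · intro x; simp_rw [e1']; exact hd i _

theorem Ph.injXi {N : ℕ} {φ : ι → En n × En n → ℝ} (h : Ph (N + 1) φ) : ∃ c : ℝ, 0 < c ∧
    ∀ i y ξ ξ', ‖ξ - ξ'‖ ^ 2 ≤
      c * ∑ j, (dLine (dX j) (φ i) (y, ξ) - dLine (dX j) (φ i) (y, ξ')) ^ 2 := by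
  obtain ⟨A, h1, h2⟩ := h.unif
  obtain ⟨C₀, hC₀, hd⟩ := h.det
  obtain ⟨c, hc, H⟩ := hadE n A C₀ hC₀
  refine ⟨c, hc, fun i y ξ ξ' => ?_⟩
  have s1 : ∀ j, Sm (dLine (dX j) (φ i)) := fun j => (h.sm i).dLine _
  have s2 : ∀ j, Sm (dLine (dY j) (φ i)) := fun j => (h.sm i).dLine _
  have e1' : ∀ j k, dLine (e1 k) (fun ξ => dLine (dX j) (φ i) (y, ξ)) =
      fun ξ => dLine (dX j) (dLine (dY k) (φ i)) (y, ξ) := fun j k => by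
    rw [dLine_right (s1 j) k y, dLine_comm (h.sm i)]
  refine H (fun j ξ => dLine (dX j) (φ i) (y, ξ)) (fun j => (s1 j).right y) ?_ ?_ ?_ ξ ξ'
  · intro j k x; rw [e1']; exact h1 i j k _
  · intro j k l x; rw [e1', dLine_right ((s2 k).dLine _)]; exact h2 i (Sum.inr l) j k _
  · intro x; simp_rw [e1']
    rw [← Matrix.det_transpose]; exact hd i _

theorem lower_aux {r S c : ℝ} (hc : 0 < c) (hS : 0 ≤ S) (h : r ≤ c * S) :
    (1 + c)⁻¹ * (1 + r) ≤ 1 + S := by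
  rw [inv_mul_le_iff₀ (by positivity)]
  nlinarith

theorem Ph.lowY {N : ℕ} {φ : ι → En n × En n → ℝ} (h : Ph (N + 1) φ) : ∃ c : ℝ, 0 < c ∧
    ∀ i y y' ξ, c * jap (y - y') ^ 2 ≤
      1 + ∑ j, (dLine (dY j) (φ i) (y, ξ) - dLine (dY j) (φ i) (y', ξ)) ^ 2 := by
  obtain ⟨c, hc, h⟩ := h.injY
  refine ⟨(1 + c)⁻¹, by positivity, fun i y y' ξ => ?_⟩
  rw [jap_sq]
  exact lower_aux hc (Finset.sum_nonneg fun j _ => sq_nonneg _) (h i y y' ξ)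

theorem Ph.lowXi {N : ℕ} {φ : ι → En n × En n → ℝ} (h : Ph (N + 1) φ) : ∃ c : ℝ, 0 < c ∧
    ∀ i y ξ ξ', c * jap (ξ - ξ') ^ 2 ≤
      1 + ∑ j, (dLine (dX j) (φ i) (y, ξ) - dLine (dX j) (φ i) (y, ξ')) ^ 2 := by
  obtain ⟨c, hc, h⟩ := h.injXi
  refine ⟨(1 + c)⁻¹, by positivity, fun i y y' ξ => ?_⟩
  rw [jap_sq]
  exact lower_aux hc (Finset.sum_nonneg fun j _ => sq_nonneg _) (h i y y' ξ)

theorem Ph.low0 {N : ℕ} {φ : ι → En n × En n → ℝ} (h : Ph (N + 1) φ) : ∃ c : ℝ, 0 < c ∧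
    ∀ i y ξ, c * jap y ^ 2 ≤ 1 + ∑ j, (dLine (dY j) (φ i) (y, ξ)) ^ 2 := by
  have h1 := fun j => (h.d1 j).zero
  choose C hC using h1
  obtain ⟨c, hc, H⟩ := h.injY
  let B := ∑ j, (C j) ^ 2
  have hB : 0 ≤ B := Finset.sum_nonneg fun j _ => sq_nonneg _
  refine ⟨(1 + 2 * c + 2 * c * B)⁻¹, by positivity, fun i y ξ => ?_⟩
  rw [jap_sq, inv_mul_le_iff₀ (by positivity)]
  set S := ∑ j, (dLine (dY j) (φ i) (y, ξ)) ^ 2 with hSdef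
  have hS : 0 ≤ S := Finset.sum_nonneg fun j _ => sq_nonneg _
  have h2 : ∑ j, (dLine (dY j) (φ i) (y, ξ) - dLine (dY j) (φ i) (0, ξ)) ^ 2 ≤ 2 * S + 2 * B := by
    rw [hSdef, Finset.mul_sum, Finset.mul_sum, ← Finset.sum_add_distrib]
    refine Finset.sum_le_sum (fun j _ => ?_)
    have h3 : |dLine (dY j) (φ i) (0, ξ)| ≤ C j := by
      have := hC j i (0, ξ)
      simpa [jap] using this
    have h4 : (dLine (dY j) (φ i) (0, ξ)) ^ 2 ≤ C j ^ 2 := by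
      rw [← sq_abs]; gcongr
    nlinarith [sq_nonneg (dLine (dY j) (φ i) (y, ξ) + dLine (dY j) (φ i) (0, ξ))]
  have h5 := H i y 0 ξ
  rw [sub_zero] at h5
  have h6 : ‖y‖ ^ 2 ≤ c * (2 * S + 2 * B) := h5.trans (by gcongr)
  have : 0 ≤ c * B * S := by positivity
  nlinarith

theorem diffY {N : ℕ} {f : ι → En n × En n → ℝ} (hf : ∀ i, Sm (f i))
    (h : ∀ k, FB v2 g1 N (fun _ _ => 1) (fun i => dLine (dX k) (f i))) :
    FB v2 g1 N (fun (s : ι × En n) z => jap (z.1 - s.2))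
      (fun (s : ι × En n) z => f s.1 z - f s.1 (s.2, z.2)) := by
  have h0 : ∀ {N : ℕ} {f : ι → En n × En n → ℝ}, (∀ i, Sm (f i)) →
      (∀ k, FB v2 g1 N (fun _ _ => 1) (fun i => dLine (dX k) (f i))) →
      ∃ C : ℝ, ∀ (s : ι × En n) (z : En n × En n),
      ‖f s.1 z - f s.1 (s.2, z.2)‖ ≤ C * jap (z.1 - s.2) := by
    intro N f hf h
    have h1 := fun k => (h k).zero
    choose C hC using h1
    refine ⟨n * abs (∑ k, |C k|), fun s z => ?_⟩
    refine (lip_of_partials (f := fun y => f s.1 (y, z.2)) ((hf s.1).left _).diff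
      (A := ∑ k, |C k|) (fun x k => ?_) s.2 z.1).trans ?_
    · rw [dLine_left (hf s.1)]
      have := hC k s.1 (x, z.2)
      rw [mul_one] at this
      exact this.trans (le_sum_abs C k)
    · exact mul_le_mul_of_nonneg_left (norm_le_jap _) (by positivity)
  induction N generalizing f with
  | zero => exact h0 hf h
  | succ N ih =>
    refine ⟨h0 hf h, fun j => ?_⟩
    have hA : ∀ (p : En n) (z : En n × En n), HasFDerivAt (fun z : En n × En n => (p, z.2))
        ((ContinuousLinearMap.inr ℝ (En n) (En n)).comp (ContinuousLinearMap.snd ℝ (En n) (En n))) z :=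
      fun p z => (hasF_right p z.2).comp z hasFDerivAt_snd
    have e : ∀ s : ι × En n, dLine (v2 j) (fun z => f s.1 z - f s.1 (s.2, z.2)) =
        fun z => dLine (v2 j) (f s.1) z - dLine (((ContinuousLinearMap.inr ℝ (En n) (En n)).comp (ContinuousLinearMap.snd ℝ (En n) (En n))) (v2 j)) (f s.1) (s.2, z.2) := fun s => by
      rw [dLine_sub (hf s.1) ((hf s.1).compA (hA s.2)), dLine_comp (hf s.1) (hA s.2)]
    simp_rw [e]
    rcases j with j | j
    · have e2 : ((ContinuousLinearMap.inr ℝ (En n) (En n)).comp (ContinuousLinearMap.snd ℝ (En n) (En n))) (v2 (Sum.inl j)) = 0 := rfl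
      rw [e2]
      have e3 : ∀ (s : ι × En n) z, dLine (0 : En n × En n) (f s.1) z = 0 := fun s z => by
        simp [dLine]
      simp_rw [e3, sub_zero]
      refine (((h j).le (Nat.le_succ N)).reindex (fun s : ι × En n => s.1)).mono g1_nonneg
        (fun _ _ => zero_le_one) 1 (fun s z => ?_)
      simpa [g1] using jap_one_le _
    · have e2 : ((ContinuousLinearMap.inr ℝ (En n) (En n)).comp (ContinuousLinearMap.snd ℝ (En n) (En n))) (v2 (Sum.inr j)) = v2 (Sum.inr j) := rfl
      rw [e2]
      have key : ∀ k, FB v2 g1 N (fun _ _ => 1) (fun i => dLine (dX k) (dLine (v2 (Sum.inr j)) (f i))) := by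
        intro k
        have := (h k).dLine (Sum.inr j)
        refine FB.congrw ?_ (w := fun i z => g1 (Sum.inr j : Fin n ⊕ Fin n) z * 1) (by simp [g1])
        have e4 : (fun i => dLine (dX k) (dLine (v2 (Sum.inr j)) (f i))) =
          fun i => dLine (v2 (Sum.inr j)) (dLine (dX k) (f i)) := by
          funext i; rw [dLine_comm (hf i)]
        rw [e4]; exact this
      exact (ih (fun i => (hf i).dLine _) key).congrw (by simp [g1])

theorem diffXi {N : ℕ} {f : ι → En n × En n → ℝ} (hf : ∀ i, Sm (f i))
    (h : ∀ k, FB v2 g1 N (fun _ _ => 1) (fun i => dLine (dY k) (f i))) :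
    FB e1 g1 N (fun (s : ι × En n × En n) _ => jap (s.2.1 - s.2.2))
      (fun (s : ι × En n × En n) y => f s.1 (y, s.2.1) - f s.1 (y, s.2.2)) := by
  have h0 : ∀ {N : ℕ} {f : ι → En n × En n → ℝ}, (∀ i, Sm (f i)) →
      (∀ k, FB v2 g1 N (fun _ _ => 1) (fun i => dLine (dY k) (f i))) →
      ∃ C : ℝ, ∀ (s : ι × En n × En n) (y : En n),
      ‖f s.1 (y, s.2.1) - f s.1 (y, s.2.2)‖ ≤ C * jap (s.2.1 - s.2.2) := by
    intro N f hf h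
    have h1 := fun k => (h k).zero
    choose C hC using h1
    refine ⟨n * abs (∑ k, |C k|), fun s y => ?_⟩
    refine (lip_of_partials (f := fun ξ => f s.1 (y, ξ)) ((hf s.1).right _).diff
      (A := ∑ k, |C k|) (fun x k => ?_) s.2.2 s.2.1).trans ?_
    · rw [dLine_right (hf s.1)]
      have := hC k s.1 (y, x)
      rw [mul_one] at this
      exact this.trans (le_sum_abs C k)
    · exact mul_le_mul_of_nonneg_left (norm_le_jap _) (by positivity)
  induction N generalizing f with
  | zero => exact h0 hf h
  | succ N ih =>
    refine ⟨h0 hf h, fun j => ?_⟩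
    have e : ∀ s : ι × En n × En n,
        dLine (e1 j) (fun y => f s.1 (y, s.2.1) - f s.1 (y, s.2.2)) =
        fun y => dLine (dX j) (f s.1) (y, s.2.1) - dLine (dX j) (f s.1) (y, s.2.2) := fun s => by
      rw [dLine_sub ((hf s.1).left _) ((hf s.1).left _), dLine_left (hf s.1), dLine_left (hf s.1)]
    simp_rw [e]
    refine (ih (f := fun i => dLine (dX j) (f i)) (fun i => (hf i).dLine _) (fun k => ?_)).congrw
      (by simp [g1])
    have := (h k).dLine (Sum.inl j)
    refine FB.congrw ?_ (w := fun i z => g1 (Sum.inl j : Fin n ⊕ Fin n) z * 1) (by simp [g1])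
    have e4 : (fun i => dLine (dY k) (dLine (dX j) (f i))) =
      fun i => dLine (v2 (Sum.inl j)) (dLine (dY k) (f i)) := by
      funext i; rw [dLine_comm (hf i)]; rfl
    rw [e4]; exact this
end Phase

section Ibp
variable {n : ℕ} {ι κ J W : Type*} [NormedAddCommGroup W] [NormedSpace ℝ W]

/-- unimodular exponential -/
def ex (t : ℝ) : ℂ := Complex.exp (Complex.I * (t : ℂ))

theorem norm_ex (t : ℝ) : ‖ex t‖ = 1 := by
  unfold ex; rw [mul_comm]; exact Complex.norm_exp_ofReal_mul_I t

theorem ex_cont : Continuous ex := by unfold ex; fun_prop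

theorem ex_add (s t : ℝ) : ex (s + t) = ex s * ex t := by
  unfold ex; rw [← Complex.exp_add]; push_cast; ring_nf

theorem conj_ex (t : ℝ) : (starRingEnd ℂ) (ex t) = ex (-t) := by
  unfold ex; rw [← Complex.exp_conj]; simp

theorem Sm_ofReal {f : W → ℝ} (hf : Sm f) : Sm (fun z => (f z : ℂ)) :=
  Sm.clm Complex.ofRealCLM hf

theorem dLine_ofReal {f : W → ℝ} (hf : Sm f) (v : W) :
    dLine v (fun z => (f z : ℂ)) = fun z => ((dLine v f z : ℝ) : ℂ) :=
  dLine_clm Complex.ofRealCLM hf v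

theorem FB_ofReal {v : J → W} {g : J → W → ℝ} {N : ℕ} {w : ι → W → ℝ} {f : ι → W → ℝ}
    (hf : ∀ i, Sm (f i)) (h : FB v g N w f) : FB v g N w (fun i z => (f i z : ℂ)) :=
  FB.clm Complex.ofRealCLM hf h

theorem FB.const_mul {v : J → W} {g : J → W → ℝ} {N : ℕ} {w : ι → W → ℝ} {f : ι → W → ℂ}
    (hf : ∀ i, Sm (f i)) (h : FB v g N w f) (c : ℂ) : FB v g N w (fun i z => c * f i z) := by
  have := FB.clm (c • ContinuousLinearMap.id ℝ ℂ) hf h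
  simpa only [smul_apply, ContinuousLinearMap.id_apply, smul_eq_mul] using this

theorem Sm_ex {f : W → ℝ} (hf : Sm f) : Sm (fun z => ex (f z)) := by
  unfold ex Sm
  exact Complex.contDiff_exp.comp (contDiff_const.mul (Sm_ofReal hf))

theorem dLine_ex {f : W → ℝ} (hf : Sm f) (v : W) :
    dLine v (fun z => ex (f z)) = fun z => ex (f z) * (Complex.I * ((dLine v f z : ℝ) : ℂ)) := by
  funext z
  have h1 : HasFDerivAt (fun z => (f z : ℂ)) (Complex.ofRealCLM.comp (fderiv ℝ f z)) z :=
    Complex.ofRealCLM.hasFDerivAt.comp z (hf.diff z).hasFDerivAt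
  have h2 := (h1.const_mul Complex.I).cexp
  unfold dLine ex
  rw [h2.fderiv]
  simp

theorem int_dLine_zero {F : En n → ℂ} (hF : Sm F) (v : En n) (h1 : Integrable F)
    (h2 : Integrable (dLine v F)) : ∫ z, dLine v F z = 0 := by
  have h2' : Integrable (fun x => fderiv ℝ F x v) volume := h2
  have := integral_mul_fderiv_eq_neg_fderiv_mul_of_integrable (𝕜 := ℂ) (μ := volume)
    (f := fun _ : En n => (1 : ℂ)) (g := F) (v := v)
    (by simp) (by simp only [one_mul]; exact h2') (by simpa using h1)
    (fun x _ => differentiableAt_const _) (fun x _ => hF.diff x)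
  simpa [dLine] using this

theorem integrable_ex_mul {Φ : En n → ℝ} (hΦ : Continuous Φ) {f : En n → ℂ} (hf : Integrable f) :
    Integrable (fun z => ex (Φ z) * f z) :=
  hf.bdd_mul (c := 1) (ex_cont.comp hΦ).aestronglyMeasurable
    (Filter.Eventually.of_forall fun z => (norm_ex _).le)

theorem ibp {Φ : En n → ℝ} (hΦ : Sm Φ) {f : En n → ℂ} (hf : Sm f) (v : En n)
    (h1 : Integrable f) (h2 : Integrable (dLine v f))
    (h3 : Integrable (fun z => ((dLine v Φ z : ℝ) : ℂ) * f z)) :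
    ∫ z, ex (Φ z) * (((dLine v Φ z : ℝ) : ℂ) * f z) =
      ∫ z, ex (Φ z) * (Complex.I * dLine v f z) := by
  have e : dLine v (fun z => ex (Φ z) * f z) = fun z =>
      Complex.I * (ex (Φ z) * (((dLine v Φ z : ℝ) : ℂ) * f z)) + ex (Φ z) * dLine v f z := by
    rw [dLine_mul (Sm_ex hΦ) hf, dLine_ex hΦ]
    funext z; ring
  have i1 := (integrable_ex_mul hΦ.cont h3).const_mul Complex.I
  have i2 := integrable_ex_mul hΦ.cont h2
  have h0 := int_dLine_zero ((Sm_ex hΦ).mul hf) v (integrable_ex_mul hΦ.cont h1)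
    (by rw [e]; exact i1.add i2)
  rw [e, integral_add i1 i2, integral_const_mul] at h0
  have e2 : ∀ z, ex (Φ z) * (Complex.I * dLine v f z) = Complex.I * (ex (Φ z) * dLine v f z) :=
    fun z => by ring
  simp_rw [e2]
  rw [integral_const_mul, eq_neg_of_add_eq_zero_right h0]
  rw [mul_neg, ← mul_assoc, Complex.I_mul_I]; ring

/-- reciprocal of `1 + |D|^2` -/
def hQ (D : Fin n → κ → W → ℝ) (k : κ) (z : W) : ℝ := (1 + ∑ j, D j k z ^ 2)⁻¹

theorem hQ_pos (D : Fin n → κ → W → ℝ) (k : κ) (z : W) : 0 < 1 + ∑ j, D j k z ^ 2 := by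
  have : 0 ≤ ∑ j, D j k z ^ 2 := Finset.sum_nonneg fun j _ => sq_nonneg _
  linarith

theorem hQ_id (D : Fin n → κ → W → ℝ) (k : κ) (z : W) :
    hQ D k z + ∑ j, (hQ D k z * D j k z) * D j k z = 1 := by
  have h := (hQ_pos D k z).ne'
  have e : ∑ j, (hQ D k z * D j k z) * D j k z = hQ D k z * ∑ j, D j k z ^ 2 := by
    rw [Finset.mul_sum]; exact Finset.sum_congr rfl fun j _ => by ring
  rw [e, ← mul_one_add, hQ, inv_mul_cancel₀ h]

variable {v : J → W} {g : J → W → ℝ} {N : ℕ} {w : κ → W → ℝ} {D : Fin n → κ → W → ℝ}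

theorem Sm_Q (hD : ∀ j k, Sm (D j k)) (k : κ) : Sm (fun z => 1 + ∑ j, D j k z ^ 2) := by
  simp_rw [pow_two]
  exact (Sm.const 1).add (Sm.sum fun j => (hD j k).mul (hD j k))

theorem Sm_hQ (hD : ∀ j k, Sm (D j k)) (k : κ) : Sm (hQ D k) :=
  (Sm_Q hD k).inv fun z => (hQ_pos D k z).ne'

theorem FB_hQ (hD : ∀ j k, Sm (D j k)) (hF : ∀ j, FB v g N w (D j)) (hw : ∀ k z, 1 ≤ w k z)
    (hg : ∀ j z, 0 ≤ g j z) {c : ℝ} (hc : 0 < c)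
    (hl : ∀ k z, c * w k z ^ 2 ≤ 1 + ∑ j, D j k z ^ 2) :
    FB v g N (fun k z => (w k z * w k z)⁻¹) (hQ D) := by
  have h0 : ∀ k z, 0 < w k z * w k z := fun k z => by
    have := hw k z; positivity
  have h1 : FB v g N (fun k z => w k z * w k z) (fun k z => 1 + ∑ j, D j k z ^ 2) := by
    simp_rw [pow_two]
    refine FB.add (fun k => Sm.const 1) (fun k => Sm.sum fun j => (hD j k).mul (hD j k)) ?_ ?_
    · exact FB.const _ (fun k z => (h0 k z).le) (fun k z => by nlinarith [hw k z]) hg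
    · exact FB.sum (fun j k => (hD j k).mul (hD j k)) (fun k z => (h0 k z).le) hg
        (fun j => FB.mul (hD j) (hD j) (hF j) (hF j))
  exact FB.inv (Sm_Q hD) h1 h0 c hc (fun k z => by rw [← pow_two]; exact hl k z)

theorem FB_V (hD : ∀ j k, Sm (D j k)) (hF : ∀ j, FB v g N w (D j)) (hw : ∀ k z, 1 ≤ w k z)
    (hg : ∀ j z, 0 ≤ g j z) {c : ℝ} (hc : 0 < c)
    (hl : ∀ k z, c * w k z ^ 2 ≤ 1 + ∑ j, D j k z ^ 2) (j : Fin n) :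
    FB v g N (fun k z => (w k z)⁻¹) (fun k z => hQ D k z * D j k z) := by
  refine (FB.mul (Sm_hQ hD) (hD j) (FB_hQ hD hF hw hg hc hl) (hF j)).congrw (fun k z => ?_)
  have : w k z ≠ 0 := by have := hw k z; positivity
  field_simp

theorem integrable_jap {r : ℝ} (hr : (n : ℝ) < r) (p : En n) :
    Integrable (fun y : En n => jap (y - p) ^ (-r)) := by
  have h := (integrable_rpow_neg_one_add_norm_sq (E := En n) (μ := volume) (r := r)
    (by simpa using hr)).comp_sub_right p
  refine h.congr (Filter.Eventually.of_forall fun y => ?_)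
  simp only
  rw [← jap_sq, ← Real.rpow_natCast, ← Real.rpow_mul (jap_pos _).le]
  congr 1; push_cast; ring

theorem integral_jap_eq (r : ℝ) (p : En n) :
    ∫ y : En n, jap (y - p) ^ (-r) = ∫ y : En n, jap y ^ (-r) :=
  integral_sub_right_eq_self (fun y : En n => jap y ^ (-r)) p

/-- the decaying weight -/
def wt (r : ℝ) (p y : En n) : ℝ := jap (y - p) ^ (-r)

theorem wt_pos (r : ℝ) (p y : En n) : 0 < wt r p y := Real.rpow_pos_of_pos (jap_pos _) _

theorem FB_integrable {J : Type*} {v : J → En n} {g : J → En n → ℝ} {N : ℕ} {μ : κ → ℝ}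
    {p : κ → En n} {f : κ → En n → ℂ} (hf : ∀ k, Sm (f k)) {r : ℝ} (hr : (n : ℝ) < r)
    (h : FB v g N (fun k y => μ k * wt r (p k) y) f) (k : κ) : Integrable (f k) := by
  obtain ⟨C, hC⟩ := h.zero
  refine Integrable.mono' ((integrable_jap hr (p k)).const_mul (C * μ k))
    (hf k).cont.aestronglyMeasurable (Filter.Eventually.of_forall fun y => ?_)
  refine (hC k y).trans (le_of_eq ?_)
  rw [wt, mul_assoc]

theorem NSP {N : ℕ} {Φ : κ → En n → ℝ} {lam : κ → ℝ} {p : κ → En n} (hΦ : ∀ k, Sm (Φ k))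
    (hlam : ∀ k, 1 ≤ lam k)
    (hd : ∀ j, FB e1 g1 N (fun k _ => lam k) (fun k => dLine (e1 j) (Φ k))) {c : ℝ} (hc : 0 < c)
    (hl : ∀ k y, c * lam k ^ 2 ≤ 1 + ∑ j, (dLine (e1 j) (Φ k) y) ^ 2) {r : ℝ} (hr : (n : ℝ) < r)
    (M : ℕ) (hM : M ≤ N) (f : κ → En n → ℂ) (μ : κ → ℝ) (hf : ∀ k, Sm (f k))
    (hμ : ∀ k, 0 ≤ μ k) (h : FB e1 g1 M (fun k y => μ k * wt r (p k) y) f) :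
    ∃ C : ℝ, 0 < C ∧ ∀ k, ‖∫ y, ex (Φ k y) * f k y‖ ≤ C * (μ k * (lam k)⁻¹ ^ M) := by
  induction M generalizing f μ with
  | zero =>
    obtain ⟨C, hC, hb⟩ := h.bound (fun k y => mul_nonneg (hμ k) (wt_pos _ _ _).le)
    have hI : 0 ≤ ∫ y : En n, jap y ^ (-r) :=
      integral_nonneg fun y => Real.rpow_nonneg (jap_pos y).le _
    refine ⟨C * (∫ y : En n, jap y ^ (-r)) + 1, by positivity, fun k => ?_⟩
    calc ‖∫ y, ex (Φ k y) * f k y‖ ≤ ∫ y, C * μ k * wt r (p k) y := by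
          refine norm_integral_le_of_norm_le ((integrable_jap hr (p k)).const_mul _)
            (Filter.Eventually.of_forall fun y => ?_)
          rw [norm_mul, norm_ex, one_mul]
          exact (hb k y).trans (le_of_eq (by ring))
      _ = C * μ k * ∫ y : En n, jap y ^ (-r) := by
          rw [integral_const_mul]; unfold wt; rw [integral_jap_eq]
      _ ≤ _ := by
          rw [pow_zero, mul_one]; nlinarith [hμ k]
  | succ M ih =>
    let D : Fin n → κ → En n → ℝ := fun j k => dLine (e1 j) (Φ k)
    have sD : ∀ j k, Sm (D j k) := fun j k => (hΦ k).dLine _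
    have FD : ∀ j, FB e1 g1 (M + 1) (fun k _ => lam k) (D j) := fun j => (hd j).le hM
    have Fh := FB_hQ sD FD (fun k _ => hlam k) g1_nonneg hc hl
    have FV := FB_V sD FD (fun k _ => hlam k) g1_nonneg hc hl
    have sV : ∀ j k, Sm (fun z => hQ D k z * D j k z) := fun j k => (Sm_hQ sD k).mul (sD j k)
    let Vf : Fin n → κ → En n → ℂ := fun j k z => ((hQ D k z * D j k z : ℝ) : ℂ) * f k z
    have sVf : ∀ j k, Sm (Vf j k) := fun j k => (Sm_ofReal (sV j k)).mul (hf k)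
    have FVf : ∀ j, FB e1 g1 (M + 1) (fun k y => (μ k * (lam k)⁻¹) * wt r (p k) y) (Vf j) := by
      intro j
      refine (FB.mul (fun k => Sm_ofReal (sV j k)) hf (FB_ofReal (sV j) (FV j)) h).congrw ?_
      intro k z; ring
    let hf0 : κ → En n → ℂ := fun k z => (hQ D k z : ℂ) * f k z
    have shf : ∀ k, Sm (hf0 k) := fun k => (Sm_ofReal (Sm_hQ sD k)).mul (hf k)
    have hpos : ∀ k, 0 ≤ (lam k)⁻¹ := fun k => inv_nonneg.2 (zero_le_one.trans (hlam k))
    have Fhf : FB e1 g1 (M + 1) (fun k y => (μ k * (lam k)⁻¹) * wt r (p k) y) hf0 := by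
      refine (FB.mul (fun k => Sm_ofReal (Sm_hQ sD k)) hf (FB_ofReal (Sm_hQ sD) Fh) h).mono
        g1_nonneg ?_ 1 ?_
      · intro k z
        have := wt_pos r (p k) z
        have := hμ k
        have := hlam k
        positivity
      · intro k z
        rw [one_mul, mul_inv]
        have h1 : (lam k)⁻¹ ≤ 1 := inv_le_one_of_one_le₀ (hlam k)
        have h2 : 0 ≤ μ k * wt r (p k) z := mul_nonneg (hμ k) (wt_pos _ _ _).le
        nlinarith [mul_nonneg (hpos k) h2, mul_nonneg (mul_nonneg (hpos k) h2) (sub_nonneg.2 h1)]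
    let f' : κ → En n → ℂ := fun k z => hf0 k z + ∑ j, Complex.I * dLine (e1 j) (Vf j k) z
    have sI : ∀ j k, Sm (fun z => Complex.I * dLine (e1 j) (Vf j k) z) := fun j k =>
      (Sm.const _).mul ((sVf j k).dLine _)
    have sf' : ∀ k, Sm (f' k) := fun k => (shf k).add (Sm.sum fun j => sI j k)
    have FI : ∀ j, FB e1 g1 M (fun k y => (μ k * (lam k)⁻¹) * wt r (p k) y)
        (fun k z => Complex.I * dLine (e1 j) (Vf j k) z) := fun j =>
      (((FVf j).dLine j).const_mul (fun k => (sVf j k).dLine _) Complex.I).congrw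
        (fun k z => by simp [g1])
    have Ff' : FB e1 g1 M (fun k y => (μ k * (lam k)⁻¹) * wt r (p k) y) f' :=
      FB.add shf (fun k => Sm.sum fun j => sI j k) (Fhf.le (Nat.le_succ M))
        (FB.sum sI (fun k z => mul_nonneg (mul_nonneg (hμ k) (hpos k)) (wt_pos _ _ _).le)
          g1_nonneg FI)
    obtain ⟨C, hC, H⟩ := ih (by omega) f' (fun k => μ k * (lam k)⁻¹) sf'
      (fun k => mul_nonneg (hμ k) (hpos k)) Ff'
    refine ⟨C, hC, fun k => ?_⟩
    have key : ∫ y, ex (Φ k y) * f k y = ∫ y, ex (Φ k y) * f' k y := by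
      have iV : ∀ j, Integrable (Vf j k) := fun j => FB_integrable (sVf j) hr (FVf j) k
      have iI : ∀ j, Integrable (fun z => Complex.I * dLine (e1 j) (Vf j k) z) := fun j =>
        FB_integrable (sI j) hr (FI j) k
      have idV : ∀ j, Integrable (dLine (e1 j) (Vf j k)) := fun j =>
        FB_integrable (fun k => (sVf j k).dLine _) hr
          (((FVf j).dLine j).congrw (w' := fun k y => (μ k * (lam k)⁻¹) * wt r (p k) y)
            (fun k z => by simp [g1])) k
      have iDV : ∀ j, Integrable (fun z => ((dLine (e1 j) (Φ k) z : ℝ) : ℂ) * Vf j k z) := fun j =>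
        FB_integrable (f := fun k z => ((D j k z : ℝ) : ℂ) * Vf j k z)
          (fun k => (Sm_ofReal (sD j k)).mul (sVf j k)) hr
          ((FB.mul (fun k => Sm_ofReal (sD j k)) (sVf j) (FB_ofReal (sD j) (FD j)) (FVf j)).congrw
            (w' := fun k y => (lam k * (μ k * (lam k)⁻¹)) * wt r (p k) y)
            (fun k z => by ring)) k
      have ih0 : Integrable (hf0 k) := FB_integrable shf hr Fhf k
      have e1' : ∀ y, ex (Φ k y) * f k y = ex (Φ k y) * hf0 k y +
          ∑ j, ex (Φ k y) * (((dLine (e1 j) (Φ k) y : ℝ) : ℂ) * Vf j k y) := by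
        intro y
        rw [← Finset.mul_sum, ← mul_add]
        congr 1
        have := congrArg (fun t : ℝ => (t : ℂ) * f k y) (hQ_id D k y)
        simp only [Complex.ofReal_add, Complex.ofReal_sum, Complex.ofReal_mul, Complex.ofReal_one,
          one_mul] at this
        rw [← this, add_mul, Finset.sum_mul]
        congr 1
        refine Finset.sum_congr rfl fun j _ => ?_
        simp only [Vf, D]; push_cast; ring
      have e2' : ∀ y, ex (Φ k y) * f' k y = ex (Φ k y) * hf0 k y +
          ∑ j, ex (Φ k y) * (Complex.I * dLine (e1 j) (Vf j k) y) := by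
        intro y
        rw [← Finset.mul_sum, ← mul_add]
      simp_rw [e1', e2']
      rw [integral_add (integrable_ex_mul (hΦ k).cont ih0)
          (integrable_finsetSum _ fun j _ => integrable_ex_mul (hΦ k).cont (iDV j)),
        integral_add (integrable_ex_mul (hΦ k).cont ih0)
          (integrable_finsetSum _ fun j _ => integrable_ex_mul (hΦ k).cont (iI j)),
        integral_finsetSum _ fun j _ => integrable_ex_mul (hΦ k).cont (iDV j),
        integral_finsetSum _ fun j _ => integrable_ex_mul (hΦ k).cont (iI j)]
      congr 1
      refine Finset.sum_congr rfl fun j _ => ?_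
      exact ibp (hΦ k) (sVf j k) (e1 j) (iV j) (idV j) (iDV j)
    rw [key]
    refine (H k).trans (le_of_eq ?_)
    rw [pow_succ]; ring

end Ibp

section Gram
variable {n : ℕ}

theorem eL_sq {X : Type*} [MeasurableSpace X] {μ : Measure X} (f : X → ℂ) :
    eLpNorm f 2 μ ^ 2 = ∫⁻ x, ‖f x‖ₑ ^ 2 ∂μ := by
  have := eLpNorm_nnreal_pow_eq_lintegral (μ := μ) (f := f) (p := 2) (by norm_num)
  simpa using this

theorem cs_int {X : Type*} [MeasurableSpace X] {μ : Measure X} {f g : X → ℂ}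
    (hf : AEStronglyMeasurable f μ) (hg : AEStronglyMeasurable g μ) :
    ‖∫ x, f x * g x ∂μ‖ₑ ≤ eLpNorm f 2 μ * eLpNorm g 2 μ := by
  refine (enorm_integral_le_lintegral_enorm _).trans ?_
  have := eLpNorm_smul_le_mul_eLpNorm (p := 2) (q := 2) (r := 1) hg hf
  rw [eLpNorm_one_eq_lintegral_enorm] at this
  simpa using this

theorem eL_conj {X : Type*} [MeasurableSpace X] {μ : Measure X} (f : X → ℂ) :
    eLpNorm (fun x => (starRingEnd ℂ) (f x)) 2 μ = eLpNorm f 2 μ :=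
  eLpNorm_congr_norm_ae (Filter.Eventually.of_forall fun x => by simp)

theorem enn_mul_le (a b : ℝ≥0∞) : a * b ≤ a ^ 2 + b ^ 2 := by
  rcases le_total a b with h | h
  · exact (mul_le_mul_left h b).trans (by rw [← pow_two]; exact le_add_self)
  · exact (mul_le_mul_right h a).trans (by rw [← pow_two]; exact le_self_add)

theorem schur {g k : En n → ℝ≥0∞} (hg : Measurable g) (hk : Measurable k) :
    ∫⁻ p, ∫⁻ p', g p * g p' * k (p - p') ≤ 2 * (∫⁻ x, k x) * ∫⁻ p, g p ^ 2 := by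
  have h1 : ∫⁻ p, ∫⁻ p', g p ^ 2 * k (p - p') = (∫⁻ x, k x) * ∫⁻ p, g p ^ 2 := by
    rw [← lintegral_const_mul _ (hg.pow_const 2)]
    refine lintegral_congr fun p => ?_
    rw [lintegral_const_mul _ (show Measurable (fun p' => k (p - p')) from
      hk.comp (measurable_const.sub measurable_id)),
      lintegral_sub_left_eq_self, mul_comm]
  have h2 : ∫⁻ p, ∫⁻ p', g p' ^ 2 * k (p - p') = (∫⁻ x, k x) * ∫⁻ p, g p ^ 2 := by
    rw [lintegral_lintegral_swap]
    · rw [← lintegral_const_mul _ (hg.pow_const 2)]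
      refine lintegral_congr fun p => ?_
      rw [lintegral_const_mul _ (show Measurable (fun x => k (x - p)) from
        hk.comp (measurable_id.sub measurable_const)),
        lintegral_sub_right_eq_self, mul_comm]
    · exact (((hg.comp measurable_snd).pow_const 2).mul
        (hk.comp (measurable_fst.sub measurable_snd))).aemeasurable
  calc ∫⁻ p, ∫⁻ p', g p * g p' * k (p - p')
      ≤ ∫⁻ p, ∫⁻ p', (g p ^ 2 * k (p - p') + g p' ^ 2 * k (p - p')) := by
        refine lintegral_mono fun p => lintegral_mono fun p' => ?_
        simp only
        rw [← add_mul]; exact mul_le_mul_left (enn_mul_le _ _) _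
    _ = ∫⁻ p, ((∫⁻ p', g p ^ 2 * k (p - p')) + ∫⁻ p', g p' ^ 2 * k (p - p')) := by
        refine lintegral_congr fun p => ?_
        exact lintegral_add_left (measurable_const.mul
          (hk.comp (measurable_const.sub measurable_id))) _
    _ = _ := by
        rw [lintegral_add_left, h1, h2]
        · ring
        · exact Measurable.lintegral_prod_right' (f := fun q : En n × En n => g q.1 ^ 2 * k (q.1 - q.2))
            (((hg.comp measurable_fst).pow_const 2).mul
              (hk.comp (measurable_fst.sub measurable_snd)))

theorem gram_integrable {A A' : En n × En n → ℂ} (hA : Continuous A) (hA' : Continuous A')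
    {w : En n → ℝ} (hw : Integrable (fun x => w x * w x))
    (h : ∀ x y, ‖A (x, y)‖ ≤ w x) (h' : ∀ x y, ‖A' (x, y)‖ ≤ w x) {f f' : En n → ℂ}
    (hf : Integrable f) (hf' : Integrable f') :
    Integrable (fun q : En n × (En n × En n) => (A (q.1, q.2.1) * f q.2.1) *
      (starRingEnd ℂ) (A' (q.1, q.2.2) * f' q.2.2))
      ((volume : Measure (En n)).prod ((volume : Measure (En n)).prod volume)) := by
  have i1 : Integrable (fun q : En n × (En n × En n) => (w q.1 * w q.1) *
      (‖f q.2.1‖ * ‖f' q.2.2‖)) ((volume : Measure (En n)).prod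
      ((volume : Measure (En n)).prod volume)) :=
    hw.mul_prod (hf.norm.mul_prod hf'.norm)
  have m1 : AEStronglyMeasurable (fun q : En n × (En n × En n) => f q.2.1)
      ((volume : Measure (En n)).prod ((volume : Measure (En n)).prod volume)) :=
    (hf.1.comp_fst (ν := volume)).comp_snd (μ := volume)
  have m2 : AEStronglyMeasurable (fun q : En n × (En n × En n) => f' q.2.2)
      ((volume : Measure (En n)).prod ((volume : Measure (En n)).prod volume)) :=
    (hf'.1.comp_snd (μ := volume)).comp_snd (μ := volume)
  refine i1.mono' ?_ (Filter.Eventually.of_forall fun q => ?_)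
  · refine AEStronglyMeasurable.mul ?_ ?_
    · exact (hA.comp (by fun_prop)).aestronglyMeasurable.mul m1
    · exact Complex.continuous_conj.comp_aestronglyMeasurable
        ((hA'.comp (by fun_prop)).aestronglyMeasurable.mul m2)
  · rw [norm_mul, RCLike.norm_conj, norm_mul, norm_mul]
    have h0 := h q.1 q.2.1
    have h1 := h' q.1 q.2.2
    calc _ = (‖A (q.1, q.2.1)‖ * ‖A' (q.1, q.2.2)‖) * (‖f q.2.1‖ * ‖f' q.2.2‖) := by ring
      _ ≤ _ := by
        refine mul_le_mul_of_nonneg_right ?_ (by positivity)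
        exact mul_le_mul h0 h1 (norm_nonneg _) ((norm_nonneg _).trans h0)

theorem gram {A A' : En n × En n → ℂ} (hA : Continuous A) (hA' : Continuous A')
    {w : En n → ℝ} (hw : Integrable (fun x => w x * w x))
    (h : ∀ x y, ‖A (x, y)‖ ≤ w x) (h' : ∀ x y, ‖A' (x, y)‖ ≤ w x) {f f' : En n → ℂ}
    (hf : Integrable f) (hf' : Integrable f') :
    ∫ x, (∫ y, A (x, y) * f y) * (starRingEnd ℂ) (∫ y, A' (x, y) * f' y) =
      ∫ q : En n × En n, f q.1 * (starRingEnd ℂ) (f' q.2) *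
        ∫ x, A (x, q.1) * (starRingEnd ℂ) (A' (x, q.2)) := by
  have hi := gram_integrable hA hA' hw h h' hf hf'
  have e1 : ∀ x, (∫ y, A (x, y) * f y) * (starRingEnd ℂ) (∫ y, A' (x, y) * f' y) =
      ∫ q : En n × En n, (A (x, q.1) * f q.1) *
      (starRingEnd ℂ) (A' (x, q.2) * f' q.2) ∂((volume : Measure (En n)).prod volume) := by
    intro x
    rw [← integral_conj, integral_prod_mul (μ := (volume : Measure (En n))) (ν := volume)
      (fun y => A (x, y) * f y) (fun y => (starRingEnd ℂ) (A' (x, y) * f' y))]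
  simp_rw [e1]
  rw [integral_integral_swap hi]
  refine integral_congr_ae (Filter.Eventually.of_forall fun q => ?_)
  simp only
  rw [← integral_const_mul]
  refine integral_congr_ae (Filter.Eventually.of_forall fun x => ?_)
  simp only [map_mul]
  ring

end Gram

section SOp
variable {n : ℕ} {κ : Type*}

/-- vanishing for `ξ` outside `K` -/
def Vn (K : Set (En n)) (b : En n × En n → ℂ) : Prop := ∀ y ξ, ξ ∉ K → b (y, ξ) = 0

theorem Vn.mul {K : Set (En n)} {b : En n × En n → ℂ} (h : Vn K b) (f : En n × En n → ℂ) :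
    Vn K (fun z => f z * b z) := fun y ξ hξ => by simp [h y ξ hξ]

theorem Vn.dLine {K : Set (En n)} (hK : IsCompact K) {b : En n × En n → ℂ} (h : Vn K b)
    (j : Fin n) : Vn K (_root_.dLine (dY j) b) := by
  intro y ξ hξ
  have : b =ᶠ[nhds (y, ξ)] fun _ => 0 := by
    have ho : IsOpen {z : En n × En n | z.2 ∉ K} :=
      hK.isClosed.isOpen_compl.preimage continuous_snd
    filter_upwards [ho.mem_nhds (show (y, ξ).2 ∉ K from hξ)] with z hz
    exact h z.1 z.2 hz
  unfold _root_.dLine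
  rw [this.fderiv_eq]; simp

/-- single amplitude -/
structure Am (K : Set (En n)) (b : En n × En n → ℂ) : Prop where
  ct : Continuous b
  bd : ∃ C : ℝ, ∀ z, ‖b z‖ ≤ C
  vn : Vn K b

/-- the operator -/
def So (φ : En n × En n → ℝ) (b : En n × En n → ℂ) (u : En n → ℂ) (ξ : En n) : ℂ :=
  ∫ y, ex (φ (y, ξ)) * b (y, ξ) * u y

/-- its Gram kernel -/
def Kf (φ : En n × En n → ℝ) (b b' : En n × En n → ℂ) (q : En n × En n) : ℂ :=
  ∫ ξ, ex (φ (q.1, ξ) - φ (q.2, ξ)) * (b (q.1, ξ) * (starRingEnd ℂ) (b' (q.2, ξ)))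

/-- the Gram form -/
def Bf (φ : En n × En n → ℝ) (b b' : En n × En n → ℂ) (u v : En n → ℂ) : ℂ :=
  ∫ q : En n × En n, u q.1 * (starRingEnd ℂ) (v q.2) * Kf φ b b' q

variable {K : Set (En n)} {φ : En n × En n → ℝ} {b b' : En n × En n → ℂ} {u v : En n → ℂ}

theorem So_cont (hφ : Continuous φ) (hb : Am K b) (hu : Integrable u) :
    Continuous (So φ b u) := by
  obtain ⟨C, hC⟩ := hb.bd
  have hb' := hb.ct
  refine continuous_of_dominated (bound := fun y => C * ‖u y‖) (fun ξ => ?_) (fun ξ => ?_)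
    (hu.norm.const_mul C) ?_
  · exact (((ex_cont.comp (hφ.comp (by fun_prop))).mul
      (hb'.comp (by fun_prop))).aestronglyMeasurable).mul hu.1
  · refine Filter.Eventually.of_forall fun y => ?_
    rw [norm_mul, norm_mul, norm_ex, one_mul]
    exact mul_le_mul_of_nonneg_right (hC _) (norm_nonneg _)
  · refine Filter.Eventually.of_forall fun y => ?_
    exact ((ex_cont.comp (hφ.comp (by fun_prop))).mul
      (hb'.comp (by fun_prop))).mul continuous_const

theorem So_vn (hb : Vn K b) (ξ : En n) (h : ξ ∉ K) : So φ b u ξ = 0 := by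
  unfold So
  simp [hb _ ξ h]

theorem So_memLp (hK : IsCompact K) (hφ : Continuous φ) (hb : Am K b) (hu : Integrable u)
    (p : ℝ≥0∞) : MemLp (So φ b u) p :=
  (So_cont hφ hb hu).memLp_of_hasCompactSupport
    (HasCompactSupport.intro hK fun ξ h => So_vn hb.vn ξ h)

theorem Kf_int (hK : IsCompact K) (hφ : Continuous φ) (hb : Am K b) (hb' : Am K b')
    (q : En n × En n) :
    Integrable (fun ξ => ex (φ (q.1, ξ) - φ (q.2, ξ)) *
      (b (q.1, ξ) * (starRingEnd ℂ) (b' (q.2, ξ)))) := by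
  have h1 := hb.ct
  have h2 := hb'.ct
  refine Continuous.integrable_of_hasCompactSupport ?_
    (HasCompactSupport.intro hK fun ξ h => by simp [hb.vn _ ξ h])
  exact (ex_cont.comp ((hφ.comp (by fun_prop)).sub (hφ.comp (by fun_prop)))).mul
    ((h1.comp (by fun_prop)).mul (Complex.continuous_conj.comp (h2.comp (by fun_prop))))

theorem Kf_cont (hK : IsCompact K) (hφ : Continuous φ) (hb : Am K b) (hb' : Am K b') :
    Continuous (Kf φ b b') := by
  have h1 := hb.ct
  have h2 := hb'.ct
  have := continuous_parametric_integral_of_continuous (μ := (volume : Measure (En n)))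
    (f := fun (q : En n × En n) ξ => ex (φ (q.1, ξ) - φ (q.2, ξ)) *
      (b (q.1, ξ) * (starRingEnd ℂ) (b' (q.2, ξ)))) (by
      unfold Function.uncurry
      exact (ex_cont.comp ((hφ.comp (by fun_prop)).sub (hφ.comp (by fun_prop)))).mul
        ((h1.comp (by fun_prop)).mul (Complex.continuous_conj.comp (h2.comp (by fun_prop))))) hK
  convert this using 2 with q
  unfold Kf
  rw [setIntegral_eq_integral_of_forall_compl_eq_zero]
  intro ξ h; simp [hb.vn _ ξ h]

theorem Kf_bd (hK : IsCompact K) (hb : Am K b) (hb' : Am K b') :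
    ∃ C : ℝ, ∀ q, ‖Kf φ b b' q‖ ≤ C := by
  obtain ⟨C, hC⟩ := hb.bd
  obtain ⟨C', hC'⟩ := hb'.bd
  refine ⟨C * C' * (volume K).toReal, fun q => ?_⟩
  unfold Kf
  rw [← setIntegral_eq_integral_of_forall_compl_eq_zero (s := K)
    (fun ξ h => by simp [hb.vn _ ξ h])]
  refine norm_setIntegral_le_of_norm_le_const (hK.measure_lt_top) fun ξ _ => ?_
  rw [norm_mul, norm_ex, one_mul, norm_mul, RCLike.norm_conj]
  exact mul_le_mul (hC _) (hC' _) (norm_nonneg _) ((norm_nonneg _).trans (hC (q.1, ξ)))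

theorem Bf_int (hK : IsCompact K) (hφ : Continuous φ) (hb : Am K b) (hb' : Am K b')
    (hu : Integrable u) (hv : Integrable v) :
    Integrable (fun q : En n × En n => u q.1 * (starRingEnd ℂ) (v q.2) * Kf φ b b' q) := by
  obtain ⟨C, hC⟩ := Kf_bd (φ := φ) hK hb hb'
  have i1 : Integrable (fun q : En n × En n => u q.1 * (starRingEnd ℂ) (v q.2))
      ((volume : Measure (En n)).prod volume) :=
    hu.mul_prod (Integrable.mono hv (Complex.continuous_conj.comp_aestronglyMeasurable hv.1)
      (Filter.Eventually.of_forall fun y => by simp))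
  exact i1.mul_bdd (c := C) (Kf_cont hK hφ hb hb').aestronglyMeasurable
    (Filter.Eventually.of_forall hC)

theorem Bf_eq (hK : IsCompact K) (hφ : Continuous φ) (hb : Am K b) (hb' : Am K b')
    (hu : Integrable u) (hv : Integrable v) :
    ∫ ξ, So φ b u ξ * (starRingEnd ℂ) (So φ b' v ξ) = Bf φ b b' u v := by
  obtain ⟨C, hC⟩ := hb.bd
  obtain ⟨C', hC'⟩ := hb'.bd
  have h1 := hb.ct
  have h2 := hb'.ct
  let A : En n × En n → ℂ := fun q => ex (φ (q.2, q.1)) * b (q.2, q.1)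
  let A' : En n × En n → ℂ := fun q => ex (φ (q.2, q.1)) * b' (q.2, q.1)
  let w : En n → ℝ := K.indicator fun _ => max C C'
  have hw : Integrable (fun x => w x * w x) := by
    have : (fun x => w x * w x) = K.indicator fun _ => max C C' * max C C' := by
      funext x; by_cases hx : x ∈ K <;> simp [w, hx]
    rw [this]
    exact (integrable_indicator_iff hK.measurableSet).2
      (integrableOn_const (hK.measure_lt_top.ne))
  have key := gram (A := A) (A' := A') ((ex_cont.comp (hφ.comp (by fun_prop))).mul
      (h1.comp (by fun_prop))) ((ex_cont.comp (hφ.comp (by fun_prop))).mul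
      (h2.comp (by fun_prop))) hw (fun x y => ?_) (fun x y => ?_) hu hv
  · unfold So Bf
    refine key.trans ?_
    refine integral_congr_ae (Filter.Eventually.of_forall fun q => ?_)
    simp only [Kf]
    congr 1
    refine integral_congr_ae (Filter.Eventually.of_forall fun ξ => ?_)
    simp only [A, A', map_mul, conj_ex]
    rw [sub_eq_add_neg, ex_add]; ring
  · simp only [A, norm_mul, norm_ex, one_mul]
    by_cases hx : x ∈ K
    · simpa only [w, Set.indicator_of_mem hx] using (hC (y, x)).trans (le_max_left _ _)
    · simp [w, hx, hb.vn _ x hx]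
  · simp only [A', norm_mul, norm_ex, one_mul]
    by_cases hx : x ∈ K
    · simpa only [w, Set.indicator_of_mem hx] using (hC' (y, x)).trans (le_max_right _ _)
    · simp [w, hx, hb'.vn _ x hx]

theorem sq_int {h : En n → ℂ} (hh : MemLp h 2) :
    ‖∫ x, h x * (starRingEnd ℂ) (h x)‖ₑ = eLpNorm h 2 volume ^ 2 := by
  have e : ∀ x, h x * (starRingEnd ℂ) (h x) = ((‖h x‖ ^ 2 : ℝ) : ℂ) := fun x => by
    rw [Complex.mul_conj, Complex.normSq_eq_norm_sq]
  simp_rw [e]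
  rw [integral_complex_ofReal, eL_sq]
  have hi : Integrable (fun x => ‖h x‖ ^ 2) := hh.integrable_norm_pow (by norm_num)
  rw [← ofReal_norm_eq_enorm, Complex.norm_real, Real.norm_of_nonneg
    (integral_nonneg fun x => by positivity),
    ofReal_integral_eq_lintegral_ofReal hi (Filter.Eventually.of_forall fun x => by positivity)]
  refine lintegral_congr fun x => ?_
  rw [ENNReal.ofReal_pow (norm_nonneg _), ofReal_norm_eq_enorm]

end SOp

section YOne
variable {n : ℕ} {κ : Type*}

theorem wt_le_one {r : ℝ} (hr : 0 ≤ r) (p y : En n) : wt r p y ≤ 1 :=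
  Real.rpow_le_one_of_one_le_of_nonpos (jap_one_le _) (by linarith)

theorem wt_cont (r : ℝ) : Continuous (fun q : En n × En n => wt r q.1 q.2) := by
  unfold wt
  exact (jap_cont.comp (by fun_prop)).rpow_const fun q => Or.inl (jap_pos _).ne'

theorem wt_cont_right (r : ℝ) (p : En n) : Continuous (fun y : En n => wt r p y) := by
  unfold wt
  exact (jap_cont.comp (by fun_prop)).rpow_const fun q => Or.inl (jap_pos _).ne'

theorem wt_add (r s : ℝ) (p y : En n) : wt (r + s) p y = wt r p y * wt s p y := by
  unfold wt; rw [← Real.rpow_add (jap_pos _)]; congr 1; ring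

theorem Ph.dXsub {N : ℕ} {φ : κ → En n × En n → ℝ} (h : Ph N φ) (j : Fin n) :
    FB e1 g1 N (fun (s : κ × En n × En n) _ => jap (s.2.1 - s.2.2))
      (fun s => dLine (e1 j) (fun y => φ s.1 (y, s.2.1) - φ s.1 (y, s.2.2))) := by
  have := diffXi (f := fun i => dLine (dX j) (φ i)) (N := N) (fun i => (h.sm i).dLine _)
    (fun k => by
      have e : (fun i => dLine (dY k) (dLine (dX j) (φ i))) =
        fun i => dLine (dX j) (dLine (dY k) (φ i)) := by
        funext i; exact dLine_comm (h.sm i) _ _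
      rw [e]; exact h.d2 j k)
  convert this using 2 with s
  rw [dLine_sub ((h.sm s.1).left _) ((h.sm s.1).left _), dLine_left (h.sm s.1),
    dLine_left (h.sm s.1)]

theorem kernXi {N : ℕ} (hN : n + 1 ≤ N) {φ : κ → En n × En n → ℝ} (hφ : Ph (N + 1) φ)
    {b : κ → En n × En n → ℂ} (sb : ∀ k, Sm (b k)) {lam : κ → ℝ} (hlam : ∀ k, 0 ≤ lam k)
    {p : κ → En n} {r : ℝ} (hr : (n : ℝ) < r)
    (Fb : FB v2 g1 N (fun k z => lam k * wt r (p k) z.1) b) :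
    ∃ C : ℝ, 0 < C ∧ ∀ k ξ ξ', ‖∫ y, ex (φ k (y, ξ) - φ k (y, ξ')) *
      (b k (y, ξ) * (starRingEnd ℂ) (b k (y, ξ')))‖ ≤
        C * (lam k ^ 2 * jap (ξ - ξ') ^ (-((n : ℝ) + 1))) := by
  obtain ⟨c, hc, hl⟩ := hφ.lowXi
  have hr0 : 0 ≤ r := (Nat.cast_nonneg n).trans hr.le
  have hw : ∀ k (y : En n), 0 ≤ lam k * wt r (p k) y := fun k y =>
    mul_nonneg (hlam k) (wt_pos _ _ _).le
  have F1 : FB e1 g1 N (fun (s : κ × En n × En n) y => lam s.1 * wt r (p s.1) y)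
      (fun s y => b s.1 (y, s.2.1)) :=
    FB.comp (v' := e1) (g' := g1) sb Fb (fun k z => hw k z.1) g1_nonneg g1_nonneg
      (fun s : κ × En n × En n => s.1) (fun s y => (y, s.2.1)) _
      (fun s y => hasF_left s.2.1 y) Sum.inl (fun j => rfl) (fun k j z => le_rfl)
  have F2 : FB e1 g1 N (fun (s : κ × En n × En n) y => lam s.1 * wt r (p s.1) y)
      (fun s y => b s.1 (y, s.2.2)) :=
    FB.comp (v' := e1) (g' := g1) sb Fb (fun k z => hw k z.1) g1_nonneg g1_nonneg
      (fun s : κ × En n × En n => s.1) (fun s y => (y, s.2.2)) _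
      (fun s y => hasF_left s.2.2 y) Sum.inl (fun j => rfl) (fun k j z => le_rfl)
  have s1 : ∀ s : κ × En n × En n, Sm (fun y => b s.1 (y, s.2.1)) := fun s => (sb s.1).left _
  have s2 : ∀ s : κ × En n × En n, Sm (fun y => b s.1 (y, s.2.2)) := fun s => (sb s.1).left _
  have s3 : ∀ s : κ × En n × En n, Sm (fun y => (starRingEnd ℂ) (b s.1 (y, s.2.2))) := fun s =>
    Sm.clm (Complex.conjCLE : ℂ →L[ℝ] ℂ) (s2 s)
  have F3 : FB e1 g1 N (fun (s : κ × En n × En n) y => lam s.1 * wt r (p s.1) y)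
      (fun s y => (starRingEnd ℂ) (b s.1 (y, s.2.2))) :=
    FB.clm (Complex.conjCLE : ℂ →L[ℝ] ℂ) s2 F2
  have F4 : FB e1 g1 N (fun (s : κ × En n × En n) y => lam s.1 ^ 2 * wt r (p s.1) y)
      (fun s y => b s.1 (y, s.2.1) * (starRingEnd ℂ) (b s.1 (y, s.2.2))) := by
    refine (FB.mul s1 s3 F1 F3).mono g1_nonneg (fun s y => mul_nonneg (hw _ _) (hw _ _)) 1 ?_
    intro s y
    have h1 := wt_le_one hr0 (p s.1) y
    have h2 := wt_pos r (p s.1) y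
    calc _ = lam s.1 ^ 2 * wt r (p s.1) y * wt r (p s.1) y := by ring
      _ ≤ _ := by
        rw [one_mul]
        exact mul_le_of_le_one_right (by positivity) h1
  obtain ⟨C, hC, H⟩ := NSP (Φ := fun (s : κ × En n × En n) y => φ s.1 (y, s.2.1) - φ s.1 (y, s.2.2))
    (lam := fun s => jap (s.2.1 - s.2.2)) (p := fun s => p s.1)
    (fun s => ((hφ.sm s.1).left _).sub ((hφ.sm s.1).left _)) (fun s => jap_one_le _)
    (fun j => (hφ.le (Nat.le_succ N)).dXsub j) hc
    (fun s y => by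
      have := hl s.1 y s.2.1 s.2.2
      convert this using 4 with j
      rw [dLine_sub ((hφ.sm s.1).left _) ((hφ.sm s.1).left _), dLine_left (hφ.sm s.1),
        dLine_left (hφ.sm s.1)])
    hr (n + 1) hN _ (fun s => lam s.1 ^ 2) (fun s => (s1 s).mul (s3 s)) (fun s => sq_nonneg _)
    (F4.le hN)
  refine ⟨C, hC, fun k ξ ξ' => (H (k, ξ, ξ')).trans (le_of_eq ?_)⟩
  simp only
  rw [inv_pow, ← Real.rpow_natCast (jap (ξ - ξ')) (n + 1), ← Real.rpow_neg (jap_pos _).le]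
  push_cast; rfl

theorem absorb {G U Hn D : ℝ≥0∞} (hG : G ≠ ∞) (h1 : G ^ 2 ≤ U * Hn)
    (h2 : Hn ^ 2 ≤ D ^ 2 * G ^ 2) : G ≤ D * U := by
  have h3 : Hn ≤ D * G := by
    rw [← mul_pow] at h2
    exact (ENNReal.pow_le_pow_left_iff (by norm_num)).1 h2
  rcases eq_or_ne G 0 with h0 | h0
  · simp [h0]
  have h4 : G * G ≤ (D * U) * G := by
    rw [← pow_two]
    refine h1.trans ((mul_le_mul_right h3 U).trans (le_of_eq (by ring)))
  exact (ENNReal.mul_le_mul_iff_left h0 hG).1 h4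

set_option maxHeartbeats 1000000 in
theorem Y1 {N : ℕ} (hN : n + 1 ≤ N) {φ : κ → En n × En n → ℝ} (hφ : Ph (N + 1) φ)
    {b : κ → En n × En n → ℂ} (sb : ∀ k, Sm (b k)) {K : κ → Set (En n)}
    (hK : ∀ k, IsCompact (K k)) (hb : ∀ k, Vn (K k) (b k)) {lam : κ → ℝ} (hlam : ∀ k, 0 ≤ lam k)
    {p : κ → En n} {r : ℝ} (hr : (n : ℝ) < r)
    (Fb : FB v2 g1 N (fun k z => lam k * wt r (p k) z.1) b) :
    ∃ C : ℝ, 0 < C ∧ ∀ k u, Integrable u → MemLp u 2 →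
      eLpNorm (So (φ k) (b k) u) 2 volume ≤ ENNReal.ofReal (C * lam k) * eLpNorm u 2 volume := by
  obtain ⟨C, hC, hk⟩ := kernXi hN hφ sb hlam hr Fb
  obtain ⟨C1, hC1, hb1⟩ := Fb.bound (fun k z => mul_nonneg (hlam k) (wt_pos _ _ _).le)
  have hr0 : 0 ≤ r := (Nat.cast_nonneg n).trans hr.le
  let I0 : ℝ := ∫ y : En n, jap y ^ (-((n : ℝ) + 1))
  have hI0 : 0 ≤ I0 := integral_nonneg fun y => Real.rpow_nonneg (jap_pos y).le _
  have iJ : Integrable (fun y : En n => jap y ^ (-((n : ℝ) + 1))) := by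
    simpa using integrable_jap (n := n) (r := (n : ℝ) + 1) (by linarith) 0
  refine ⟨Real.sqrt (2 * C * I0) + 1, by positivity, fun k u hu hu2 => ?_⟩
  have cφ : Continuous (φ k) := (hφ.sm k).cont
  have cb : Continuous (b k) := (sb k).cont
  have am : Am (K k) (b k) := ⟨cb, ⟨C1 * (lam k * 1), fun z => (hb1 k z).trans
    (mul_le_mul_of_nonneg_left (mul_le_mul_of_nonneg_left (wt_le_one hr0 _ _) (hlam k)) hC1.le)⟩,
    hb k⟩
  let g : En n → ℂ := So (φ k) (b k) u
  have gc : Continuous g := So_cont cφ am hu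
  have g1 : Integrable g := memLp_one_iff_integrable.1 (So_memLp (hK k) cφ am hu 1)
  have g2 : MemLp g 2 := So_memLp (hK k) cφ am hu 2
  let A : En n × En n → ℂ := fun q => (starRingEnd ℂ) (ex (φ k q) * b k q)
  have cA : Continuous A := Complex.continuous_conj.comp ((ex_cont.comp cφ).mul cb)
  let w : En n → ℝ := fun y => C1 * (lam k * wt r (p k) y)
  have hA : ∀ y ξ, ‖A (y, ξ)‖ ≤ w y := fun y ξ => by
    simp only [A, RCLike.norm_conj, norm_mul, norm_ex, one_mul]
    exact hb1 k (y, ξ)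
  have wc : Continuous w := by
    have h0 := wt_cont_right r (p k)
    exact continuous_const.mul (continuous_const.mul h0)
  have w0 : ∀ y, 0 ≤ w y := fun y => mul_nonneg hC1.le (mul_nonneg (hlam k) (wt_pos _ _ _).le)
  have hw : Integrable (fun y => w y * w y) := by
    have h0 := ((integrable_jap hr (p k)).const_mul (C1 * lam k * (C1 * lam k)))
    refine h0.mono' (wc.mul wc).aestronglyMeasurable (Filter.Eventually.of_forall fun y => ?_)
    rw [Real.norm_of_nonneg (mul_nonneg (w0 y) (w0 y))]
    have h1 := wt_le_one hr0 (p k) y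
    have h2 := wt_pos r (p k) y
    have h3 := hlam k
    have h4 : (C1 * lam k * (C1 * lam k) * wt r (p k) y) * wt r (p k) y ≤
        C1 * lam k * (C1 * lam k) * wt r (p k) y := mul_le_of_le_one_right (by positivity) h1
    refine le_trans (le_of_eq ?_) h4
    simp only [w]; ring
  let H : En n → ℂ := fun y => ∫ ξ, A (y, ξ) * g ξ
  have Hm : AEStronglyMeasurable H volume := by
    have : AEStronglyMeasurable (fun q : En n × En n => A q * g q.2)
        ((volume : Measure (En n)).prod volume) :=
      (cA.mul (gc.comp continuous_snd)).aestronglyMeasurable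
    exact this.integral_prod_right'
  have Hb : ∀ y, ‖H y‖ ≤ w y * ∫ ξ, ‖g ξ‖ := fun y => by
    rw [← integral_const_mul]
    refine norm_integral_le_of_norm_le (g1.norm.const_mul _)
      (Filter.Eventually.of_forall fun ξ => ?_)
    rw [norm_mul]; exact mul_le_mul_of_nonneg_right (hA y ξ) (norm_nonneg _)
  have H2 : MemLp H 2 := by
    rw [memLp_two_iff_integrable_sq_norm Hm]
    refine (hw.mul_const ((∫ ξ, ‖g ξ‖) ^ 2)).mono' (Hm.norm.pow 2)
      (Filter.Eventually.of_forall fun y => ?_)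
    rw [Real.norm_of_nonneg (by positivity)]
    calc ‖H y‖ ^ 2 ≤ (w y * ∫ ξ, ‖g ξ‖) ^ 2 := pow_le_pow_left₀ (norm_nonneg _) (Hb y) 2
      _ = _ := by ring
  -- duality
  have dual : ∫ ξ, g ξ * (starRingEnd ℂ) (g ξ) = ∫ y, u y * (starRingEnd ℂ) (H y) := by
    have i0 : Integrable (fun q : En n × En n => (starRingEnd ℂ) (g q.1) * u q.2 *
        (ex (φ k (q.2, q.1)) * b k (q.2, q.1))) ((volume : Measure (En n)).prod volume) := by
      obtain ⟨B, hB⟩ := am.bd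
      refine Integrable.mul_bdd (c := B) (Integrable.mul_prod (Integrable.mono g1
        (Complex.continuous_conj.comp_aestronglyMeasurable g1.1)
        (Filter.Eventually.of_forall fun y => by simp)) hu) ?_ ?_
      · exact ((ex_cont.comp (cφ.comp (by fun_prop))).mul
          (cb.comp (by fun_prop))).aestronglyMeasurable
      · exact Filter.Eventually.of_forall fun q => by
          rw [norm_mul, norm_ex, one_mul]; exact hB _
    have e1 : ∀ ξ, g ξ * (starRingEnd ℂ) (g ξ) = ∫ y, (starRingEnd ℂ) (g ξ) * u y *
        (ex (φ k (y, ξ)) * b k (y, ξ)) := fun ξ => by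
      conv_lhs => rw [mul_comm]
      conv_lhs => arg 2; rw [show g ξ = ∫ y, ex (φ k (y, ξ)) * b k (y, ξ) * u y from rfl]
      rw [← integral_const_mul]
      exact integral_congr_ae (Filter.Eventually.of_forall fun y => by simp only; ring)
    simp_rw [e1]
    rw [integral_integral_swap i0]
    refine integral_congr_ae (Filter.Eventually.of_forall fun y => ?_)
    simp only [H]
    rw [← integral_conj, ← integral_const_mul]
    refine integral_congr_ae (Filter.Eventually.of_forall fun ξ => ?_)
    simp only [A, map_mul, Complex.conj_conj]
    ring
  have step1 : eLpNorm g 2 volume ^ 2 ≤ eLpNorm u 2 volume * eLpNorm H 2 volume := by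
    rw [← sq_int g2, dual, ← eL_conj H]
    exact cs_int hu.1 (Complex.continuous_conj.comp_aestronglyMeasurable Hm)
  have step2 : eLpNorm H 2 volume ^ 2 ≤
      ENNReal.ofReal (2 * C * I0 * lam k ^ 2) * eLpNorm g 2 volume ^ 2 := by
    rw [← sq_int H2]
    have := gram (A := A) (A' := A) cA cA hw hA hA g1 g1
    rw [this]
    refine (enorm_integral_le_lintegral_enorm _).trans ?_
    have kb : ∀ q : En n × En n, ‖∫ y, A (y, q.1) * (starRingEnd ℂ) (A (y, q.2))‖ₑ ≤
        ENNReal.ofReal (C * lam k ^ 2) *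
          ENNReal.ofReal (jap (q.1 - q.2) ^ (-((n : ℝ) + 1))) := fun q => by
      rw [← ENNReal.ofReal_mul (by positivity), ← ofReal_norm_eq_enorm]
      refine ENNReal.ofReal_le_ofReal ?_
      have h0 := hk k q.2 q.1
      rw [jap_sub_comm, ← mul_assoc] at h0
      refine le_trans (le_of_eq ?_) h0
      congr 1
      refine integral_congr_ae (Filter.Eventually.of_forall fun y => ?_)
      simp only [A, map_mul, Complex.conj_conj, conj_ex]
      rw [sub_eq_add_neg, ex_add]; ring
    calc ∫⁻ q : En n × En n, ‖g q.1 * (starRingEnd ℂ) (g q.2) *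
          ∫ y, A (y, q.1) * (starRingEnd ℂ) (A (y, q.2))‖ₑ
        ≤ ∫⁻ q : En n × En n, ENNReal.ofReal (C * lam k ^ 2) * (‖g q.1‖ₑ * ‖g q.2‖ₑ *
          ENNReal.ofReal (jap (q.1 - q.2) ^ (-((n : ℝ) + 1)))) := by
          refine lintegral_mono fun q => ?_
          simp only [enorm_mul]
          have e2 : ‖(starRingEnd ℂ) (g q.2)‖ₑ = ‖g q.2‖ₑ := by
            rw [← ofReal_norm_eq_enorm, RCLike.norm_conj, ofReal_norm_eq_enorm]
          rw [e2]
          refine (mul_le_mul_right (kb q) _).trans (le_of_eq (by ring))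
      _ = ENNReal.ofReal (C * lam k ^ 2) * ∫⁻ ξ, ∫⁻ ξ', ‖g ξ‖ₑ * ‖g ξ'‖ₑ *
          ENNReal.ofReal (jap (ξ - ξ') ^ (-((n : ℝ) + 1))) := by
          have mm : Measurable (fun q : En n × En n => ‖g q.1‖ₑ * ‖g q.2‖ₑ *
              ENNReal.ofReal (jap (q.1 - q.2) ^ (-((n : ℝ) + 1)))) := by
            refine Measurable.mul (M := ℝ≥0∞) (Measurable.mul (M := ℝ≥0∞) ?_ ?_) ?_
            · exact ((gc.comp continuous_fst).enorm.measurable)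
            · exact (gc.comp continuous_snd).enorm.measurable
            · refine Measurable.ennreal_ofReal (Continuous.measurable ?_)
              exact (jap_cont.comp (by fun_prop)).rpow_const fun q => Or.inl (jap_pos _).ne'
          rw [lintegral_const_mul _ mm]
          congr 1
          exact lintegral_prod (μ := (volume : Measure (En n))) (ν := volume) _ mm.aemeasurable
      _ ≤ ENNReal.ofReal (C * lam k ^ 2) * (2 * (∫⁻ ξ : En n,
            ENNReal.ofReal (jap ξ ^ (-((n : ℝ) + 1)))) * ∫⁻ ξ, ‖g ξ‖ₑ ^ 2) := by
          refine mul_le_mul_right (schur gc.enorm.measurable ?_) _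
          refine Measurable.ennreal_ofReal (Continuous.measurable ?_)
          exact jap_cont.rpow_const fun q => Or.inl (jap_pos _).ne'
      _ = _ := by
          rw [← eL_sq, ← ofReal_integral_eq_lintegral_ofReal iJ
            (Filter.Eventually.of_forall fun y => Real.rpow_nonneg (jap_pos y).le _)]
          change _ * (2 * ENNReal.ofReal I0 * _) = _
          rw [show 2 * C * I0 * lam k ^ 2 = (C * lam k ^ 2) * (2 * I0) by ring,
            ENNReal.ofReal_mul (p := C * lam k ^ 2) (by positivity),
            ENNReal.ofReal_mul (p := 2) (by norm_num), ENNReal.ofReal_ofNat]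
          ring
  refine absorb (g2.eLpNorm_ne_top) step1 (step2.trans (mul_le_mul_left ?_ _))
  rw [← ENNReal.ofReal_pow (mul_nonneg (by positivity) (hlam k))]
  refine ENNReal.ofReal_le_ofReal ?_
  rw [mul_pow]
  refine mul_le_mul_of_nonneg_right ?_ (sq_nonneg _)
  nlinarith [Real.sq_sqrt (show 0 ≤ 2 * C * I0 by positivity), Real.sqrt_nonneg (2 * C * I0)]

end YOne

section YTwo
variable {n : ℕ} {κ : Type*}

theorem Kf_step {K : Set (En n)} (hK : IsCompact K) {φ : En n × En n → ℝ} (hφ : Sm φ)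
    {b b' : En n × En n → ℂ} (hb' : Sm b') (ab : Am K b) (ab' : Am K b')
    {h : En n × En n → ℝ} {D V : Fin n → En n × En n → ℝ} (hV : ∀ z, h z + ∑ j, V j z * D j z = 1)
    (hD : ∀ j y y' ξ, D j (y, ξ) - D j (y', ξ) =
      dLine (dY j) φ (y, ξ) - dLine (dY j) φ (y', ξ))
    {hb0 : En n × En n → ℂ} (e0 : ∀ z, hb0 z = (h z : ℂ) * b z) (a0 : Am K hb0)
    {Vb : Fin n → En n × En n → ℂ} (e1' : ∀ j z, Vb j z = (V j z : ℂ) * b z) (sV : ∀ j, Sm (Vb j))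
    (aV : ∀ j, Am K (Vb j)) {Db : Fin n → En n × En n → ℂ} (e2 : ∀ j z, Db j z = (D j z : ℂ) * b' z)
    (aD : ∀ j, Am K (Db j))
    {dV : Fin n → En n × En n → ℂ} (e3 : ∀ j z, dV j z = Complex.I * dLine (dY j) (Vb j) z)
    (adV : ∀ j, Am K (dV j))
    {db : Fin n → En n × En n → ℂ} (e4 : ∀ j z, db j z = (-Complex.I) * dLine (dY j) b' z)
    (adb : ∀ j, Am K (db j)) (q : En n × En n) :
    Kf φ b b' q = Kf φ hb0 b' q +
      ∑ j, (Kf φ (Vb j) (Db j) q + (Kf φ (dV j) b' q + Kf φ (Vb j) (db j) q)) := by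
  have cφ := hφ.cont
  have sconj : Sm (fun ξ => (starRingEnd ℂ) (b' (q.2, ξ))) :=
    Sm.clm (Complex.conjCLE : ℂ →L[ℝ] ℂ) (hb'.right q.2)
  have dconj : ∀ j, dLine (e1 j) (fun ξ => (starRingEnd ℂ) (b' (q.2, ξ))) =
      fun ξ => (starRingEnd ℂ) (dLine (dY j) b' (q.2, ξ)) := fun j => by
    have := dLine_clm (Complex.conjCLE : ℂ →L[ℝ] ℂ) (hb'.right q.2) (e1 j)
    rw [dLine_right hb'] at this
    exact this
  let Ψ : En n → ℝ := fun ξ => φ (q.1, ξ) - φ (q.2, ξ)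
  have sΨ : Sm Ψ := (hφ.right _).sub (hφ.right _)
  have dΨ : ∀ j, dLine (e1 j) Ψ = fun ξ => dLine (dY j) φ (q.1, ξ) - dLine (dY j) φ (q.2, ξ) := by
    intro j
    rw [dLine_sub (hφ.right _) (hφ.right _), dLine_right hφ, dLine_right hφ]
  let F : Fin n → En n → ℂ := fun j ξ => Vb j (q.1, ξ) * (starRingEnd ℂ) (b' (q.2, ξ))
  have sF : ∀ j, Sm (F j) := fun j => ((sV j).right _).mul sconj
  have dF : ∀ j, dLine (e1 j) (F j) = fun ξ =>
      dLine (dY j) (Vb j) (q.1, ξ) * (starRingEnd ℂ) (b' (q.2, ξ)) +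
      Vb j (q.1, ξ) * (starRingEnd ℂ) (dLine (dY j) b' (q.2, ξ)) := by
    intro j
    have := dLine_mul ((sV j).right q.1) sconj (e1 j)
    rw [dLine_right (sV j), dconj j] at this
    rw [show F j = fun ξ => Vb j (q.1, ξ) * (starRingEnd ℂ) (b' (q.2, ξ)) from rfl, this]
    try (funext ξ; ring)
  have F0 : ∀ j ξ, ξ ∉ K → F j ξ = 0 := fun j ξ hξ => by simp [F, (aV j).vn _ ξ hξ]
  have dF0 : ∀ j ξ, ξ ∉ K → dLine (e1 j) (F j) ξ = 0 := fun j ξ hξ => by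
    rw [dF]
    have := Vn.dLine hK (aV j).vn j q.1 ξ hξ
    simp [this, (aV j).vn _ ξ hξ]
  have ibpj : ∀ j, ∫ ξ, ex (Ψ ξ) * (((dLine (e1 j) Ψ ξ : ℝ) : ℂ) * F j ξ) =
      ∫ ξ, ex (Ψ ξ) * (Complex.I * dLine (e1 j) (F j) ξ) := fun j => by
    refine ibp sΨ (sF j) (e1 j) ?_ ?_ ?_
    · exact (sF j).cont.integrable_of_hasCompactSupport (HasCompactSupport.intro hK (F0 j))
    · exact ((sF j).dLine _).cont.integrable_of_hasCompactSupport
        (HasCompactSupport.intro hK (dF0 j))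
    · exact ((Sm_ofReal (sΨ.dLine (e1 j))).mul (sF j)).cont.integrable_of_hasCompactSupport
        (HasCompactSupport.intro hK fun ξ hξ => by simp [F0 j ξ hξ])
  have iDΨ : ∀ j, Integrable (fun ξ => ex (Ψ ξ) * (((dLine (e1 j) Ψ ξ : ℝ) : ℂ) * F j ξ)) :=
    fun j => ((Sm_ex sΨ).mul ((Sm_ofReal (sΨ.dLine (e1 j))).mul
      (sF j))).cont.integrable_of_hasCompactSupport
        (HasCompactSupport.intro hK fun ξ hξ => by simp [F0 j ξ hξ])
  have i0 := Kf_int hK cφ a0 ab' q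
  have i1 := fun j => Kf_int hK cφ (aV j) (aD j) q
  have i2 := fun j => Kf_int hK cφ (adV j) ab' q
  have i3 := fun j => Kf_int hK cφ (aV j) (adb j) q
  have t1 : ∀ j, ∫ ξ, ex (Ψ ξ) * (((dLine (e1 j) Ψ ξ : ℝ) : ℂ) * F j ξ) =
      Kf φ (dV j) b' q + Kf φ (Vb j) (db j) q := fun j => by
    rw [ibpj]
    unfold Kf
    rw [← integral_add (i2 j) (i3 j)]
    refine integral_congr_ae (Filter.Eventually.of_forall fun ξ => ?_)
    simp only [dF, e3, e4, map_mul, map_neg, Complex.conj_I, Ψ]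
    ring
  simp_rw [← t1]
  unfold Kf
  simp_rw [← integral_add (i1 _) (iDΨ _)]
  have i4 : ∀ j, Integrable (fun ξ => ex (φ (q.1, ξ) - φ (q.2, ξ)) *
      (Vb j (q.1, ξ) * (starRingEnd ℂ) (Db j (q.2, ξ))) +
      ex (Ψ ξ) * (((dLine (e1 j) Ψ ξ : ℝ) : ℂ) * F j ξ)) := fun j => (i1 j).add (iDΨ j)
  rw [← integral_finsetSum _ (fun j _ => i4 j),
    ← integral_add i0 (integrable_finsetSum _ (fun j _ => i4 j))]
  refine integral_congr_ae (Filter.Eventually.of_forall fun ξ => ?_)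
  simp only [dΨ, F, e0, e1', e2, Ψ, map_mul, Complex.conj_ofReal]
  have hs : ∀ j, ex (φ (q.1, ξ) - φ (q.2, ξ)) * (((V j (q.1, ξ) : ℝ) : ℂ) * b (q.1, ξ) *
      (((D j (q.2, ξ) : ℝ) : ℂ) * (starRingEnd ℂ) (b' (q.2, ξ)))) +
      ex (φ (q.1, ξ) - φ (q.2, ξ)) * (((dLine (dY j) φ (q.1, ξ) - dLine (dY j) φ (q.2, ξ) : ℝ) : ℂ)
        * (((V j (q.1, ξ) : ℝ) : ℂ) * b (q.1, ξ) * (starRingEnd ℂ) (b' (q.2, ξ)))) =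
      ex (φ (q.1, ξ) - φ (q.2, ξ)) * (b (q.1, ξ) * (starRingEnd ℂ) (b' (q.2, ξ))) *
        ((V j (q.1, ξ) * D j (q.1, ξ) : ℝ) : ℂ) := fun j => by
    rw [← hD]; push_cast; ring
  rw [Finset.sum_congr rfl fun j _ => hs j, ← Finset.mul_sum, ← Complex.ofReal_sum]
  have hh : ((∑ j, V j (q.1, ξ) * D j (q.1, ξ) : ℝ) : ℂ) = 1 - ((h (q.1, ξ) : ℝ) : ℂ) := by
    have hc := congrArg (fun t : ℝ => (t : ℂ)) (hV (q.1, ξ))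
    push_cast at hc ⊢
    linear_combination hc
  rw [hh]; ring

theorem Am_of {K : κ → Set (En n)} {N : ℕ} {lam : κ → ℝ} {p : κ → En n} {r : ℝ} (hr : 0 ≤ r)
    (hlam : ∀ k, 0 ≤ lam k) {b : κ → En n × En n → ℂ} (sb : ∀ k, Sm (b k))
    (vb : ∀ k, Vn (K k) (b k)) (Fb : FB v2 g1 N (fun k z => lam k * wt r (p k) z.1) b) (k : κ) :
    Am (K k) (b k) := by
  obtain ⟨C1, hC1, hb1⟩ := Fb.bound (fun k z => mul_nonneg (hlam k) (wt_pos _ _ _).le)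
  exact ⟨(sb k).cont, ⟨C1 * (lam k * 1), fun z => (hb1 k z).trans
    (mul_le_mul_of_nonneg_left (mul_le_mul_of_nonneg_left (wt_le_one hr _ _) (hlam k)) hC1.le)⟩,
    vb k⟩

/-- real `L²` product -/
def n22 (u v : En n → ℂ) : ℝ := (eLpNorm u 2 volume * eLpNorm v 2 volume).toReal

theorem wt_succ (r : ℝ) (p y : En n) : wt (r + 1) p y = wt r p y * (jap (y - p))⁻¹ := by
  rw [wt_add]; congr 1; unfold wt; rw [Real.rpow_neg_one]

set_option maxHeartbeats 1000000 in
theorem Y2 {N P : ℕ} (hN : n + 1 ≤ N) {φ : κ → En n × En n → ℝ} (hφ : Ph (P + 1) φ)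
    {K : κ → Set (En n)} (hK : ∀ k, IsCompact (K k)) {p p' : κ → En n} (M : ℕ) (hP : N + M ≤ P)
    (b b' : κ → En n × En n → ℂ) (sb : ∀ k, Sm (b k)) (sb' : ∀ k, Sm (b' k))
    (vb : ∀ k, Vn (K k) (b k)) (vb' : ∀ k, Vn (K k) (b' k)) (lam lam' : κ → ℝ)
    (hlam : ∀ k, 0 ≤ lam k) (hlam' : ∀ k, 0 ≤ lam' k)
    (Fb : FB v2 g1 (N + M) (fun k z => lam k * wt ((n : ℝ) + 1 + M) (p k) z.1) b)
    (Fb' : FB v2 g1 (N + M) (fun k z => lam' k * wt ((n : ℝ) + 1 + M) (p' k) z.1) b') :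
    ∃ C : ℝ, 0 < C ∧ ∀ k u v, Integrable u → MemLp u 2 → Integrable v → MemLp v 2 →
      ‖Bf (φ k) (b k) (b' k) u v‖ ≤
        C * (lam k * lam' k * (jap (p k - p' k))⁻¹ ^ M) * n22 u v := by
  induction M generalizing b b' lam lam' with
  | zero =>
    have hφ' : Ph (N + 1) φ := hφ.le (by omega)
    have hr : (n : ℝ) < (n : ℝ) + 1 + (0 : ℕ) := by push_cast; linarith
    have hr0 : (0 : ℝ) ≤ (n : ℝ) + 1 + (0 : ℕ) := by positivity
    obtain ⟨C, hC, H⟩ := Y1 hN hφ' sb hK vb hlam hr Fb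
    obtain ⟨C', hC', H'⟩ := Y1 hN hφ' sb' hK vb' hlam' hr Fb'
    refine ⟨C * C', by positivity, fun k u v hu hu2 hv hv2 => ?_⟩
    have am := Am_of hr0 hlam sb vb Fb k
    have am' := Am_of hr0 hlam' sb' vb' Fb' k
    have cφ : Continuous (φ k) := (hφ.sm k).cont
    rw [← Bf_eq (hK k) cφ am am' hu hv]
    have h1 := cs_int (μ := volume) (So_cont cφ am hu).aestronglyMeasurable
      (Complex.continuous_conj.comp (So_cont cφ am' hv)).aestronglyMeasurable
    have h2 := h1.trans (mul_le_mul' (H k u hu hu2)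
      ((le_of_eq (eL_conj _)).trans (H' k v hv hv2)))
    have h3 := ENNReal.toReal_mono (ENNReal.mul_ne_top
      (ENNReal.mul_ne_top ENNReal.ofReal_ne_top hu2.eLpNorm_ne_top)
      (ENNReal.mul_ne_top ENNReal.ofReal_ne_top hv2.eLpNorm_ne_top)) h2
    rw [toReal_enorm] at h3
    refine h3.trans (le_of_eq ?_)
    have l1 := hlam k
    have l2 := hlam' k
    rw [ENNReal.toReal_mul, ENNReal.toReal_mul, ENNReal.toReal_mul,
      ENNReal.toReal_ofReal (by positivity), ENNReal.toReal_ofReal (by positivity)]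
    unfold n22
    rw [ENNReal.toReal_mul, pow_zero]; ring
  | succ M ih =>
    obtain ⟨c, hc, hl⟩ := hφ.lowY
    let D : Fin n → κ → En n × En n → ℝ := fun j k z =>
      dLine (dY j) (φ k) z - dLine (dY j) (φ k) (p' k, z.2)
    have sD : ∀ j k, Sm (D j k) := fun j k => by
      have s1 : Sm (dLine (dY j) (φ k)) := (hφ.sm k).dLine _
      refine s1.sub ?_
      exact ContDiff.comp (g := dLine (dY j) (φ k)) (f := fun z : En n × En n => (p' k, z.2))
        s1.cd (by fun_prop)
    have FD : ∀ j, FB v2 g1 (N + M + 1) (fun k z => jap (z.1 - p' k)) (D j) := fun j =>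
      (((diffY (f := fun k => dLine (dY j) (φ k)) (fun k => (hφ.sm k).dLine _)
        (fun l => hφ.d2 l j)).le (by omega)).reindex (fun k => (k, p' k)))
    have wpos : ∀ (k : κ) (z : En n × En n), 1 ≤ jap (z.1 - p' k) := fun k z => jap_one_le _
    have hl' : ∀ k z, c * jap (z.1 - p' k) ^ 2 ≤ 1 + ∑ j, D j k z ^ 2 := fun k z =>
      hl k z.1 (p' k) z.2
    have Fh := FB_hQ sD FD wpos g1_nonneg hc hl'
    have FV := FB_V sD FD wpos g1_nonneg hc hl'
    have sh := Sm_hQ sD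
    have sV : ∀ j k, Sm (fun z => hQ D k z * D j k z) := fun j k => (sh k).mul (sD j k)
    let J : κ → ℝ := fun k => (jap (p k - p' k))⁻¹
    have hJ : ∀ k, 0 ≤ J k := fun k => inv_nonneg.2 (jap_pos _).le
    let L : ℝ := (n : ℝ) + 1 + M
    have hL : (0 : ℝ) ≤ L := by positivity
    have eL : (n : ℝ) + 1 + ((M + 1 : ℕ) : ℝ) = L + 1 := by simp only [L]; push_cast; ring
    rw [eL] at Fb Fb'
    have Fb := Fb.le (show N + M + 1 ≤ N + (M + 1) by omega)
    have Fb' := Fb'.le (show N + M + 1 ≤ N + (M + 1) by omega)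
    let lamJ : κ → ℝ := fun k => lam k * J k
    have hlamJ : ∀ k, 0 ≤ lamJ k := fun k => mul_nonneg (hlam k) (hJ k)
    have peet : ∀ k (y : En n), (jap (y - p' k))⁻¹ * (lam k * wt (L + 1) (p k) y) ≤
        2 * (lamJ k * wt L (p k) y) := fun k y => by
      rw [wt_succ]
      have h1 := jap_peetre y (p k) (p' k)
      have h2 := wt_pos L (p k) y
      have h3 := jap_pos (y - p k)
      have h4 := hlam k
      calc (jap (y - p' k))⁻¹ * (lam k * (wt L (p k) y * (jap (y - p k))⁻¹))
          ≤ (2 * (jap (p k - p' k))⁻¹ * jap (y - p k)) *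
            (lam k * (wt L (p k) y * (jap (y - p k))⁻¹)) :=
            mul_le_mul_of_nonneg_right h1 (by positivity)
        _ = _ := by simp only [lamJ, J]; field_simp
    let hb0 : κ → En n × En n → ℂ := fun k z => ((hQ D k z : ℝ) : ℂ) * b k z
    let Vb : Fin n → κ → En n × En n → ℂ := fun j k z =>
      ((hQ D k z * D j k z : ℝ) : ℂ) * b k z
    let Db : Fin n → κ → En n × En n → ℂ := fun j k z => ((D j k z : ℝ) : ℂ) * b' k z
    let dV : Fin n → κ → En n × En n → ℂ := fun j k z => Complex.I * dLine (dY j) (Vb j k) z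
    let db : Fin n → κ → En n × En n → ℂ := fun j k z => (-Complex.I) * dLine (dY j) (b' k) z
    have shb : ∀ k, Sm (hb0 k) := fun k => (Sm_ofReal (sh k)).mul (sb k)
    have sVb : ∀ j k, Sm (Vb j k) := fun j k => (Sm_ofReal (sV j k)).mul (sb k)
    have sDb : ∀ j k, Sm (Db j k) := fun j k => (Sm_ofReal (sD j k)).mul (sb' k)
    have sdV : ∀ j k, Sm (dV j k) := fun j k => (Sm.const _).mul ((sVb j k).dLine _)
    have sdb : ∀ j k, Sm (db j k) := fun j k => (Sm.const _).mul ((sb' k).dLine _)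
    have vhb : ∀ k, Vn (K k) (hb0 k) := fun k => (vb k).mul _
    have vVb : ∀ j k, Vn (K k) (Vb j k) := fun j k => (vb k).mul _
    have vDb : ∀ j k, Vn (K k) (Db j k) := fun j k => (vb' k).mul _
    have vdV : ∀ j k, Vn (K k) (dV j k) := fun j k => ((vVb j k).dLine (hK k) j).mul _
    have vdb : ∀ j k, Vn (K k) (db j k) := fun j k => ((vb' k).dLine (hK k) j).mul _
    have wn : ∀ k (y : En n), 0 ≤ (jap (y - p' k))⁻¹ * (lam k * wt (L + 1) (p k) y) := fun k y =>
      mul_nonneg (inv_nonneg.2 (jap_pos _).le) (mul_nonneg (hlam k) (wt_pos _ _ _).le)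
    have Fhb : FB v2 g1 (N + M + 1) (fun k z => lamJ k * wt L (p k) z.1) hb0 := by
      refine (FB.mul (fun k => Sm_ofReal (sh k)) sb (FB_ofReal sh Fh) Fb).mono g1_nonneg ?_ 2 ?_
      · intro k z
        have := wt_pos (L + 1) (p k) z.1
        have := hlam k
        have := jap_pos (z.1 - p' k)
        positivity
      · intro k z
        refine le_trans ?_ (peet k z.1)
        have h1 : (jap (z.1 - p' k))⁻¹ ≤ 1 := inv_le_one_of_one_le₀ (jap_one_le _)
        rw [mul_inv, mul_assoc]
        exact mul_le_of_le_one_left (wn k z.1) h1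
    have FVb : ∀ j, FB v2 g1 (N + M + 1) (fun k z => lamJ k * wt L (p k) z.1) (Vb j) := fun j =>
      (FB.mul (fun k => Sm_ofReal (sV j k)) sb (FB_ofReal (sV j) (FV j)) Fb).mono g1_nonneg
        (fun k z => wn k z.1) 2 (fun k z => peet k z.1)
    have FDb : ∀ j, FB v2 g1 (N + M + 1) (fun k z => lam' k * wt L (p' k) z.1) (Db j) := fun j => by
      refine (FB.mul (fun k => Sm_ofReal (sD j k)) sb' (FB_ofReal (sD j) (FD j)) Fb').congrw ?_
      intro k z
      rw [wt_succ]
      have := jap_pos (z.1 - p' k)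
      field_simp
    have FdV : ∀ j, FB v2 g1 (N + M) (fun k z => lamJ k * wt L (p k) z.1) (dV j) := fun j =>
      (((FVb j).dLine (Sum.inr j)).const_mul (fun k => (sVb j k).dLine _) Complex.I).congrw
        (fun k z => by simp [g1])
    have Fb0 : FB v2 g1 (N + M + 1) (fun k z => lam' k * wt L (p' k) z.1) b' := by
      refine Fb'.mono g1_nonneg (fun k z => mul_nonneg (hlam' k) (wt_pos _ _ _).le) 1 ?_
      intro k z
      rw [wt_succ, one_mul]
      refine mul_le_mul_of_nonneg_left ?_ (hlam' k)
      exact mul_le_of_le_one_right (wt_pos _ _ _).le (inv_le_one_of_one_le₀ (jap_one_le _))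
    have Fdb : ∀ j, FB v2 g1 (N + M) (fun k z => lam' k * wt L (p' k) z.1) (db j) := fun j =>
      ((Fb0.dLine (Sum.inr j)).const_mul (fun k => (sb' k).dLine _) (-Complex.I)).congrw
        (fun k z => by simp [g1])
    have le1 : N + M ≤ N + M + 1 := by omega
    obtain ⟨C0, hC0, H0⟩ := ih (by omega) hb0 b' shb sb' vhb vb' lamJ lam' hlamJ hlam'
      (Fhb.le le1) (Fb0.le le1)
    have X1 := fun j => ih (by omega) (Vb j) (Db j) (sVb j) (sDb j) (vVb j) (vDb j) lamJ lam'
      hlamJ hlam' ((FVb j).le le1) ((FDb j).le le1)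
    have X2 := fun j => ih (by omega) (dV j) b' (sdV j) sb' (vdV j) vb' lamJ lam'
      hlamJ hlam' (FdV j) (Fb0.le le1)
    have X3 := fun j => ih (by omega) (Vb j) (db j) (sVb j) (sdb j) (vVb j) (vdb j) lamJ lam'
      hlamJ hlam' ((FVb j).le le1) (Fdb j)
    choose C1 hC1 H1 using X1
    choose C2 hC2 H2 using X2
    choose C3 hC3 H3 using X3
    have hS : 0 ≤ ∑ j, (C1 j + (C2 j + C3 j)) := Finset.sum_nonneg fun j _ => by
      have := hC1 j; have := hC2 j; have := hC3 j; positivity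
    refine ⟨C0 + ∑ j, (C1 j + (C2 j + C3 j)), by positivity, fun k u v hu hu2 hv hv2 => ?_⟩
    have cφ : Continuous (φ k) := (hφ.sm k).cont
    have a0 := Am_of hL hlamJ shb vhb Fhb k
    have ab' := Am_of hL hlam' sb' vb' Fb0 k
    have ab := Am_of (by positivity) hlam sb vb Fb k
    have aV := fun j => Am_of hL hlamJ (sVb j) (vVb j) (FVb j) k
    have aD := fun j => Am_of hL hlam' (sDb j) (vDb j) (FDb j) k
    have adV := fun j => Am_of hL hlamJ (sdV j) (vdV j) (FdV j) k
    have adb := fun j => Am_of hL hlam' (sdb j) (vdb j) (Fdb j) k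
    have ks := Kf_step (hK k) (hφ.sm k) (sb' k) ab ab' (h := hQ D k) (D := fun j => D j k)
      (V := fun j z => hQ D k z * D j k z) (hQ_id D k)
      (fun j y y' ξ => by simp only [D]; ring) (fun z => rfl) a0 (fun j z => rfl)
      (fun j => sVb j k) aV (fun j z => rfl) aD (fun j z => rfl) adV (fun j z => rfl) adb
    have i0 := Bf_int (hK k) cφ a0 ab' hu hv
    have i1 := fun j => Bf_int (hK k) cφ (aV j) (aD j) hu hv
    have i2 := fun j => Bf_int (hK k) cφ (adV j) ab' hu hv
    have i3 := fun j => Bf_int (hK k) cφ (aV j) (adb j) hu hv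
    have i4 : ∀ j, Integrable (fun q : En n × En n => u q.1 * (starRingEnd ℂ) (v q.2) *
        Kf (φ k) (Vb j k) (Db j k) q + (u q.1 * (starRingEnd ℂ) (v q.2) *
        Kf (φ k) (dV j k) (b' k) q + u q.1 * (starRingEnd ℂ) (v q.2) *
        Kf (φ k) (Vb j k) (db j k) q)) := fun j => (i1 j).add ((i2 j).add (i3 j))
    have bs : Bf (φ k) (b k) (b' k) u v = Bf (φ k) (hb0 k) (b' k) u v +
        ∑ j, (Bf (φ k) (Vb j k) (Db j k) u v + (Bf (φ k) (dV j k) (b' k) u v +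
          Bf (φ k) (Vb j k) (db j k) u v)) := by
      unfold Bf
      simp_rw [← integral_add (i2 _) (i3 _)]
      have i23 : ∀ j, Integrable (fun q : En n × En n => u q.1 * (starRingEnd ℂ) (v q.2) *
        Kf (φ k) (dV j k) (b' k) q + u q.1 * (starRingEnd ℂ) (v q.2) *
        Kf (φ k) (Vb j k) (db j k) q) := fun j => (i2 j).add (i3 j)
      simp_rw [← integral_add (i1 _) (i23 _)]
      rw [← integral_finsetSum _ (fun j _ => i4 j),
        ← integral_add i0 (integrable_finsetSum _ (fun j _ => i4 j))]
      refine integral_congr_ae (Filter.Eventually.of_forall fun q => ?_)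
      simp only
      rw [ks q, mul_add, Finset.mul_sum]
      simp only [mul_add]
      rfl
    rw [bs]
    have E : ∀ C, C * (lamJ k * lam' k * (jap (p k - p' k))⁻¹ ^ M) * n22 u v =
        C * (lam k * lam' k * (jap (p k - p' k))⁻¹ ^ (M + 1) * n22 u v) := fun C => by
      simp only [lamJ, J]; ring
    have G0 := H0 k u v hu hu2 hv hv2
    have G1 := fun j => H1 j k u v hu hu2 hv hv2
    have G2 := fun j => H2 j k u v hu hu2 hv hv2
    have G3 := fun j => H3 j k u v hu hu2 hv hv2
    rw [E] at G0
    simp_rw [E] at G1 G2 G3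
    rw [mul_assoc, add_mul, Finset.sum_mul]
    refine (norm_add_le _ _).trans (add_le_add G0 ((norm_sum_le _ _).trans
      (Finset.sum_le_sum fun j _ => ?_)))
    rw [add_mul, add_mul]
    exact (norm_add_le _ _).trans (add_le_add (G1 j) ((norm_add_le _ _).trans
      (add_le_add (G2 j) (G3 j))))

end YTwo

section YThree
variable {n : ℕ} {κ ι : Type*}

theorem FB.comp0 {W J F W' J' : Type*} [NormedAddCommGroup W] [NormedSpace ℝ W]
    [NormedAddCommGroup F] [NormedSpace ℝ F] [NormedAddCommGroup W'] [NormedSpace ℝ W']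
    {v : J → W} {g : J → W → ℝ} {N : ℕ} {w : ι → W → ℝ}
    {v' : J' → W'} {g' : J' → W' → ℝ} {f : ι → W → F} (hf : ∀ i, Sm (f i)) (h : FB v g N w f)
    (hw : ∀ i z, 0 ≤ w i z) (hg : ∀ j z, 0 ≤ g j z) (hg' : ∀ j z, 0 ≤ g' j z)
    (r : κ → ι) (A : κ → W' → W) (L : W' →L[ℝ] W) (hA : ∀ k z, HasFDerivAt (A k) L z)
    (hσ : ∀ j, L (v' j) = 0 ∨ ∃ j0, L (v' j) = v j0 ∧ ∀ k z, g j0 (A k z) ≤ g' j z) :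
    FB v' g' N (fun k z => w (r k) (A k z)) (fun k z => f (r k) (A k z)) := by
  induction N generalizing w f with
  | zero => obtain ⟨C, hC⟩ := h; exact ⟨C, fun k z => hC _ _⟩
  | succ N ih =>
    obtain ⟨C, hC⟩ := h.1
    refine ⟨⟨C, fun k z => hC _ _⟩, fun j => ?_⟩
    simp_rw [dLine_comp (hf _) (hA _)]
    rcases hσ j with h0 | ⟨j0, hj, hgg⟩
    · rw [h0]
      have e0 : ∀ k z, _root_.dLine (0 : W) (f (r k)) (A k z) = 0 := fun k z => by
        simp [_root_.dLine]
      simp_rw [e0]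
      exact FB.zero_fun (fun k z => mul_nonneg (hg' _ _) (hw _ _)) hg'
    · have := ih (fun i => (hf i).dLine (v j0)) (h.2 j0)
        (fun i z => mul_nonneg (hg _ z) (hw i z))
      rw [hj]
      refine this.mono hg' (fun k z => mul_nonneg (hg _ _) (hw _ _)) 1 (fun k z => ?_)
      rw [one_mul]
      exact mul_le_mul_of_nonneg_right (hgg k z) (hw _ _)

theorem gj_le_one (j : Fin n) (x : En n) : gj j x ≤ 1 := inv_le_one_of_one_le₀ (jap_one_le x)

theorem hasF_fst_sub (p : En n) (z : En n × En n) :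
    HasFDerivAt (fun z : En n × En n => z.1 - p) (ContinuousLinearMap.fst ℝ (En n) (En n)) z :=
  hasFDerivAt_fst.sub_const p

theorem fst_v2 (j : Fin n ⊕ Fin n) : (ContinuousLinearMap.fst ℝ (En n) (En n)) (v2 j) = 0 ∨
    ∃ j0, (ContinuousLinearMap.fst ℝ (En n) (En n)) (v2 j) = e1 j0 := by
  cases j with
  | inl j => exact Or.inr ⟨j, rfl⟩
  | inr j => exact Or.inl rfl

theorem FB_japY (N : ℕ) (q : ℝ) (p : κ → En n) :
    FB v2 g1 N (fun k z => jap (z.1 - p k) ^ q)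
      (fun k (z : En n × En n) => jap (z.1 - p k) ^ q) := by
  have hs : ∀ _ : Unit, Sm (fun x : En n => jap x ^ q) := fun _ => Sm_jap_rpow q
  have hσ : ∀ j : Fin n ⊕ Fin n, (ContinuousLinearMap.fst ℝ (En n) (En n)) (v2 j) = 0 ∨
      ∃ j0, (ContinuousLinearMap.fst ℝ (En n) (En n)) (v2 j) = e1 j0 ∧
        ∀ (k : κ) (z : En n × En n), gj j0 (z.1 - p k) ≤ g1 j z := fun j => by
    rcases fst_v2 j with h | ⟨j0, h⟩
    · exact Or.inl h
    · exact Or.inr ⟨j0, h, fun k z => gj_le_one _ _⟩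
  have hF : FB e1 gj N (fun (_ : Unit) (x : En n) => jap x ^ q) (fun (_ : Unit) x => jap x ^ q) :=
    FB_jap N q
  have hw : ∀ (_ : Unit) (x : En n), 0 ≤ jap x ^ q :=
    fun _ x => Real.rpow_nonneg (jap_pos x).le _
  have hA : ∀ (k : κ) (z : En n × En n), HasFDerivAt (fun z : En n × En n => z.1 - p k)
    (ContinuousLinearMap.fst ℝ (En n) (En n)) z := fun k z => hasF_fst_sub (p k) z
  have hg' : ∀ (j : Fin n ⊕ Fin n) (z : En n × En n), 0 ≤ g1 j z := g1_nonneg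
  exact FB.comp0 (κ := κ) hs hF hw gj_nonneg hg' (fun _ : κ => ())
    (fun k z => z.1 - p k) (ContinuousLinearMap.fst ℝ (En n) (En n)) hA hσ

theorem wt_cont_left (r : ℝ) (y : En n) : Continuous (fun p : En n => wt r p y) := by
  unfold wt
  exact (jap_cont.comp (by fun_prop)).rpow_const fun q => Or.inl (jap_pos _).ne'

theorem Sm_japY (q : ℝ) (p : En n) : Sm (fun z : En n × En n => jap (z.1 - p) ^ q) :=
  (Sm_jap_rpow q).compA (hasF_fst_sub p)

theorem wt_sq_int (r : ℝ) (y : En n) :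
    ∫ p, wt r p y * wt r p y = ∫ y : En n, jap y ^ (-(r + r)) := by
  rw [← integral_jap_eq (r + r) y]
  refine integral_congr_ae (Filter.Eventually.of_forall fun p => ?_)
  simp only
  rw [← wt_add, wt, jap_sub_comm]

theorem wt_sq_integrable {r : ℝ} (hr : (n : ℝ) < r + r) (y : En n) :
    Integrable (fun p => wt r p y * wt r p y) := by
  refine (integrable_jap hr y).congr (Filter.Eventually.of_forall fun p => ?_)
  simp only
  rw [← wt_add, wt, jap_sub_comm]

theorem jap_int_pos {r : ℝ} (hr : (n : ℝ) < r) : 0 < ∫ y : En n, jap y ^ (-r) := by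
  have hp : ∀ y : En n, 0 < jap y ^ (-r) := fun y => Real.rpow_pos_of_pos (jap_pos y) _
  rw [integral_pos_iff_support_of_nonneg (fun y => (hp y).le)
    (by simpa using integrable_jap (n := n) hr 0)]
  rw [show Function.support (fun y : En n => jap y ^ (-r)) = Set.univ from
    Set.eq_univ_of_forall fun y => (hp y).ne']
  exact NeZero.pos _

/-- cut by a weight -/
def cw (r : ℝ) (p : En n) (u : En n → ℂ) : En n → ℂ := fun y => (wt r p y : ℂ) * u y

theorem cw_norm_le {r : ℝ} (hr : 0 ≤ r) (p : En n) (u : En n → ℂ) (y : En n) :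
    ‖cw r p u y‖ ≤ ‖u y‖ := by
  unfold cw
  rw [norm_mul, Complex.norm_real, Real.norm_of_nonneg (wt_pos _ _ _).le]
  exact mul_le_of_le_one_left (norm_nonneg _) (wt_le_one hr p y)

theorem cw_asm {r : ℝ} (p : En n) {u : En n → ℂ} (hu : AEStronglyMeasurable u volume) :
    AEStronglyMeasurable (cw r p u) volume :=
  ((Complex.continuous_ofReal.comp (wt_cont_right r p)).aestronglyMeasurable).mul hu

theorem Kf_cut (φ : En n × En n → ℝ) (b b' : En n × En n → ℂ) (r : ℝ) (p p' : En n)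
    (q : En n × En n) :
    Kf φ (fun z => (wt r p z.1 : ℂ) * b z) (fun z => (wt r p' z.1 : ℂ) * b' z) q =
      (wt r p q.1 : ℂ) * (wt r p' q.2 : ℂ) * Kf φ b b' q := by
  unfold Kf
  rw [← integral_const_mul]
  refine integral_congr_ae (Filter.Eventually.of_forall fun ξ => ?_)
  simp only [map_mul, Complex.conj_ofReal]
  ring

theorem cut_formula {K : Set (En n)} {φ : En n × En n → ℝ} {b : En n × En n → ℂ} {u : En n → ℂ}
    (hK : IsCompact K) (hφ : Continuous φ) (hb : Am K b) (hu : Integrable u) {r : ℝ}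
    (hr : (n : ℝ) < r + r) :
    (((∫ y : En n, jap y ^ (-(r + r))) ^ 2 : ℝ) : ℂ) * Bf φ b b u u =
      ∫ P : En n × En n, Bf φ (fun z => (wt r P.1 z.1 : ℂ) * b z)
        (fun z => (wt r P.2 z.1 : ℂ) * b z) (cw r P.1 u) (cw r P.2 u) := by
  set c := ∫ y : En n, jap y ^ (-(r + r)) with hc
  have iB := Bf_int hK hφ hb hb hu hu
  set T : En n × En n → ℂ := fun q => u q.1 * (starRingEnd ℂ) (u q.2) * Kf φ b b q with hT
  let w2 : En n × En n → En n × En n → ℝ := fun q P =>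
    (wt r P.1 q.1 * wt r P.1 q.1) * (wt r P.2 q.2 * wt r P.2 q.2)
  have w2n : ∀ q P, 0 ≤ w2 q P := fun q P => mul_nonneg (mul_self_nonneg _) (mul_self_nonneg _)
  have w2i : ∀ q, Integrable (w2 q) := fun q =>
    (wt_sq_integrable hr q.1).mul_prod (wt_sq_integrable hr q.2)
  have w2c : ∀ q, ∫ P, w2 q P = c ^ 2 := fun q => by
    have := integral_prod_mul (μ := (volume : Measure (En n))) (ν := (volume : Measure (En n)))
      (fun p => wt r p q.1 * wt r p q.1) (fun p => wt r p q.2 * wt r p q.2)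
    rw [wt_sq_int, wt_sq_int] at this
    rw [pow_two]; exact this
  have w2m : Continuous (fun Z : (En n × En n) × (En n × En n) => w2 Z.1 Z.2) := by
    have h1 := (wt_cont (n := n) r).comp (show Continuous
      (fun Z : (En n × En n) × (En n × En n) => (Z.2.1, Z.1.1)) by fun_prop)
    have h2 := (wt_cont (n := n) r).comp (show Continuous
      (fun Z : (En n × En n) × (En n × En n) => (Z.2.2, Z.1.2)) by fun_prop)
    exact (h1.mul h1).mul (h2.mul h2)
  have iG : Integrable (fun Z : (En n × En n) × (En n × En n) => (w2 Z.1 Z.2 : ℂ) * T Z.1)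
      ((volume : Measure (En n × En n)).prod volume) := by
    refine (integrable_prod_iff ?_).2 ⟨?_, ?_⟩
    · exact (Complex.continuous_ofReal.comp w2m).aestronglyMeasurable.mul iB.1.comp_fst
    · exact Filter.Eventually.of_forall fun q =>
        show Integrable (fun P => (w2 q P : ℂ) * T q) from ((w2i q).ofReal).mul_const _
    · have : (fun q => ∫ P, ‖(w2 q P : ℂ) * T q‖) = fun q => c ^ 2 * ‖T q‖ := by
        funext q
        rw [← w2c q, ← integral_mul_const]
        refine integral_congr_ae (Filter.Eventually.of_forall fun P => ?_)
        simp only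
        rw [norm_mul, Complex.norm_real, Real.norm_of_nonneg (w2n q P)]
      simp only
      rw [this]
      exact iB.norm.const_mul _
  have e1 : ((c ^ 2 : ℝ) : ℂ) * Bf φ b b u u = ∫ q, ∫ P, (w2 q P : ℂ) * T q := by
    unfold Bf
    rw [← integral_const_mul]
    refine integral_congr_ae (Filter.Eventually.of_forall fun q => ?_)
    simp only
    rw [integral_mul_const, integral_complex_ofReal, w2c]
  rw [e1, integral_integral_swap iG]
  refine integral_congr_ae (Filter.Eventually.of_forall fun P => ?_)
  simp only [Bf]
  refine integral_congr_ae (Filter.Eventually.of_forall fun q => ?_)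
  simp only [Kf_cut, cw, w2, T, map_mul, Complex.conj_ofReal]
  push_cast
  ring

set_option maxHeartbeats 1000000 in
theorem Y3 {N : ℕ} (hN : 2 * n + 2 ≤ N) {φ : κ → En n × En n → ℝ} (hφ : Ph (N + 1) φ)
    {b : κ → En n × En n → ℂ} (sb : ∀ k, Sm (b k)) {K : κ → Set (En n)}
    (hK : ∀ k, IsCompact (K k)) (vb : ∀ k, Vn (K k) (b k)) {lam : κ → ℝ} (hlam : ∀ k, 0 ≤ lam k)
    (Fb : FB v2 g1 N (fun k _ => lam k) b) :
    ∃ C : ℝ, 0 < C ∧ ∀ k u, Measurable u → Integrable u → MemLp u 2 →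
      eLpNorm (So (φ k) (b k) u) 2 volume ≤ ENNReal.ofReal (C * lam k) * eLpNorm u 2 volume := by
  set r : ℝ := (n : ℝ) + 1 + ((n + 1 : ℕ) : ℝ) with hr
  have hr0 : 0 ≤ r := by positivity
  have hrr : (n : ℝ) < r + r := by rw [hr]; push_cast; linarith [(Nat.cast_nonneg n : (0 : ℝ) ≤ n)]
  have X : ∀ p : (κ × En n × En n) → En n,
      (∀ s : κ × En n × En n, Sm (fun z => (wt r (p s) z.1 : ℂ) * b s.1 z)) ∧
      (∀ s : κ × En n × En n, Vn (K s.1) (fun z => (wt r (p s) z.1 : ℂ) * b s.1 z)) ∧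
      FB v2 g1 ((n + 1) + (n + 1)) (fun s z => lam s.1 * wt r (p s) z.1)
        (fun (s : κ × En n × En n) z => (wt r (p s) z.1 : ℂ) * b s.1 z) := by
    intro p
    have s1 : ∀ s, Sm (fun z : En n × En n => (wt r (p s) z.1 : ℂ)) := fun s =>
      Sm_ofReal (Sm_japY (-r) (p s))
    refine ⟨fun s => (s1 s).mul (sb s.1), fun s => (vb s.1).mul _, ?_⟩
    have h1 := FB_ofReal (fun s => Sm_japY (-r) (p s)) (FB_japY ((n + 1) + (n + 1)) (-r) p)
    have h2 := (Fb.le (show (n + 1) + (n + 1) ≤ N by omega)).reindex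
      (fun s : κ × En n × En n => s.1)
    exact (FB.mul s1 (fun s => sb s.1) h1 h2).congrw fun s z => mul_comm _ _
  obtain ⟨sm1, vn1, fb1⟩ := X (fun s => s.2.1)
  obtain ⟨sm2, vn2, fb2⟩ := X (fun s => s.2.2)
  have hφ' : Ph ((2 * n + 2) + 1) (fun s : κ × En n × En n => φ s.1) :=
    (hφ.le (by omega)).reindex _
  obtain ⟨C, hC, H⟩ := Y2 (N := n + 1) (P := 2 * n + 2) le_rfl hφ' (fun s => hK s.1)
    (p := fun s => s.2.1) (p' := fun s => s.2.2) (n + 1) (by omega) _ _ sm1 sm2 vn1 vn2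
    (fun s => lam s.1) (fun s => lam s.1) (fun s => hlam s.1) (fun s => hlam s.1) fb1 fb2
  set c := ∫ y : En n, jap y ^ (-(r + r)) with hcdef
  have hc : 0 < c := jap_int_pos hrr
  let kk : En n → ℝ := fun x => (jap x)⁻¹ ^ (n + 1)
  have kk_eq : kk = fun x => jap x ^ (-((n : ℝ) + 1)) := by
    funext x
    simp only [kk]
    rw [Real.rpow_neg (jap_pos x).le, inv_pow, ← Real.rpow_natCast]
    push_cast; rfl
  have kk0 : ∀ x, 0 ≤ kk x := fun x => pow_nonneg (inv_nonneg.2 (jap_pos x).le) _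
  have kki : Integrable kk := by
    rw [kk_eq]; simpa using integrable_jap (n := n) (r := (n : ℝ) + 1) (by linarith) 0
  have kkc : Continuous kk := by
    rw [kk_eq]; exact jap_cont.rpow_const fun q => Or.inl (jap_pos _).ne'
  set I0 : ℝ := ∫ x, kk x with hI0
  have I00 : 0 ≤ I0 := integral_nonneg kk0
  have kkl : ∫⁻ x, ENNReal.ofReal (kk x) = ENNReal.ofReal I0 :=
    (ofReal_integral_eq_lintegral_ofReal kki (Filter.Eventually.of_forall kk0)).symm
  refine ⟨Real.sqrt (2 * C * I0 / c) + 1, by positivity, fun k u mu hu hu2 => ?_⟩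
  obtain ⟨C1, hC1, hb1⟩ := Fb.bound (fun k _ => hlam k)
  have am : Am (K k) (b k) := ⟨(sb k).cont, ⟨_, fun z => hb1 k z⟩, vb k⟩
  have cφ : Continuous (φ k) := (hφ.sm k).cont
  let g : En n → ℝ≥0∞ := fun p => eLpNorm (cw r p u) 2 volume
  have g2 : ∀ p, g p ^ 2 = ∫⁻ y, ENNReal.ofReal (wt r p y * wt r p y) * ‖u y‖ₑ ^ 2 := fun p => by
    simp only [g, eL_sq]
    refine lintegral_congr fun y => ?_
    rw [cw, enorm_mul, mul_pow]
    congr 1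
    rw [← ofReal_norm_eq_enorm, Complex.norm_real, Real.norm_of_nonneg (wt_pos _ _ _).le,
      pow_two, ENNReal.ofReal_mul (wt_pos _ _ _).le]
  have mj : Measurable (fun Z : En n × En n =>
      ENNReal.ofReal (wt r Z.1 Z.2 * wt r Z.1 Z.2) * ‖u Z.2‖ₑ ^ 2) := by
    refine Measurable.mul (M := ℝ≥0∞) ?_ ?_
    · exact ((wt_cont r).mul (wt_cont r)).measurable.ennreal_ofReal
    · exact ((mu.comp measurable_snd).enorm).pow_const 2
  have mg2 : Measurable (fun p => g p ^ 2) := by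
    simp_rw [g2]
    exact Measurable.lintegral_prod_right' mj
  have mg : Measurable g := by
    have : g = fun p => (g p ^ 2) ^ (1 / 2 : ℝ) := by
      funext p
      rw [← ENNReal.rpow_natCast, ← ENNReal.rpow_mul]; simp
    rw [this]; exact mg2.pow_const _
  have ig2 : ∫⁻ p, g p ^ 2 = ENNReal.ofReal c * eLpNorm u 2 volume ^ 2 := by
    simp_rw [g2]
    rw [lintegral_lintegral_swap mj.aemeasurable, eL_sq,
      ← lintegral_const_mul _ (mu.enorm.pow_const 2)]
    refine lintegral_congr fun y => ?_
    have mw : Measurable (fun p => ENNReal.ofReal (wt r p y * wt r p y)) :=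
      ((wt_cont_left r y).mul (wt_cont_left r y)).measurable.ennreal_ofReal
    rw [lintegral_mul_const _ mw,
      ← ofReal_integral_eq_lintegral_ofReal (wt_sq_integrable hrr y)
        (Filter.Eventually.of_forall fun p => mul_self_nonneg _), wt_sq_int]
  have key : ENNReal.ofReal (c ^ 2) * eLpNorm (So (φ k) (b k) u) 2 volume ^ 2 ≤
      ENNReal.ofReal (C * (lam k * lam k)) * (2 * ENNReal.ofReal I0 *
        (ENNReal.ofReal c * eLpNorm u 2 volume ^ 2)) := by
    rw [← sq_int (So_memLp (hK k) cφ am hu 2), Bf_eq (hK k) cφ am am hu hu]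
    have e := cut_formula (hK k) cφ am hu hrr
    have e' := congrArg (fun z : ℂ => ‖z‖ₑ) e
    simp only [enorm_mul] at e'
    rw [← ofReal_norm_eq_enorm (((_ : ℝ) : ℂ)), Complex.norm_real,
      Real.norm_of_nonneg (by positivity)] at e'
    rw [e']
    refine (enorm_integral_le_lintegral_enorm _).trans ?_
    have mk : Measurable (fun x => ENNReal.ofReal (kk x)) := kkc.measurable.ennreal_ofReal
    have hs := schur mg mk
    rw [kkl, ig2] at hs
    have mP : Measurable (fun P : En n × En n => g P.1 * g P.2 * ENNReal.ofReal (kk (P.1 - P.2))) :=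
      Measurable.mul (M := ℝ≥0∞) (Measurable.mul (M := ℝ≥0∞) (mg.comp measurable_fst)
        (mg.comp measurable_snd)) (mk.comp (measurable_fst.sub measurable_snd))
    have hs' : ∫⁻ P : En n × En n, g P.1 * g P.2 * ENNReal.ofReal (kk (P.1 - P.2)) ≤
        2 * ENNReal.ofReal I0 * (ENNReal.ofReal c * eLpNorm u 2 volume ^ 2) := by
      rw [Measure.volume_eq_prod, lintegral_prod _ mP.aemeasurable]
      exact hs
    have ms := mul_le_mul_right hs' (ENNReal.ofReal (C * (lam k * lam k)))
    refine le_trans ?_ ms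
    rw [← lintegral_const_mul _ mP]
    refine lintegral_mono fun P => ?_
    have ci : ∀ p, Integrable (cw r p u) := fun p =>
      hu.mono (cw_asm p hu.1) (Filter.Eventually.of_forall (cw_norm_le hr0 p u))
    have cm : ∀ p, MemLp (cw r p u) 2 := fun p =>
      hu2.mono (cw_asm p hu.1) (Filter.Eventually.of_forall (cw_norm_le hr0 p u))
    have h := H (k, P.1, P.2) _ _ (ci P.1) (cm P.1) (ci P.2) (cm P.2)
    rw [← ofReal_norm_eq_enorm]
    refine (ENNReal.ofReal_le_ofReal h).trans ?_
    have hn : ENNReal.ofReal (n22 (cw r P.1 u) (cw r P.2 u)) = g P.1 * g P.2 :=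
      ENNReal.ofReal_toReal (ENNReal.mul_ne_top (cm P.1).2.ne (cm P.2).2.ne)
    have hl := mul_nonneg (hlam k) (hlam k)
    have h0 := kk0 (P.1 - P.2)
    rw [show C * (lam k * lam k * (jap (P.1 - P.2))⁻¹ ^ (n + 1)) * n22 (cw r P.1 u) (cw r P.2 u)
      = (C * (lam k * lam k)) * kk (P.1 - P.2) * n22 (cw r P.1 u) (cw r P.2 u) by
        simp only [kk]; ring, ENNReal.ofReal_mul (by positivity), ENNReal.ofReal_mul (by positivity),
      hn]
    exact le_of_eq (by ring)
  have key2 : eLpNorm (So (φ k) (b k) u) 2 volume ^ 2 ≤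
      (ENNReal.ofReal ((Real.sqrt (2 * C * I0 / c) + 1) * lam k) * eLpNorm u 2 volume) ^ 2 := by
    have hl := hlam k
    have hcc : ENNReal.ofReal (c ^ 2) ≠ 0 := by simp; positivity
    rw [← ENNReal.mul_le_mul_iff_right hcc ENNReal.ofReal_ne_top]
    refine key.trans ?_
    rw [mul_pow, ← ENNReal.ofReal_pow (by positivity),
      show ∀ a d e f h : ℝ≥0∞, a * (d * e * (f * h)) = (a * d * e * f) * h by intros; ring,
      ← mul_assoc (ENNReal.ofReal (c ^ 2))]
    refine mul_le_mul_left ?_ _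
    rw [show (2 : ℝ≥0∞) = ENNReal.ofReal 2 by simp, ← ENNReal.ofReal_mul (by positivity),
      ← ENNReal.ofReal_mul (by positivity), ← ENNReal.ofReal_mul (by positivity),
      ← ENNReal.ofReal_mul (by positivity)]
    refine ENNReal.ofReal_le_ofReal ?_
    have hs : 2 * C * I0 / c ≤ (Real.sqrt (2 * C * I0 / c) + 1) ^ 2 := by
      have h0 : 0 ≤ 2 * C * I0 / c := by positivity
      nlinarith [Real.sq_sqrt h0, Real.sqrt_nonneg (2 * C * I0 / c)]
    have hs2 := mul_le_mul_of_nonneg_left hs (show 0 ≤ c ^ 2 * lam k ^ 2 by positivity)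
    calc C * (lam k * lam k) * 2 * I0 * c = c ^ 2 * lam k ^ 2 * (2 * C * I0 / c) := by
          field_simp
      _ ≤ _ := hs2
      _ = _ := by ring
  exact (ENNReal.pow_le_pow_left_iff (by norm_num)).1 key2

end YThree

section ShiftSec
variable {n : ℕ} {κ : Type*}

/-- the three-factor space -/
abbrev Z3 (n : ℕ) := En n × En n × En n

theorem hasF3 (x y ξ : En n) : HasFDerivAt (fun ξ : En n => ((x, y, ξ) : Z3 n))
    ((ContinuousLinearMap.inr ℝ (En n) (En n × En n)).comp
      (ContinuousLinearMap.inr ℝ (En n) (En n))) ξ :=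
  (hasFDerivAt_prodMk_right x (y, ξ)).comp ξ (hasFDerivAt_prodMk_right y ξ)

theorem dLine_xi {F : Type*} [NormedAddCommGroup F] [NormedSpace ℝ F]
    {f : Z3 n → F} (hf : Sm f) (k : Fin n) (x y : En n) :
    dLine (e1 k) (fun ξ => f (x, y, ξ)) = fun ξ => dLine (d3Xi k) f (x, y, ξ) := by
  rw [dLine_comp hf (hasF3 x y)]; rfl

/-- vanishing off a compact set in the last variable -/
def Vn3 (K : Set (En n)) (b : Z3 n → ℂ) : Prop := ∀ x y ξ, ξ ∉ K → b (x, y, ξ) = 0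

theorem Vn3.mul {K : Set (En n)} {b : Z3 n → ℂ} (h : Vn3 K b) (f : Z3 n → ℂ) :
    Vn3 K (fun z => f z * b z) := fun x y ξ hξ => by simp [h x y ξ hξ]

theorem Vn3.dLine {K : Set (En n)} (hK : IsCompact K) {b : Z3 n → ℂ} (h : Vn3 K b)
    (v : Z3 n) : Vn3 K (_root_.dLine v b) := by
  intro x y ξ hξ
  have : b =ᶠ[nhds (x, y, ξ)] fun _ => 0 := by
    have ho : IsOpen {z : Z3 n | z.2.2 ∉ K} :=
      hK.isClosed.isOpen_compl.preimage (continuous_snd.comp continuous_snd)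
    filter_upwards [ho.mem_nhds (show (x, y, ξ).2.2 ∉ K from hξ)] with z hz
    exact h z.1 z.2.1 z.2.2 hz
  unfold _root_.dLine
  rw [this.fderiv_eq]
  simp

/-- the oscillatory kernel -/
def Is (Ψ : Z3 n → ℝ) (a : Z3 n → ℂ) (x y : En n) : ℂ := ∫ ξ, ex (Ψ (x, y, ξ)) * a (x, y, ξ)

/-- the modified amplitude -/
def sh (h : Z3 n → ℝ) (V E : Fin n → Z3 n → ℝ) (a : Z3 n → ℂ) (z : Z3 n) : ℂ :=
  (h z : ℂ) * a z + ∑ j, ((-1 : ℂ) * (((E j z : ℝ) : ℂ) * (((V j z : ℝ) : ℂ) * a z)) +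
    Complex.I * dLine (d3Xi j) (fun z => ((V j z : ℝ) : ℂ) * a z) z)

theorem shift_id {K : Set (En n)} (hK : IsCompact K) {Ψ : Z3 n → ℝ} (sΨ : Sm Ψ) {a : Z3 n → ℂ}
    (sa : Sm a) (va : Vn3 K a) {h : Z3 n → ℝ} (shh : Sm h) {D E V : Fin n → Z3 n → ℝ}
    (sV : ∀ j, Sm (V j)) (sE : ∀ j, Sm (E j)) (hV : ∀ z, h z + ∑ j, V j z * D j z = 1)
    (hD : ∀ j z, dLine (d3Xi j) Ψ z = D j z + E j z) (x y : En n) :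
    Is Ψ a x y = Is Ψ (sh h V E a) x y := by
  let F : Fin n → Z3 n → ℂ := fun j z => ((V j z : ℝ) : ℂ) * a z
  have sF : ∀ j, Sm (F j) := fun j => (Sm_ofReal (sV j)).mul sa
  have vF : ∀ j, Vn3 K (F j) := fun j => va.mul _
  have ssh : Sm (sh h V E a) := by
    unfold sh
    exact ((Sm_ofReal shh).mul sa).add (Sm.sum fun j =>
      ((Sm.const _).mul ((Sm_ofReal (sE j)).mul (sF j))).add
        ((Sm.const _).mul ((sF j).dLine _)))
  have vsh : Vn3 K (sh h V E a) := fun x y ξ hξ => by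
    have h1 : ∀ j, dLine (d3Xi j) (fun z => ((V j z : ℝ) : ℂ) * a z) (x, y, ξ) = 0 :=
      fun j => Vn3.dLine hK (vF j) _ x y ξ hξ
    simp [sh, va x y ξ hξ, h1]
  have sl : ∀ {G : Z3 n → ℂ}, Sm G → Sm (fun ξ => G (x, y, ξ)) := fun hG => hG.compA (hasF3 x y)
  have slΨ : Sm (fun ξ => Ψ (x, y, ξ)) := sΨ.compA (hasF3 x y)
  have ii : ∀ {G : Z3 n → ℂ}, Sm G → Vn3 K G → Integrable (fun ξ => G (x, y, ξ)) := fun hG vG =>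
    (sl hG).cont.integrable_of_hasCompactSupport (HasCompactSupport.intro hK fun ξ => vG x y ξ)
  have ie : ∀ {G : Z3 n → ℂ}, Sm G → Vn3 K G →
      Integrable (fun ξ => ex (Ψ (x, y, ξ)) * G (x, y, ξ)) := fun hG vG =>
    integrable_ex_mul slΨ.cont (ii hG vG)
  have sP : ∀ j, Sm (fun z => ((dLine (d3Xi j) Ψ z : ℝ) : ℂ) * F j z) := fun j =>
    (Sm_ofReal (sΨ.dLine _)).mul (sF j)
  have vP : ∀ j, Vn3 K (fun z => ((dLine (d3Xi j) Ψ z : ℝ) : ℂ) * F j z) := fun j => (vF j).mul _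
  have sI : ∀ j, Sm (fun z => Complex.I * dLine (d3Xi j) (F j) z) := fun j =>
    (Sm.const _).mul ((sF j).dLine _)
  have vI : ∀ j, Vn3 K (fun z => Complex.I * dLine (d3Xi j) (F j) z) := fun j =>
    (Vn3.dLine hK (vF j) _).mul _
  have ibpj : ∀ j, ∫ ξ, ex (Ψ (x, y, ξ)) * (((dLine (d3Xi j) Ψ (x, y, ξ) : ℝ) : ℂ) * F j (x, y, ξ))
      = ∫ ξ, ex (Ψ (x, y, ξ)) * (Complex.I * dLine (d3Xi j) (F j) (x, y, ξ)) := fun j => by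
    have := ibp slΨ (sl (sF j)) (e1 j) (ii (sF j) (vF j))
      (by rw [dLine_xi (sF j)]; exact ii ((sF j).dLine _) (Vn3.dLine hK (vF j) _))
      (by rw [dLine_xi sΨ]; exact ii (sP j) (vP j))
    rw [dLine_xi sΨ, dLine_xi (sF j)] at this
    exact this
  have idj : ∀ j, Integrable (fun ξ => ex (Ψ (x, y, ξ)) *
      (((dLine (d3Xi j) Ψ (x, y, ξ) : ℝ) : ℂ) * F j (x, y, ξ)) -
      ex (Ψ (x, y, ξ)) * (Complex.I * dLine (d3Xi j) (F j) (x, y, ξ))) := fun j =>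
    (ie (sP j) (vP j)).sub (ie (sI j) (vI j))
  have z0 : ∑ j, ∫ ξ, (ex (Ψ (x, y, ξ)) *
      (((dLine (d3Xi j) Ψ (x, y, ξ) : ℝ) : ℂ) * F j (x, y, ξ)) -
      ex (Ψ (x, y, ξ)) * (Complex.I * dLine (d3Xi j) (F j) (x, y, ξ))) = 0 :=
    Finset.sum_eq_zero fun j _ => by
      rw [integral_sub (ie (sP j) (vP j)) (ie (sI j) (vI j)), ibpj j, sub_self]
  unfold Is
  rw [← add_zero (∫ ξ, ex (Ψ (x, y, ξ)) * sh h V E a (x, y, ξ)), ← z0,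
    ← integral_finsetSum _ (fun j _ => idj j),
    ← integral_add (ie ssh vsh) (integrable_finsetSum _ (fun j _ => idj j))]
  refine integral_congr_ae (Filter.Eventually.of_forall fun ξ => ?_)
  simp only [sh]
  rw [← sub_eq_iff_eq_add', ]
  have hh : a (x, y, ξ) = ((h (x, y, ξ) : ℝ) : ℂ) * a (x, y, ξ) +
      ∑ j, ((V j (x, y, ξ) * D j (x, y, ξ) : ℝ) : ℂ) * a (x, y, ξ) := by
    have hc := congrArg (fun t : ℝ => (t : ℂ)) (hV (x, y, ξ))
    rw [← Finset.sum_mul, ← add_mul, ← Complex.ofReal_sum, ← Complex.ofReal_add, hc]; simp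
  rw [← mul_sub, sub_eq_iff_eq_add'.2 (show a (x, y, ξ) = _ + ∑ j,
    (((dLine (d3Xi j) Ψ (x, y, ξ) : ℝ) : ℂ) * F j (x, y, ξ) -
      Complex.I * dLine (d3Xi j) (F j) (x, y, ξ)) from ?_), Finset.mul_sum]
  · exact Finset.sum_congr rfl fun j _ => by ring
  · rw [add_assoc, ← Finset.sum_add_distrib]
    conv_lhs => rw [hh]
    congr 1
    refine Finset.sum_congr rfl fun j _ => ?_
    rw [hD]
    simp only [F]
    push_cast
    ring

/-- one abstract shift step -/
theorem shift_abs {N : ℕ} {K : κ → Set (En n)} (hK : ∀ k, IsCompact (K k)) {Ψ : κ → Z3 n → ℝ}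
    (sΨ : ∀ k, Sm (Ψ k)) {a : κ → Z3 n → ℂ} (sa : ∀ k, Sm (a k)) (va : ∀ k, Vn3 (K k) (a k))
    {w wD wE : κ → Z3 n → ℝ} (hw : ∀ k z, 0 ≤ w k z) (hwD : ∀ k z, 1 ≤ wD k z)
    (hwE : ∀ k z, 1 ≤ wE k z)
    (Fa : FB v3 g3 (N + 1) w a) {D E : Fin n → κ → Z3 n → ℝ} (sD : ∀ j k, Sm (D j k))
    (sE : ∀ j k, Sm (E j k)) (FD : ∀ j, FB v3 g3 (N + 1) wD (D j))
    (FE : ∀ j, FB v3 g3 (N + 1) wE (E j)) {c : ℝ} (hc : 0 < c)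
    (hl : ∀ k z, c * wD k z ^ 2 ≤ 1 + ∑ j, D j k z ^ 2)
    (hD : ∀ j k z, dLine (d3Xi j) (Ψ k) z = D j k z + E j k z) :
    ∃ a' : κ → Z3 n → ℂ, (∀ k, Sm (a' k)) ∧ (∀ k, Vn3 (K k) (a' k)) ∧
      FB v3 g3 N (fun k z => wE k z * ((wD k z)⁻¹ * w k z)) a' ∧
      ∀ k x y, Is (Ψ k) (a k) x y = Is (Ψ k) (a' k) x y := by
  have sh0 := Sm_hQ sD
  have sV : ∀ j k, Sm (fun z => hQ D k z * D j k z) := fun j k => (sh0 k).mul (sD j k)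
  have Fh := FB_hQ sD FD hwD g3_nonneg hc hl
  have FV := FB_V sD FD hwD g3_nonneg hc hl
  have wDi : ∀ k z, 0 ≤ (wD k z)⁻¹ := fun k z => inv_nonneg.2 (by linarith [hwD k z])
  have w0 : ∀ k z, 0 ≤ (wD k z)⁻¹ * w k z := fun k z => mul_nonneg (wDi k z) (hw k z)
  have wW : ∀ k z, (wD k z)⁻¹ * w k z ≤ 1 * (wE k z * ((wD k z)⁻¹ * w k z)) := fun k z => by
    rw [one_mul]; exact le_mul_of_one_le_left (w0 k z) (hwE k z)
  have wW0 : ∀ k z, 0 ≤ wE k z * ((wD k z)⁻¹ * w k z) := fun k z =>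
    mul_nonneg (by linarith [hwE k z]) (w0 k z)
  have sVa : ∀ j k, Sm (fun z => ((hQ D k z * D j k z : ℝ) : ℂ) * a k z) := fun j k =>
    (Sm_ofReal (sV j k)).mul (sa k)
  have FVa : ∀ j, FB v3 g3 (N + 1) (fun k z => (wD k z)⁻¹ * w k z)
      (fun k z => ((hQ D k z * D j k z : ℝ) : ℂ) * a k z) := fun j =>
    FB.mul (fun k => Sm_ofReal (sV j k)) sa (FB_ofReal (sV j) (FV j)) Fa
  have s1 : ∀ k, Sm (fun z => ((hQ D k z : ℝ) : ℂ) * a k z) := fun k =>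
    (Sm_ofReal (sh0 k)).mul (sa k)
  have s2 : ∀ j k, Sm (fun z => ((E j k z : ℝ) : ℂ) *
      (((hQ D k z * D j k z : ℝ) : ℂ) * a k z)) := fun j k => (Sm_ofReal (sE j k)).mul (sVa j k)
  have s2' : ∀ j k, Sm (fun z => (-1 : ℂ) * (((E j k z : ℝ) : ℂ) *
      (((hQ D k z * D j k z : ℝ) : ℂ) * a k z))) := fun j k => (Sm.const _).mul (s2 j k)
  have s3 : ∀ j k, Sm (dLine (d3Xi j) (fun z => ((hQ D k z * D j k z : ℝ) : ℂ) * a k z)) :=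
    fun j k => (sVa j k).dLine _
  have s3' : ∀ j k, Sm (fun z => Complex.I *
      dLine (d3Xi j) (fun z => ((hQ D k z * D j k z : ℝ) : ℂ) * a k z) z) :=
    fun j k => (Sm.const _).mul (s3 j k)
  refine ⟨fun k => sh (hQ D k) (fun j z => hQ D k z * D j k z) (fun j => E j k) (a k),
    fun k => ?_, fun k => ?_, ?_, fun k x y => ?_⟩
  · unfold sh
    exact (s1 k).add (Sm.sum fun j => (s2' j k).add (s3' j k))
  · intro x y ξ hξ
    have h1 : ∀ j, dLine (d3Xi j) (fun z => ((hQ D k z * D j k z : ℝ) : ℂ) * a k z) (x, y, ξ) = 0 :=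
      fun j => Vn3.dLine (hK k) ((va k).mul _) _ x y ξ hξ
    simp only [sh, va k x y ξ hξ, h1]
    simp
  · unfold sh
    refine FB.add s1 (fun k => Sm.sum fun j => (s2' j k).add (s3' j k)) ?_ ?_
    · refine (FB.mul (fun k => Sm_ofReal (sh0 k)) sa (FB_ofReal sh0 (Fh.le (Nat.le_succ N)))
        (Fa.le (Nat.le_succ N))).mono g3_nonneg (fun k z => ?_) 1 (fun k z => ?_)
      · exact mul_nonneg (inv_nonneg.2 (mul_self_nonneg _)) (hw k z)
      · refine le_trans ?_ (wW k z)
        refine mul_le_mul_of_nonneg_right ?_ (hw k z)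
        rw [mul_inv]
        exact mul_le_of_le_one_left (wDi k z) (inv_le_one_of_one_le₀ (hwD k z))
    · refine FB.sum (fun j k => (s2' j k).add (s3' j k)) wW0 g3_nonneg (fun j => ?_)
      refine FB.add (s2' j) (s3' j) ?_ ?_
      · refine FB.const_mul (s2 j) ?_ _
        exact FB.mul (fun k => Sm_ofReal (sE j k)) (sVa j)
          (FB_ofReal (sE j) ((FE j).le (Nat.le_succ N))) ((FVa j).le (Nat.le_succ N))
      · refine FB.const_mul (s3 j) ?_ _
        have h1 := (FVa j).dLine (Sum.inr (Sum.inr j))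
        refine FB.mono h1 g3_nonneg (fun k z => mul_nonneg (g3_nonneg _ _) (w0 k z)) 1 (fun k z => ?_)
        refine le_trans (le_of_eq ?_) (wW k z)
        exact one_mul _
  · exact shift_id (hK k) (sΨ k) (sa k) (va k) (sh0 k) (fun j => sV j k) (fun j => sE j k)
      (hQ_id D k) (fun j z => hD j k z) x y

end ShiftSec

section ShiftConc
variable {n : ℕ} {κ ι : Type*}

theorem FB.fst3 {N : ℕ} {F : Type*} [NormedAddCommGroup F] [NormedSpace ℝ F]
    {w : κ → En n → ℝ} {f : κ → En n → F} (hf : ∀ k, Sm (f k))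
    (h : FB e1 gj N w f) (hw : ∀ k z, 0 ≤ w k z) :
    FB v3 g3 N (fun k z => w k z.1) (fun k (z : Z3 n) => f k z.1) := by
  have hσ : ∀ j : Fin n ⊕ (Fin n ⊕ Fin n),
      (ContinuousLinearMap.fst ℝ (En n) (En n × En n)) (v3 j) = 0 ∨
      ∃ j0, (ContinuousLinearMap.fst ℝ (En n) (En n × En n)) (v3 j) = e1 j0 ∧
        ∀ (k : κ) (z : Z3 n), gj j0 z.1 ≤ g3 j z := fun j => by
    rcases j with j | j | j
    · exact Or.inr ⟨j, rfl, fun k z => le_rfl⟩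
    · exact Or.inl rfl
    · exact Or.inl rfl
  have hA : ∀ (k : κ) (z : Z3 n), HasFDerivAt (fun z : Z3 n => z.1)
    (ContinuousLinearMap.fst ℝ (En n) (En n × En n)) z := fun k z => hasFDerivAt_fst
  exact FB.comp0 (κ := κ) hf h hw gj_nonneg g3_nonneg (fun k : κ => k)
    (fun k z => z.1) (ContinuousLinearMap.fst ℝ (En n) (En n × En n)) hA hσ

theorem FB.snd3 {N : ℕ} {F : Type*} [NormedAddCommGroup F] [NormedSpace ℝ F]
    {w : κ → En n × En n → ℝ} {f : κ → En n × En n → F} (hf : ∀ k, Sm (f k))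
    (h : FB v2 g1 N w f) (hw : ∀ k z, 0 ≤ w k z) :
    FB v3 g3 N (fun k z => w k z.2) (fun k (z : Z3 n) => f k z.2) := by
  have hσ : ∀ j : Fin n ⊕ (Fin n ⊕ Fin n),
      (ContinuousLinearMap.snd ℝ (En n) (En n × En n)) (v3 j) = 0 ∨
      ∃ j0, (ContinuousLinearMap.snd ℝ (En n) (En n × En n)) (v3 j) = v2 j0 ∧
        ∀ (k : κ) (z : Z3 n), g1 j0 z.2 ≤ g3 j z := fun j => by
    rcases j with j | j | j
    · exact Or.inl rfl
    · exact Or.inr ⟨Sum.inl j, rfl, fun k z => le_rfl⟩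
    · exact Or.inr ⟨Sum.inr j, rfl, fun k z => le_rfl⟩
  have hA : ∀ (k : κ) (z : Z3 n), HasFDerivAt (fun z : Z3 n => z.2)
    (ContinuousLinearMap.snd ℝ (En n) (En n × En n)) z := fun k z => hasFDerivAt_snd
  exact FB.comp0 (κ := κ) hf h hw g1_nonneg g3_nonneg (fun k : κ => k)
    (fun k z => z.2) (ContinuousLinearMap.snd ℝ (En n) (En n × En n)) hA hσ

theorem Sm.fst3 {F : Type*} [NormedAddCommGroup F] [NormedSpace ℝ F] {f : En n → F}
    (hf : Sm f) : Sm (fun z : Z3 n => f z.1) := ContDiff.comp hf contDiff_fst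
theorem Sm.snd3 {F : Type*} [NormedAddCommGroup F] [NormedSpace ℝ F] {f : En n × En n → F}
    (hf : Sm f) : Sm (fun z : Z3 n => f z.2) := ContDiff.comp hf contDiff_snd

/-- full phase -/
def Psi (φ : En n × En n → ℝ) (z : Z3 n) : ℝ := ⟪z.1, z.2.2⟫ + φ z.2

theorem Sm_Psi {φ : En n × En n → ℝ} (h : Sm φ) : Sm (Psi φ) := by
  refine Sm.add ?_ h.snd3
  exact ContDiff.inner ℝ contDiff_fst (contDiff_snd.comp contDiff_snd)

theorem dLine_Psi {φ : En n × En n → ℝ} (h : Sm φ) (j : Fin n) (z : Z3 n) :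
    dLine (d3Xi j) (Psi φ) z = z.1 j + dLine (dY j) φ z.2 := by
  have h1 : Sm (fun z : Z3 n => ⟪z.1, z.2.2⟫) :=
    ContDiff.inner ℝ contDiff_fst (contDiff_snd.comp contDiff_snd)
  have e : Psi φ = fun z => ⟪z.1, z.2.2⟫ + φ z.2 := rfl
  rw [e, dLine_add h1 h.snd3]; beta_reduce
  congr 1
  · obtain ⟨x, y, ξ⟩ := z
    have := congrFun (dLine_xi h1 j x y) ξ
    rw [← this]
    have h2 : HasFDerivAt (fun ξ : En n => ⟪x, ξ⟫) (innerSL ℝ x) ξ :=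
      (innerSL ℝ x).hasFDerivAt
    unfold dLine
    rw [h2.fderiv]
    simp [e1, EuclideanSpace.inner_single_right]
  · have hA : ∀ z : Z3 n, HasFDerivAt (fun z : Z3 n => z.2)
      (ContinuousLinearMap.snd ℝ (En n) (En n × En n)) z := fun z => hasFDerivAt_snd
    have := congrFun (dLine_comp h hA (d3Xi j)) z
    rw [this]; rfl

/-- symbol weight -/
def w3 (p q : ℝ) (z : Z3 n) : ℝ := jap z.1 ^ p * jap z.2.1 ^ q

theorem w3_pos (p q : ℝ) (z : Z3 n) : 0 < w3 p q z :=
  mul_pos (Real.rpow_pos_of_pos (jap_pos _) _) (Real.rpow_pos_of_pos (jap_pos _) _)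

theorem jap_rpow_inv_mul (x : En n) (p : ℝ) : (jap x)⁻¹ * jap x ^ p = jap x ^ (p - 1) := by
  rw [Real.rpow_sub_one (jap_pos x).ne']; ring

theorem jap_rpow_mul (x : En n) (p : ℝ) : jap x * jap x ^ p = jap x ^ (p + 1) := by
  rw [Real.rpow_add_one (jap_pos x).ne']; ring

theorem shiftA1 {N : ℕ} {K : κ → Set (En n)} (hK : ∀ k, IsCompact (K k))
    {φ : κ → En n × En n → ℝ} (hφ : Ph (N + 1) φ) {a : κ → Z3 n → ℂ} (sa : ∀ k, Sm (a k))
    (va : ∀ k, Vn3 (K k) (a k)) {p q : ℝ} (Fa : FB v3 g3 (N + 1) (fun _ => w3 p q) a) :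
    ∃ a' : κ → Z3 n → ℂ, (∀ k, Sm (a' k)) ∧ (∀ k, Vn3 (K k) (a' k)) ∧
      FB v3 g3 N (fun _ => w3 (p - 1) (q + 1)) a' ∧
      ∀ k x y, Is (Psi (φ k)) (a k) x y = Is (Psi (φ k)) (a' k) x y := by
  have FD : ∀ j, FB v3 g3 (N + 1) (fun (_ : κ) (z : Z3 n) => jap z.1) (fun (_ : κ) z => z.1 j) :=
    fun j => FB.fst3 (fun _ => Sm_coord j) (FB_coord (N + 1) j) (fun _ x => (jap_pos x).le)
  have FE : ∀ j, FB v3 g3 (N + 1) (fun (_ : κ) (z : Z3 n) => jap z.2.1)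
      (fun k z => dLine (dY j) (φ k) z.2) := fun j =>
    FB.snd3 (fun k => (hφ.sm k).dLine _) (hφ.d1 j) (fun _ x => (jap_pos _).le)
  obtain ⟨a', h1, h2, h3, h4⟩ := shift_abs hK (fun k => Sm_Psi (hφ.sm k)) sa va
    (fun _ z => (w3_pos p q z).le) (fun _ z => jap_one_le z.1) (fun _ z => jap_one_le z.2.1) Fa
    (fun j _ => (Sm_coord j).fst3) (fun j k => ((hφ.sm k).dLine (dY j)).snd3) FD FE one_pos
    (fun _ z => by
      rw [one_mul, jap_sq, EuclideanSpace.norm_sq_eq]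
      simp)
    (fun j k z => dLine_Psi (hφ.sm k) j z)
  refine ⟨a', h1, h2, h3.congrw fun k z => ?_, h4⟩
  unfold w3
  rw [← jap_rpow_inv_mul, ← jap_rpow_mul]; ring

theorem shiftB1 {N : ℕ} {K : κ → Set (En n)} (hK : ∀ k, IsCompact (K k))
    {φ : κ → En n × En n → ℝ} (hφ : Ph (N + 1) φ) {a : κ → Z3 n → ℂ} (sa : ∀ k, Sm (a k))
    (va : ∀ k, Vn3 (K k) (a k)) {p q : ℝ} (Fa : FB v3 g3 (N + 1) (fun _ => w3 p q) a) :
    ∃ a' : κ → Z3 n → ℂ, (∀ k, Sm (a' k)) ∧ (∀ k, Vn3 (K k) (a' k)) ∧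
      FB v3 g3 N (fun _ => w3 (p + 1) (q - 1)) a' ∧
      ∀ k x y, Is (Psi (φ k)) (a k) x y = Is (Psi (φ k)) (a' k) x y := by
  have FD : ∀ j, FB v3 g3 (N + 1) (fun (_ : κ) (z : Z3 n) => jap z.1) (fun (_ : κ) z => z.1 j) :=
    fun j => FB.fst3 (fun _ => Sm_coord j) (FB_coord (N + 1) j) (fun _ x => (jap_pos x).le)
  have FE : ∀ j, FB v3 g3 (N + 1) (fun (_ : κ) (z : Z3 n) => jap z.2.1)
      (fun k z => dLine (dY j) (φ k) z.2) := fun j =>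
    FB.snd3 (fun k => (hφ.sm k).dLine _) (hφ.d1 j) (fun _ x => (jap_pos _).le)
  obtain ⟨c, hc, hl⟩ := hφ.low0
  obtain ⟨a', h1, h2, h3, h4⟩ := shift_abs hK (fun k => Sm_Psi (hφ.sm k)) sa va
    (fun _ z => (w3_pos p q z).le) (fun _ z => jap_one_le z.2.1) (fun _ z => jap_one_le z.1) Fa
    (fun j k => ((hφ.sm k).dLine (dY j)).snd3) (fun j _ => (Sm_coord j).fst3) FE FD hc
    (fun k z => hl k z.2.1 z.2.2)
    (fun j k z => (dLine_Psi (hφ.sm k) j z).trans (add_comm _ _))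
  refine ⟨a', h1, h2, h3.congrw fun k z => ?_, h4⟩
  unfold w3
  rw [← jap_rpow_inv_mul, ← jap_rpow_mul]; ring

theorem shiftA {N : ℕ} {K : κ → Set (En n)} (hK : ∀ k, IsCompact (K k)) (d : ℕ)
    {φ : κ → En n × En n → ℝ} (hφ : Ph (N + d) φ) {a : κ → Z3 n → ℂ} (sa : ∀ k, Sm (a k))
    (va : ∀ k, Vn3 (K k) (a k)) {p q : ℝ} (Fa : FB v3 g3 (N + d) (fun _ => w3 p q) a) :
    ∃ a' : κ → Z3 n → ℂ, (∀ k, Sm (a' k)) ∧ (∀ k, Vn3 (K k) (a' k)) ∧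
      FB v3 g3 N (fun _ => w3 (p - d) (q + d)) a' ∧
      ∀ k x y, Is (Psi (φ k)) (a k) x y = Is (Psi (φ k)) (a' k) x y := by
  induction d generalizing a p q with
  | zero => exact ⟨a, sa, va, by simpa using Fa, fun _ _ _ => rfl⟩
  | succ d ih =>
    obtain ⟨a1, s1, v1, F1, e1⟩ := shiftA1 (N := N + d) hK hφ sa va Fa
    obtain ⟨a2, s2, v2, F2, e2⟩ := ih (hφ.le (by omega)) s1 v1 F1
    refine ⟨a2, s2, v2, F2.congrw fun k z => ?_, fun k x y => (e1 k x y).trans (e2 k x y)⟩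
    push_cast
    congr 1 <;> ring

theorem shiftB {N : ℕ} {K : κ → Set (En n)} (hK : ∀ k, IsCompact (K k)) (d : ℕ)
    {φ : κ → En n × En n → ℝ} (hφ : Ph (N + d) φ) {a : κ → Z3 n → ℂ} (sa : ∀ k, Sm (a k))
    (va : ∀ k, Vn3 (K k) (a k)) {p q : ℝ} (Fa : FB v3 g3 (N + d) (fun _ => w3 p q) a) :
    ∃ a' : κ → Z3 n → ℂ, (∀ k, Sm (a' k)) ∧ (∀ k, Vn3 (K k) (a' k)) ∧
      FB v3 g3 N (fun _ => w3 (p + d) (q - d)) a' ∧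
      ∀ k x y, Is (Psi (φ k)) (a k) x y = Is (Psi (φ k)) (a' k) x y := by
  induction d generalizing a p q with
  | zero => exact ⟨a, sa, va, by simpa using Fa, fun _ _ _ => rfl⟩
  | succ d ih =>
    obtain ⟨a1, s1, v1, F1, e1⟩ := shiftB1 (N := N + d) hK hφ sa va Fa
    obtain ⟨a2, s2, v2, F2, e2⟩ := ih (hφ.le (by omega)) s1 v1 F1
    refine ⟨a2, s2, v2, F2.congrw fun k z => ?_, fun k x y => (e1 k x y).trans (e2 k x y)⟩
    push_cast
    congr 1 <;> ring

/-- rapidly decaying functions -/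
structure RD (v : En n → ℂ) : Prop where
  ms : Measurable v
  i1 : ∀ q : ℝ, Integrable (fun y => ((jap y ^ q : ℝ) : ℂ) * v y)
  i2 : ∀ q : ℝ, MemLp (fun y => ((jap y ^ q : ℝ) : ℂ) * v y) 2

/-- the operator -/
def TT (φ : En n × En n → ℝ) (a : Z3 n → ℂ) (v : En n → ℂ) (x : En n) : ℂ :=
  ∫ ξ, ∫ y, ex (Psi φ (x, y, ξ)) * a (x, y, ξ) * v y

theorem TT_eq_Is {φ : En n × En n → ℝ} (hφ : Sm φ) {a : Z3 n → ℂ} (sa : Sm a)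
    {K : Set (En n)} (hK : IsCompact K) (va : Vn3 K a) {C p q : ℝ}
    (hC : ∀ z, ‖a z‖ ≤ C * w3 p q z) {v : En n → ℂ} (hv : RD v) (x : En n) :
    TT φ a v x = ∫ y, Is (Psi φ) a x y * v y := by
  unfold TT
  rw [integral_integral_swap]
  · refine integral_congr_ae (Filter.Eventually.of_forall fun y => ?_)
    simp only [Is]
    rw [integral_mul_const]
  · have i1 : Integrable (fun ξ : En n => K.indicator (fun _ => C * jap x ^ p) ξ) :=
      (integrable_indicator_iff hK.measurableSet).2 (integrableOn_const hK.measure_lt_top.ne)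
    have := i1.mul_prod (hv.i1 q).norm
    refine this.mono' ?_ (Filter.Eventually.of_forall fun z => ?_)
    · have c1 : Continuous (fun z : En n × En n => ex (Psi φ (x, z.2, z.1)) * a (x, z.2, z.1)) := by
        have cc : Continuous (fun z : En n × En n => ((x, z.2, z.1) : Z3 n)) := by fun_prop
        exact (ex_cont.comp ((Sm_Psi hφ).cont.comp cc)).mul (sa.cont.comp cc)
      exact c1.aestronglyMeasurable.mul (hv.ms.comp measurable_snd).aestronglyMeasurable
    · simp only [Function.uncurry]
      rw [norm_mul, norm_mul, norm_ex, one_mul, norm_mul, Complex.norm_real, Real.norm_of_nonneg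
        (Real.rpow_nonneg (jap_pos _).le _)]
      by_cases h : z.1 ∈ K
      · simp only [h, Set.indicator_of_mem]
        have := mul_le_mul_of_nonneg_right (hC (x, z.2, z.1)) (norm_nonneg (v z.2))
        refine this.trans (le_of_eq ?_)
        unfold w3; ring
      · simp [va x z.2 z.1 h, h]

theorem Y3q {N : ℕ} (hN : 2 * n + 2 ≤ N) {φ : κ → En n × En n → ℝ} (hφ : Ph (N + 1) φ)
    {b : κ → En n × En n → ℂ} (sb : ∀ k, Sm (b k)) {K : κ → Set (En n)}
    (hK : ∀ k, IsCompact (K k)) (vb : ∀ k, Vn (K k) (b k)) {lam : κ → ℝ} (hlam : ∀ k, 0 ≤ lam k)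
    {q : ℝ} (Fb : FB v2 g1 N (fun k z => lam k * jap z.1 ^ q) b) :
    ∃ C : ℝ, 0 < C ∧ ∀ k v, RD v →
      eLpNorm (So (φ k) (b k) v) 2 volume ≤
        ENNReal.ofReal (C * lam k) * eLpNorm (fun y => ((jap y ^ q : ℝ) : ℂ) * v y) 2 volume := by
  have sj : ∀ _ : κ, Sm (fun z : En n × En n => ((jap (z.1 - 0) ^ (-q) : ℝ) : ℂ)) := fun _ =>
    Sm_ofReal (Sm_japY (-q) 0)
  have Fj := FB_ofReal (fun _ : κ => Sm_japY (-q) (0 : En n)) (FB_japY N (-q) (fun _ : κ => 0))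
  have F := FB.mul sj sb Fj Fb
  obtain ⟨C, hC, H⟩ := Y3 hN hφ (fun k => (sj k).mul (sb k)) hK (fun k => (vb k).mul _) hlam
    (F.congrw fun k z => by
      rw [sub_zero, Real.rpow_neg (jap_pos _).le]
      have := (Real.rpow_pos_of_pos (jap_pos z.1) q).ne'
      field_simp)
  refine ⟨C, hC, fun k v hv => ?_⟩
  have hm : Measurable (fun y => ((jap y ^ q : ℝ) : ℂ) * v y) := by
    refine Measurable.mul ?_ hv.ms
    exact (Complex.continuous_ofReal.comp (Sm_jap_rpow q).cont).measurable
  have := H k _ hm (hv.i1 q) (hv.i2 q)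
  convert this using 2
  funext ξ
  unfold So
  refine integral_congr_ae (Filter.Eventually.of_forall fun y => ?_)
  simp only [sub_zero]
  have e : ((jap y ^ (-q) : ℝ) : ℂ) * ((jap y ^ q : ℝ) : ℂ) = 1 := by
    rw [← Complex.ofReal_mul, ← Real.rpow_add (jap_pos _)]; simp
  linear_combination (-(ex (φ k (y, ξ)) * b k (y, ξ) * v y)) * e
end ShiftConc

section Planch
variable {n : ℕ}
open FourierTransform

theorem four_L2 {g : En n → ℂ} (h1 : Integrable g) (h2 : MemLp g 2) :
    eLpNorm (𝓕 g) 2 volume = eLpNorm g 2 volume := by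
  have hc : Continuous (𝓕 g) := VectorFourier.fourierIntegral_continuous
    Real.continuous_fourierChar (by exact continuous_inner) h1
  set G : Lp ℂ 2 (volume : Measure (En n)) := 𝓕 (h2.toLp g) with hG
  have key : (G : En n → ℂ) =ᵐ[volume] 𝓕 g := by
    refine ae_eq_of_integral_contDiff_smul_eq (μ := volume) ((Lp.memLp G).locallyIntegrable (by norm_num))
      hc.locallyIntegrable fun ψ hψ hψc => ?_
    have hg1 : HasCompactSupport (Complex.ofRealCLM ∘ ψ) := hψc.comp_left rfl
    have hg2 : ContDiff ℝ (⊤ : ℕ∞) (Complex.ofRealCLM ∘ ψ) := by fun_prop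
    set P : 𝓢(En n, ℂ) := hg1.toSchwartzMap hg2 with hP
    have e1 : ∫ x, ψ x • G x = Lp.toTemperedDistribution G P := by
      rw [Lp.toTemperedDistribution_apply]; rfl
    rw [e1, hG, ← Lp.fourier_toTemperedDistribution_eq, TemperedDistribution.fourier_apply,
      Lp.toTemperedDistribution_apply]
    have e2 : ∫ x, (𝓕 P) x • (h2.toLp g : En n → ℂ) x = ∫ x, (𝓕 (P : En n → ℂ)) x • g x := by
      refine integral_congr_ae ?_
      filter_upwards [h2.coeFn_toLp] with x hx
      rw [hx]; rfl
    rw [e2]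
    have := VectorFourier.integral_fourierIntegral_smul_eq_flip (L := innerₗ (En n))
      Real.continuous_fourierChar continuous_inner (P.integrable (μ := volume)) h1
    rw [flip_innerₗ] at this
    exact this
  rw [← eLpNorm_congr_ae key]
  have e3 : eLpNorm (G : En n → ℂ) 2 volume = ENNReal.ofReal ‖G‖ := by
    rw [Lp.norm_def, ENNReal.ofReal_toReal (Lp.eLpNorm_ne_top G)]
  rw [e3, hG, Lp.norm_fourier_eq, Lp.norm_toLp, ENNReal.ofReal_toReal h2.2.ne]

/-- the Fourier integral in our normalisation -/
def Ft (g : En n → ℂ) (x : En n) : ℂ := ∫ ξ, ex ⟪x, ξ⟫ * g ξ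

theorem Ft_eq (g : En n → ℂ) (x : En n) : Ft g x = 𝓕 g ((-(2 * π)⁻¹) • x) := by
  unfold Ft
  rw [Real.fourier_eq']
  refine integral_congr_ae (Filter.Eventually.of_forall fun ξ => ?_)
  simp only [smul_eq_mul, ex]
  congr 2
  rw [real_inner_smul_right, real_inner_comm]
  have : -2 * π * (-(2 * π)⁻¹ * ⟪x, ξ⟫) = ⟪x, ξ⟫ := by
    have := Real.pi_pos.ne'
    field_simp
  rw [real_inner_comm, this]; ring

theorem lint_scale {f : En n → ℝ≥0∞} (hf : Measurable f) {r : ℝ} (hr : r ≠ 0) :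
    ∫⁻ x, f (r • x) = ENNReal.ofReal |(r ^ n)⁻¹| * ∫⁻ x, f x := by
  have := Measure.map_addHaar_smul (volume : Measure (En n)) hr
  rw [← lintegral_map hf (measurable_const_smul r), this, lintegral_smul_measure]
  simp [En]

theorem Ft_cont {g : En n → ℂ} (h1 : Integrable g) : Continuous (Ft g) := by
  have hc : Continuous (𝓕 g) := VectorFourier.fourierIntegral_continuous
    Real.continuous_fourierChar (by exact continuous_inner) h1
  have : Ft g = fun x => 𝓕 g ((-(2 * π)⁻¹) • x) := funext (Ft_eq g)
  rw [this]
  exact hc.comp (continuous_const_smul _)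

theorem planch {g : En n → ℂ} (h1 : Integrable g) (h2 : MemLp g 2) :
    ∫⁻ x, ‖Ft g x‖ₑ ^ 2 = ENNReal.ofReal ((2 * π) ^ n) * eLpNorm g 2 volume ^ 2 := by
  have hc : Continuous (𝓕 g) := VectorFourier.fourierIntegral_continuous
    Real.continuous_fourierChar (by exact continuous_inner) h1
  simp_rw [Ft_eq]
  have hm : Measurable (fun x => ‖𝓕 g x‖ₑ ^ 2) := (hc.measurable.enorm).pow_const 2
  have hr : (-(2 * π)⁻¹) ≠ 0 := by
    have := Real.pi_pos
    exact neg_ne_zero.2 (by positivity)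
  rw [lint_scale hm hr, ← eL_sq, four_L2 h1 h2]
  congr 2
  rw [abs_inv, abs_pow, abs_neg, abs_of_pos (by have := Real.pi_pos; positivity), inv_pow, inv_inv]
end Planch

section Frozen
variable {n : ℕ}

/-- the operator with frozen outer variable in the amplitude -/
def JJ (φ : En n × En n → ℝ) (c : Z3 n → ℂ) (v : En n → ℂ) (x z : En n) : ℂ :=
  ∫ p : En n × En n, ex (Psi φ (x, p.2, p.1)) * c (z, p.2, p.1) * v p.2

/-- decaying amplitudes -/
structure Dc (K : Set (En n)) (q : ℝ) (c : Z3 n → ℂ) : Prop where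
  sm : Sm c
  vn : Vn3 K c
  bd : ∃ B : ℝ, 0 ≤ B ∧ ∀ z, ‖c z‖ ≤ B * (jap z.1)⁻¹ * jap z.2.1 ^ q

/-- dominating function -/
def dm (K : Set (En n)) (q B : ℝ) (v : En n → ℂ) (p : En n × En n) : ℝ :=
  K.indicator (fun _ => B) p.1 * ‖((jap p.2 ^ q : ℝ) : ℂ) * v p.2‖

variable {K : Set (En n)} {q B : ℝ} {v : En n → ℂ} {c : Z3 n → ℂ} {φ : En n × En n → ℝ}

theorem dm_int (hK : IsCompact K) (hv : RD v) : Integrable (dm K q B v) := by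
  have i1 : Integrable (fun ξ : En n => K.indicator (fun _ => B) ξ) :=
    (integrable_indicator_iff hK.measurableSet).2 (integrableOn_const hK.measure_lt_top.ne)
  exact i1.mul_prod (hv.i1 q).norm

theorem dm_bound (vc : Vn3 K c) (hB : ∀ z, ‖c z‖ ≤ B * (jap z.1)⁻¹ * jap z.2.1 ^ q)
    (x z : En n) (p : En n × En n) :
    ‖ex (Psi φ (x, p.2, p.1)) * c (z, p.2, p.1) * v p.2‖ ≤ (jap z)⁻¹ * dm K q B v p := by
  unfold dm
  rw [norm_mul, norm_mul, norm_ex, one_mul, norm_mul, Complex.norm_real, Real.norm_of_nonneg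
    (Real.rpow_nonneg (jap_pos _).le _)]
  by_cases h : p.1 ∈ K
  · simp only [h, Set.indicator_of_mem]
    have := mul_le_mul_of_nonneg_right (hB (z, p.2, p.1)) (norm_nonneg (v p.2))
    refine this.trans (le_of_eq ?_)
    ring
  · simp [vc z p.2 p.1 h, h]

theorem dm_nonneg (hB : 0 ≤ B) (p : En n × En n) : 0 ≤ dm K q B v p := by
  unfold dm
  refine mul_nonneg (Set.indicator_nonneg (fun _ _ => hB) _) (norm_nonneg _)

theorem dm_bound' (vc : Vn3 K c) (hB0 : 0 ≤ B) (hB : ∀ z, ‖c z‖ ≤ B * (jap z.1)⁻¹ * jap z.2.1 ^ q)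
    (x z : En n) (p : En n × En n) :
    ‖ex (Psi φ (x, p.2, p.1)) * c (z, p.2, p.1) * v p.2‖ ≤ dm K q B v p :=
  (dm_bound vc hB x z p).trans
    (mul_le_of_le_one_left (dm_nonneg hB0 p) (inv_le_one_of_one_le₀ (jap_one_le z)))

theorem jj_asm (hφ : Sm φ) (sc : Sm c) (hv : RD v) (x z : En n) :
    AEStronglyMeasurable (fun p : En n × En n =>
      ex (Psi φ (x, p.2, p.1)) * c (z, p.2, p.1) * v p.2) := by
  have c1 : Continuous (fun p : En n × En n => ex (Psi φ (x, p.2, p.1)) * c (z, p.2, p.1)) := by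
    have cc : Continuous (fun p : En n × En n => ((x, p.2, p.1) : Z3 n)) := by fun_prop
    have cd : Continuous (fun p : En n × En n => ((z, p.2, p.1) : Z3 n)) := by fun_prop
    exact (ex_cont.comp ((Sm_Psi hφ).cont.comp cc)).mul (sc.cont.comp cd)
  exact c1.aestronglyMeasurable.mul (hv.ms.comp measurable_snd).aestronglyMeasurable

theorem jj_int (hK : IsCompact K) (hφ : Sm φ) (hc : Dc K q c) (hv : RD v) (x z : En n) :
    Integrable (fun p : En n × En n => ex (Psi φ (x, p.2, p.1)) * c (z, p.2, p.1) * v p.2) := by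
  obtain ⟨B, hB0, hB⟩ := hc.bd
  exact (dm_int hK hv).mono' (jj_asm hφ hc.sm hv x z)
    (Filter.Eventually.of_forall fun p => dm_bound' hc.vn hB0 hB x z p)

theorem jj_norm (hK : IsCompact K) (hc : Dc K q c) (hv : RD v) :
    ∃ B : ℝ, ∀ x z, ‖JJ φ c v x z‖ ≤ (jap z)⁻¹ * B := by
  obtain ⟨B, hB0, hB⟩ := hc.bd
  refine ⟨∫ p, dm K q B v p, fun x z => ?_⟩
  rw [← integral_const_mul]
  exact norm_integral_le_of_norm_le ((dm_int hK hv).const_mul _)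
    (Filter.Eventually.of_forall fun p => dm_bound hc.vn hB x z p)

theorem jj_cont (hK : IsCompact K) (hφ : Sm φ) (hc : Dc K q c) (hv : RD v) :
    Continuous (fun s : En n × En n => JJ φ c v s.1 s.2) := by
  obtain ⟨B, hB0, hB⟩ := hc.bd
  refine continuous_of_dominated (fun s => jj_asm hφ hc.sm hv s.1 s.2)
    (fun s => Filter.Eventually.of_forall fun p => dm_bound' hc.vn hB0 hB s.1 s.2 p)
    (dm_int hK hv) (Filter.Eventually.of_forall fun p => ?_)
  have cc : Continuous (fun s : En n × En n => ((s.1, p.2, p.1) : Z3 n)) := by fun_prop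
  have cd : Continuous (fun s : En n × En n => ((s.2, p.2, p.1) : Z3 n)) := by fun_prop
  exact ((ex_cont.comp ((Sm_Psi hφ).cont.comp cc)).mul (hc.sm.cont.comp cd)).mul continuous_const

theorem jj_cont_z (hK : IsCompact K) (hφ : Sm φ) (hc : Dc K q c) (hv : RD v) (x : En n) :
    Continuous (JJ φ c v x) := by
  obtain ⟨B, hB0, hB⟩ := hc.bd
  refine continuous_of_dominated (fun s => jj_asm hφ hc.sm hv x s)
    (fun s => Filter.Eventually.of_forall fun p => dm_bound' hc.vn hB0 hB x s p)
    (dm_int hK hv) (Filter.Eventually.of_forall fun p => ?_)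
  have cd : Continuous (fun s : En n => ((s, p.2, p.1) : Z3 n)) := by fun_prop
  exact (continuous_const.mul (hc.sm.cont.comp cd)).mul continuous_const

theorem jj_deriv (hK : IsCompact K) (hφ : Sm φ) (hc : Dc K q c) (j : Fin n)
    (hc' : Dc K q (dLine (d3X j) c)) (hv : RD v) (x z : En n) (t : ℝ) :
    HasDerivAt (fun t : ℝ => JJ φ c v x (z + t • e1 j))
      (JJ φ (dLine (d3X j) c) v x (z + t • e1 j)) t := by
  obtain ⟨B, hB0, hB⟩ := hc'.bd
  refine (hasDerivAt_integral_of_dominated_loc_of_deriv_le (bound := dm K q B v)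
    (F := fun (t : ℝ) (p : En n × En n) =>
      ex (Psi φ (x, p.2, p.1)) * c (z + t • e1 j, p.2, p.1) * v p.2)
    (F' := fun (t : ℝ) (p : En n × En n) =>
      ex (Psi φ (x, p.2, p.1)) * dLine (d3X j) c (z + t • e1 j, p.2, p.1) * v p.2)
    Filter.univ_mem
    (Filter.Eventually.of_forall fun t => jj_asm hφ hc.sm hv x _) (jj_int hK hφ hc hv x _)
    (jj_asm hφ hc'.sm hv x _)
    (Filter.Eventually.of_forall fun p t _ => dm_bound' hc'.vn hB0 hB x _ p)
    (dm_int hK hv) (Filter.Eventually.of_forall fun p t _ => ?_)).2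
  refine HasDerivAt.mul_const (HasDerivAt.const_mul _ ?_) _
  have h1 : HasDerivAt (fun t : ℝ => ((z + t • e1 j, p.2, p.1) : Z3 n)) (d3X j) t := by
    have h2 : HasDerivAt (fun t : ℝ => z + t • (e1 j : En n)) (e1 j) t := by
      simpa using ((hasDerivAt_id t).smul_const (e1 j : En n)).const_add z
    exact h2.prodMk (hasDerivAt_const t (p.2, p.1))
  exact (hc.sm.diff _).hasFDerivAt.comp_hasDerivAt t h1

theorem ftc_enorm {f f' : ℝ → ℂ} (hf : ∀ t, HasDerivAt f (f' t) t) (hc : Continuous f')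
    (h0 : Filter.Tendsto f Filter.atBot (nhds 0)) (t : ℝ) : ‖f t‖ₑ ≤ ∫⁻ s, ‖f' s‖ₑ := by
  have key : ∀ a ≤ t, ‖f t - f a‖ₑ ≤ ∫⁻ s, ‖f' s‖ₑ := fun a ha => by
    rw [← intervalIntegral.integral_eq_sub_of_hasDerivAt (fun s _ => hf s)
      (hc.intervalIntegrable _ _), intervalIntegral.integral_of_le ha]
    exact (enorm_integral_le_lintegral_enorm _).trans (setLIntegral_le_lintegral _ _)
  have h1 : Filter.Tendsto (fun a => ‖f t - f a‖ₑ) Filter.atBot (nhds ‖f t - 0‖ₑ) :=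
    (continuous_enorm.tendsto _).comp (tendsto_const_nhds.sub h0)
  rw [sub_zero] at h1
  refine le_of_tendsto h1 ?_
  filter_upwards [Filter.eventually_le_atBot t] with a ha using key a ha

theorem jj_ftc (hK : IsCompact K) (hφ : Sm φ) (hc : Dc K q c) (j : Fin n)
    (hc' : Dc K q (dLine (d3X j) c)) (hv : RD v) (x z : En n) (t : ℝ) :
    ‖JJ φ c v x (z + t • e1 j)‖ₑ ≤ ∫⁻ s : ℝ, ‖JJ φ (dLine (d3X j) c) v x (z + s • e1 j)‖ₑ := by
  refine ftc_enorm (f := fun t : ℝ => JJ φ c v x (z + t • e1 j))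
    (fun t => jj_deriv hK hφ hc j hc' hv x z t) ?_ ?_ t
  · have h1 := jj_cont_z hK hφ hc' hv x
    have h2 : Continuous fun s : ℝ => z + s • (e1 j : En n) := by fun_prop
    exact Continuous.comp (g := JJ φ (dLine (d3X j) c) v x) h1 h2
  · obtain ⟨B, hB⟩ := jj_norm (φ := φ) hK hc hv
    have hB0 : 0 ≤ B := by
      have := (norm_nonneg _).trans (hB x z)
      exact nonneg_of_mul_nonneg_right this (inv_pos.2 (jap_pos z))
    have l1 : Filter.Tendsto (fun t : ℝ => jap (z + t • e1 j)) Filter.atBot Filter.atTop := by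
      refine Filter.tendsto_atTop_mono (f := fun t : ℝ => -t - |z j|) (fun t => ?_) ?_
      · refine le_trans ?_ (norm_le_jap _)
        refine le_trans ?_ (En_coord_le _ j)
        have : (z + t • (e1 j : En n)) j = z j + t := by simp [e1]
        rw [this]
        have h1 := neg_abs_le (z j + t)
        have h2 := neg_abs_le (z j)
        have h3 := le_abs_self (z j)
        linarith
      · exact Filter.tendsto_atTop_add_const_right _ _ Filter.tendsto_neg_atBot_atTop
    have l2 := (tendsto_inv_atTop_zero.comp l1).mul_const B
    rw [zero_mul] at l2
    exact squeeze_zero_norm (fun t => hB x _) l2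

theorem toLp_update (z : Fin n → ℝ) (j : Fin n) (s : ℝ) :
    (WithLp.toLp 2 (Function.update z j s) : En n) = WithLp.toLp 2 z + (s - z j) • e1 j := by
  ext i
  by_cases h : i = j
  · subst h; simp [e1]
  · simp [e1, h]

theorem jj_update (hK : IsCompact K) (hφ : Sm φ) (hc : Dc K q c) (j : Fin n)
    (hc' : Dc K q (dLine (d3X j) c)) (hv : RD v) (x : En n) (z : Fin n → ℝ) :
    ‖JJ φ c v x (WithLp.toLp 2 z)‖ₑ ≤
      ∫⁻ s : ℝ, ‖JJ φ (dLine (d3X j) c) v x (WithLp.toLp 2 (Function.update z j s))‖ₑ := by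
  have := jj_ftc hK hφ hc j hc' hv x (WithLp.toLp 2 z) 0
  simp_rw [toLp_update]
  rw [zero_smul, add_zero] at this
  refine this.trans (le_of_eq ?_)
  exact (lintegral_sub_right_eq_self
    (fun s => ‖JJ φ (dLine (d3X j) c) v x (WithLp.toLp 2 z + s • e1 j)‖ₑ) (z j)).symm

theorem jj_all (hK : IsCompact K) (hφ : Sm φ)
    (hc : ∀ l : List (Fin n), l.length ≤ n → Dc K q (ld v3 (l.map Sum.inl) c))
    (hv : RD v) (x z : En n) :
    ‖JJ φ c v x z‖ₑ ≤ ∫⁻ z : En n, ‖JJ φ (ld v3 ((List.finRange n).map Sum.inl) c) v x z‖ₑ := by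
  classical
  have hm : ∀ l : List (Fin n), l.length ≤ n → Measurable (fun z : Fin n → ℝ =>
      ‖JJ φ (ld v3 (l.map Sum.inl) c) v x (WithLp.toLp 2 z)‖ₑ) := fun l hl => by
    refine Continuous.measurable (continuous_enorm.comp ?_)
    have h1 := jj_cont_z hK hφ (hc l hl) hv x
    have h2 : Continuous fun z : Fin n → ℝ => (WithLp.toLp 2 z : En n) :=
      PiLp.continuous_toLp 2 _
    exact Continuous.comp (g := JJ φ (ld v3 (l.map Sum.inl) c) v x) h1 h2
  have ind : ∀ l : List (Fin n), l.Nodup → ∀ z : Fin n → ℝ, ‖JJ φ c v x (WithLp.toLp 2 z)‖ₑ ≤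
      (∫⋯∫⁻_l.toFinset, (fun z : Fin n → ℝ =>
        ‖JJ φ (ld v3 (l.map Sum.inl) c) v x (WithLp.toLp 2 z)‖ₑ) ∂(fun _ => volume)) z := by
    intro l
    induction l with
    | nil => intro _ z; simp [ld]
    | cons j l ih =>
      intro hl z
      have hl' := List.nodup_cons.1 hl
      have hlen : (j :: l).length ≤ n := by
        simpa using hl.length_le_card
      have hlen' : l.length ≤ n := by simp at hlen; omega
      refine (ih hl'.2 z).trans ?_
      rw [List.toFinset_cons, lmarginal_insert' _ (hm _ hlen) (by simpa using hl'.1)]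
      refine lmarginal_mono (fun z => ?_) z
      exact jj_update hK hφ (hc l hlen') j (hc (j :: l) hlen) hv x z
  have h1 := ind (List.finRange n) (List.nodup_finRange n) (WithLp.ofLp z)
  rw [List.toFinset_finRange, lmarginal_univ] at h1
  refine h1.trans (le_of_eq ?_)
  exact (EuclideanSpace.volume_preserving_symm_measurableEquiv_toLp (Fin n)).symm.lintegral_comp_emb
    (MeasurableEquiv.measurableEmbedding _)
    (fun z : En n => ‖JJ φ (ld v3 ((List.finRange n).map Sum.inl) c) v x z‖ₑ)
end Frozen

section Rho
variable {n : ℕ} {κ : Type*}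

theorem FB.constf {W J ι F : Type*} [NormedAddCommGroup W] [NormedSpace ℝ W]
    [NormedAddCommGroup F] [NormedSpace ℝ F] {v : J → W} {g : J → W → ℝ} {N : ℕ} {w : ι → W → ℝ}
    (c : ι → F) (h1 : ∀ i z, ‖c i‖ ≤ w i z) (hg : ∀ j z, 0 ≤ g j z) :
    FB v g N w (fun i _ => c i) := by
  have hw : ∀ i z, 0 ≤ w i z := fun i z => (norm_nonneg _).trans (h1 i z)
  have h0 : ∃ C : ℝ, ∀ (i : ι) (z : W), ‖c i‖ ≤ C * w i z :=
    ⟨1, fun i z => by rw [one_mul]; exact h1 i z⟩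
  cases N with
  | zero => exact h0
  | succ N =>
    refine ⟨h0, fun j => ?_⟩
    simp only [dLine_const]
    exact FB.zero_fun (fun i z => mul_nonneg (hg j z) (hw i z)) hg

/-- dyadic-type localisation -/
def rh (R : ℝ) (x : En n) : ℝ := R * (jap x ^ (1 : ℝ) * (R ^ 2 + jap x ^ (2 : ℝ))⁻¹)

theorem rh_eq (R : ℝ) (x : En n) : rh R x = R * jap x / (R ^ 2 + jap x ^ 2) := by
  unfold rh
  rw [Real.rpow_one, Real.rpow_two]; ring

variable {R : ℝ}

theorem rh_pos (hR : 0 < R) (x : En n) : 0 < rh R x := by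
  rw [rh_eq]; have := jap_pos x; positivity

theorem rh_le_one (hR : 0 < R) (x : En n) : rh R x ≤ 1 := by
  have := jap_pos x
  rw [rh_eq, div_le_one (by positivity)]
  nlinarith [sq_nonneg (R - jap x)]

theorem rh_le_a (hR : 0 < R) (x : En n) : rh R x ≤ jap x / R := by
  have := jap_pos x
  rw [rh_eq, div_le_div_iff₀ (by positivity) hR]
  nlinarith [pow_pos this 3, mul_pos hR hR]

theorem rh_le_b (hR : 0 < R) (x : En n) : rh R x ≤ R / jap x := by
  have := jap_pos x
  rw [rh_eq, div_le_div_iff₀ (by positivity) this]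
  nlinarith [pow_pos this 3, mul_pos hR hR, pow_pos hR 3]

theorem rh_le_c (hR : 0 < R) (x : En n) : rh R x ≤ 2 * (jap (R⁻¹ • x))⁻¹ := by
  have h1 := jap_pos x
  have h2 := jap_pos (R⁻¹ • x)
  have h3 : jap (R⁻¹ • x) ≤ 1 + jap x / R := by
    refine (jap_le _).trans ?_
    rw [norm_smul, norm_inv, Real.norm_of_nonneg hR.le, div_eq_inv_mul]
    have := mul_le_mul_of_nonneg_left (norm_le_jap x) (inv_pos.2 hR).le
    linarith
  have h4 : rh R x * jap (R⁻¹ • x) ≤ 2 := by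
    have h5 := mul_le_mul_of_nonneg_left h3 (rh_pos hR x).le
    have h6 := rh_le_one hR x
    have h7 : rh R x * (jap x / R) ≤ 1 := by
      have := mul_le_mul_of_nonneg_right (rh_le_b hR x) (div_pos h1 hR).le
      refine this.trans (le_of_eq ?_)
      field_simp
    linarith
  rw [← div_eq_mul_inv, le_div_iff₀ h2]; exact h4

theorem rh_pow (hR : 0 < R) (x : En n) {s : ℝ} {d : ℕ} (hd : |s| ≤ d) : R ^ (-s) * jap x ^ s * rh R x ^ d ≤ 1 := by
  have h1 := jap_pos x
  have hp := rh_pos hR x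
  have h2 : R ^ (-s) * jap x ^ s ≤ (rh R x) ^ (-|s|) := by
    rw [Real.rpow_neg hR.le, inv_mul_eq_div, ← Real.div_rpow h1.le hR.le, Real.rpow_neg hp.le,
      ← Real.inv_rpow hp.le]
    rcases le_total 0 s with h | h
    · rw [abs_of_nonneg h]
      refine Real.rpow_le_rpow (div_pos h1 hR).le ?_ h
      rw [le_inv_comm₀ (div_pos h1 hR) hp, inv_div]
      exact rh_le_b hR x
    · rw [abs_of_nonpos h]
      have : (jap x / R) ^ s = (R / jap x) ^ (-s) := by
        rw [Real.rpow_neg (div_pos hR h1).le, ← Real.inv_rpow (div_pos hR h1).le, inv_div]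
      rw [this]
      refine Real.rpow_le_rpow (div_pos hR h1).le ?_ (by linarith)
      rw [le_inv_comm₀ (div_pos hR h1) hp, inv_div]
      exact rh_le_a hR x
  have h3 : rh R x ^ d ≤ rh R x ^ |s| := by
    rw [← Real.rpow_natCast]
    exact Real.rpow_le_rpow_of_exponent_ge hp (rh_le_one hR x) hd
  refine (mul_le_mul h2 h3 (pow_pos hp d).le (Real.rpow_pos_of_pos hp _).le).trans (le_of_eq ?_)
  rw [← Real.rpow_add hp]; simp

theorem Sm_rh (hR : 0 < R) : Sm (fun x : En n => rh R x) := by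
  unfold rh
  refine (Sm.const R).mul ((Sm_jap_rpow 1).mul (((Sm.const _).add (Sm_jap_rpow 2)).inv
    fun z => ?_))
  have := Real.rpow_pos_of_pos (jap_pos z) 2
  positivity

theorem FB_rh (N : ℕ) {R : κ → ℝ} (hR : ∀ k, 0 < R k) :
    FB e1 gj N (fun k (x : En n) => rh (R k) x) (fun k (x : En n) => rh (R k) x) := by
  have hj : ∀ (x : En n), 0 < jap x ^ (2 : ℝ) := fun x => Real.rpow_pos_of_pos (jap_pos x) 2
  have f1 : FB e1 gj N (fun k (_ : En n) => R k) (fun k (_ : En n) => R k) :=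
    FB.constf R (fun k _ => by rw [Real.norm_of_nonneg (hR k).le]) gj_nonneg
  have f2 : FB e1 gj N (fun k (x : En n) => R k ^ 2 + jap x ^ (2 : ℝ))
      (fun k (x : En n) => R k ^ 2) :=
    FB.constf (fun k => R k ^ 2) (fun k x => by
      rw [Real.norm_of_nonneg (sq_nonneg _)]; linarith [hj x]) gj_nonneg
  have f3 : FB e1 gj N (fun k (x : En n) => R k ^ 2 + jap x ^ (2 : ℝ))
      (fun (_ : κ) (x : En n) => jap x ^ (2 : ℝ)) :=
    (FB_jap (ι := κ) N 2).mono gj_nonneg (fun _ x => (hj x).le) 1 (fun k x => by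
      rw [one_mul]; linarith [sq_nonneg (R k)])
  have s1 : ∀ k : κ, Sm (fun (_ : En n) => R k ^ 2) := fun k => Sm.const _
  have s2 : ∀ _ : κ, Sm (fun (x : En n) => jap x ^ (2 : ℝ)) := fun k => Sm_jap_rpow 2
  have s3 : ∀ k : κ, Sm (fun (x : En n) => R k ^ 2 + jap x ^ (2 : ℝ)) := fun k => (s1 k).add (s2 k)
  have f4 := FB.add s1 s2 f2 f3
  have hp : ∀ (k : κ) (x : En n), 0 < R k ^ 2 + jap x ^ (2 : ℝ) := fun k x => by
    have := hj x; positivity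
  have f5 := FB.inv s3 f4 hp 1 one_pos (fun k x => by rw [one_mul])
  have s4 : ∀ k : κ, Sm (fun (x : En n) => (R k ^ 2 + jap x ^ (2 : ℝ))⁻¹) := fun k =>
    (s3 k).inv fun x => (hp k x).ne'
  have s5 : ∀ _ : κ, Sm (fun (x : En n) => jap x ^ (1 : ℝ)) := fun k => Sm_jap_rpow 1
  have f6 := FB.mul s5 s4 (FB_jap (ι := κ) N 1) f5
  have s6 : ∀ k : κ, Sm (fun (x : En n) => jap x ^ (1 : ℝ) * (R k ^ 2 + jap x ^ (2 : ℝ))⁻¹) :=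
    fun k => (s5 k).mul (s4 k)
  have s7 : ∀ k : κ, Sm (fun (_ : En n) => R k) := fun k => Sm.const _
  exact FB.mul s7 s6 f1 f6

theorem Sm_rhp (hR : 0 < R) (L : ℕ) : Sm (fun x : En n => rh R x ^ L) := ContDiff.pow (Sm_rh hR) L

theorem FB_rhp (N L : ℕ) {R : κ → ℝ} (hR : ∀ k, 0 < R k) :
    FB e1 gj N (fun k (x : En n) => rh (R k) x ^ L) (fun k (x : En n) => rh (R k) x ^ L) := by
  induction L with
  | zero =>
    simp only [pow_zero]
    exact FB.constf (fun _ => (1 : ℝ)) (fun _ _ => by simp) gj_nonneg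
  | succ L ih =>
    simp only [pow_succ]
    exact FB.mul (fun k => Sm_rhp (hR k) L) (fun k => Sm_rh (hR k)) ih (FB_rh N hR)

/-- localised amplitude -/
def am (R : ℝ) (L : ℕ) (s m : ℝ) (a : Z3 n → ℂ) (z : Z3 n) : ℂ :=
  ((R ^ (-s) * (rh R z.1 ^ L * jap z.1 ^ m) : ℝ) : ℂ) * a z

theorem Sm_am0 (hR : 0 < R) (L : ℕ) (s m : ℝ) :
    Sm (fun x : En n => R ^ (-s) * (rh R x ^ L * jap x ^ m)) :=
  (Sm.const _).mul ((Sm_rhp hR L).mul (Sm_jap_rpow m))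

theorem Sm_am (hR : 0 < R) (L : ℕ) (s m : ℝ) {a : Z3 n → ℂ} (ha : Sm a) : Sm (am R L s m a) :=
  (Sm_ofReal (Sm_am0 hR L s m).fst3).mul ha

theorem FB_am {N d L : ℕ} {R : κ → ℝ} (hR : ∀ k, 0 < R k) {p q m : ℝ} {a : κ → Z3 n → ℂ}
    (hd : |p + m| ≤ d) (hL : 2 * n + 1 + d ≤ L)
    (sa : ∀ k, Sm (a k)) (Fa : FB v3 g3 N (fun _ => w3 p q) a) :
    FB v3 g3 N (fun k z => rh (R k) z.1 ^ (2 * n + 1) * jap z.2.1 ^ q)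
      (fun k => am (R k) L (p + m) m (a k)) := by
  have f1 : FB e1 gj N (fun k (_ : En n) => R k ^ (-(p + m))) (fun k (_ : En n) => R k ^ (-(p + m))) :=
    FB.constf (fun k => R k ^ (-(p + m)))
      (fun k _ => by rw [Real.norm_of_nonneg (Real.rpow_nonneg (hR k).le _)]) gj_nonneg
  have f2 := FB.mul (fun k => Sm_rhp (hR k) L) (fun _ => Sm_jap_rpow m)
    (FB_rhp N L hR) (FB_jap (n := n) (ι := κ) N m)
  have f3 := FB.mul (fun k => Sm.const _) (fun k => (Sm_rhp (hR k) L).mul (Sm_jap_rpow m)) f1 f2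
  have hw : ∀ k (x : En n), 0 ≤ R k ^ (-(p + m)) * (rh (R k) x ^ L * jap x ^ m) := fun k x => by
    have h1 := Real.rpow_pos_of_pos (hR k) (-(p + m))
    have h2 := rh_pos (hR k) x
    have h3 := Real.rpow_pos_of_pos (jap_pos x) m
    positivity
  have f4 := FB_ofReal (fun k => (Sm_am0 (hR k) L (p + m) m).fst3)
    (FB.fst3 (fun k => Sm_am0 (hR k) L (p + m) m) f3 hw)
  have f5 := FB.mul (fun k => Sm_ofReal (Sm_am0 (hR k) L (p + m) m).fst3) sa f4 Fa
  refine f5.mono g3_nonneg (fun k z => mul_nonneg (hw k z.1) (w3_pos _ _ _).le) 1 (fun k z => ?_)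
  have h2 := rh_pos (hR k) z.1
  have h4 := Real.rpow_pos_of_pos (jap_pos z.2.1) q
  have h5 := rh_pow (hR k) z.1 hd
  have h6 := Real.rpow_pos_of_pos (hR k) (-(p + m))
  have h7 := Real.rpow_pos_of_pos (jap_pos z.1) (p + m)
  have h8 : rh (R k) z.1 ^ L ≤ rh (R k) z.1 ^ (2 * n + 1 + d) :=
    pow_le_pow_of_le_one h2.le (rh_le_one (hR k) z.1) hL
  unfold w3
  calc R k ^ (-(p + m)) * (rh (R k) z.1 ^ L * jap z.1 ^ m) * (jap z.1 ^ p * jap z.2.1 ^ q)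
      = R k ^ (-(p + m)) * rh (R k) z.1 ^ L * (jap z.1 ^ (p + m)) * jap z.2.1 ^ q := by
        rw [Real.rpow_add (jap_pos _)]; ring
    _ ≤ R k ^ (-(p + m)) * rh (R k) z.1 ^ (2 * n + 1 + d) * (jap z.1 ^ (p + m)) * jap z.2.1 ^ q := by
        gcongr
    _ = (R k ^ (-(p + m)) * jap z.1 ^ (p + m) * rh (R k) z.1 ^ d) *
          (rh (R k) z.1 ^ (2 * n + 1) * jap z.2.1 ^ q) := by rw [pow_add]; ring
    _ ≤ 1 * (rh (R k) z.1 ^ (2 * n + 1) * jap z.2.1 ^ q) :=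
        mul_le_mul_of_nonneg_right h5 (by positivity)
end Rho

section Mink

theorem cs_lint {X : Type*} [MeasurableSpace X] (μ : Measure X) {h g : X → ℝ≥0∞} (hh : AEMeasurable h μ)
    (hg : AEMeasurable g μ) : (∫⁻ z, h z * g z ∂μ) ^ 2 ≤ (∫⁻ z, h z ^ 2 ∂μ) * ∫⁻ z, g z ^ 2 ∂μ := by
  have := ENNReal.lintegral_mul_le_Lp_mul_Lq μ Real.HolderConjugate.two_two hh hg
  have h2 := pow_le_pow_left' this 2
  refine h2.trans (le_of_eq ?_)
  rw [mul_pow]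
  have e : ∀ a : ℝ≥0∞, (a ^ (1 / (2 : ℝ))) ^ 2 = a := fun a => by
    rw [← ENNReal.rpow_natCast, ← ENNReal.rpow_mul]; norm_num
  rw [e, e]
  simp

theorem mink {X : Type*} [MeasurableSpace X] (μ : Measure X) [SFinite μ] {J : X → X → ℝ≥0∞}
    (hJ : Measurable (Function.uncurry J)) {lam : X → ℝ} (hl : Measurable lam) (hp : ∀ z, 0 < lam z)
    {B : ℝ≥0∞} (hB : ∀ z, ∫⁻ x, J x z ^ 2 ∂μ ≤ B * ENNReal.ofReal (lam z) ^ 2) :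
    ∫⁻ x, (∫⁻ z, J x z ∂μ) ^ 2 ∂μ ≤ B * (∫⁻ z, ENNReal.ofReal (lam z) ∂μ) ^ 2 := by
  let h : X → ℝ≥0∞ := fun z => ENNReal.ofReal (Real.sqrt (lam z))
  have hh : Measurable h := (Real.continuous_sqrt.measurable.comp hl).ennreal_ofReal
  have h0 : ∀ z, h z ≠ 0 := fun z => (ENNReal.ofReal_pos.2 (Real.sqrt_pos.2 (hp z))).ne'
  have ht : ∀ z, h z ≠ ∞ := fun z => ENNReal.ofReal_ne_top
  have hs : ∀ z, h z ^ 2 = ENNReal.ofReal (lam z) := fun z => by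
    rw [← ENNReal.ofReal_pow (Real.sqrt_nonneg _), Real.sq_sqrt (hp z).le]
  have h1 : ∀ z, (h z)⁻¹ ^ 2 * ENNReal.ofReal (lam z) ^ 2 = ENNReal.ofReal (lam z) := fun z => by
    rw [← hs z, pow_two ((h z) ^ 2), ← mul_assoc, ← mul_pow, ENNReal.inv_mul_cancel (h0 z) (ht z)]
    simp
  have mJ : ∀ x, Measurable (J x) := fun x => hJ.comp measurable_prodMk_left
  have mJ' : ∀ z, Measurable (fun x => J x z) := fun z => hJ.comp measurable_prodMk_right
  have k1 : ∀ x, (∫⁻ z, J x z ∂μ) ^ 2 ≤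
      (∫⁻ z, ENNReal.ofReal (lam z) ∂μ) * ∫⁻ z, (h z)⁻¹ ^ 2 * J x z ^ 2 ∂μ := fun x => by
    have e1 : ∫⁻ z, J x z ∂μ = ∫⁻ z, h z * ((h z)⁻¹ * J x z) ∂μ := by
      refine lintegral_congr fun z => ?_
      rw [← mul_assoc, ENNReal.mul_inv_cancel (h0 z) (ht z), one_mul]
    have e2 := cs_lint μ hh.aemeasurable (hh.inv.mul (mJ x)).aemeasurable
    rw [e1]
    refine e2.trans (le_of_eq ?_)
    simp only [hs, Pi.mul_apply, Pi.inv_apply, mul_pow]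
  have mF : Measurable (Function.uncurry fun x z => (h z)⁻¹ ^ 2 * J x z ^ 2) :=
    Measurable.mul (M := ℝ≥0∞) ((hh.comp measurable_snd).inv.pow_const 2) (hJ.pow_const 2)
  calc ∫⁻ x, (∫⁻ z, J x z ∂μ) ^ 2 ∂μ
      ≤ ∫⁻ x, (∫⁻ z, ENNReal.ofReal (lam z) ∂μ) * ∫⁻ z, (h z)⁻¹ ^ 2 * J x z ^ 2 ∂μ ∂μ :=
        lintegral_mono k1
    _ = (∫⁻ z, ENNReal.ofReal (lam z) ∂μ) * ∫⁻ x, ∫⁻ z, (h z)⁻¹ ^ 2 * J x z ^ 2 ∂μ ∂μ :=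
        lintegral_const_mul _ mF.lintegral_prod_right'
    _ = (∫⁻ z, ENNReal.ofReal (lam z) ∂μ) * ∫⁻ z, ∫⁻ x, (h z)⁻¹ ^ 2 * J x z ^ 2 ∂μ ∂μ := by
        rw [lintegral_lintegral_swap mF.aemeasurable]
    _ ≤ (∫⁻ z, ENNReal.ofReal (lam z) ∂μ) * ∫⁻ z, B * ENNReal.ofReal (lam z) ∂μ := by
        gcongr with z
        rw [lintegral_const_mul _ ((mJ' z).pow_const 2)]
        calc _ ≤ (h z)⁻¹ ^ 2 * (B * ENNReal.ofReal (lam z) ^ 2) := by gcongr; exact hB z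
          _ = B * ((h z)⁻¹ ^ 2 * ENNReal.ofReal (lam z) ^ 2) := by ring
          _ = _ := by rw [h1]
    _ = _ := by
        rw [lintegral_const_mul _ hl.ennreal_ofReal]; ring
end Mink

section LdTools
variable {n : ℕ} {κ : Type*}

theorem FB.ld {W J ι F : Type*} [NormedAddCommGroup W] [NormedSpace ℝ W]
    [NormedAddCommGroup F] [NormedSpace ℝ F] {v : J → W} {g : J → W → ℝ} {N : ℕ} {w : ι → W → ℝ}
    {f : ι → W → F} (l : List J) (h : FB v g (N + l.length) w f) :
    FB v g N (fun i z => gl g l z * w i z) (fun i => _root_.ld v l (f i)) := by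
  induction l generalizing N with
  | nil => simpa [gl, _root_.ld] using h
  | cons j l ih =>
    have h1 : FB v g (N + 1 + l.length) w f := h.le (by simp; omega)
    have h2 := FB.dLine (ih h1) j
    refine FB.congrw h2 ?_
    intro i z
    simp [gl, mul_assoc]

theorem gl_inl (l : List (Fin n)) (z : Z3 n) :
    gl g3 (l.map Sum.inl) z = ((jap z.1)⁻¹) ^ l.length := by
  induction l with
  | nil => simp [gl]
  | cons j l ih =>
    simp only [gl, List.map_cons, List.prod_cons] at ih ⊢
    rw [ih, List.length_cons, pow_succ, mul_comm]
    rfl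

theorem Vn3.ld {K : Set (En n)} (hK : IsCompact K) {b : Z3 n → ℂ} (h : Vn3 K b)
    (l : List (Fin n ⊕ (Fin n ⊕ Fin n))) : Vn3 K (_root_.ld v3 l b) := by
  induction l with
  | nil => exact h
  | cons j l ih => exact Vn3.dLine hK ih _

theorem Dc_ld {N d L : ℕ} {R : κ → ℝ} (hR : ∀ k, 0 < R k) {p q m : ℝ} {a : κ → Z3 n → ℂ}
    {K : κ → Set (En n)} (hK : ∀ k, IsCompact (K k))
    (hd : |p + m| ≤ d) (hL : 2 * n + 1 + d ≤ L)
    (sa : ∀ k, Sm (a k)) (va : ∀ k, Vn3 (K k) (a k)) (Fa : FB v3 g3 N (fun _ => w3 p q) a)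
    (hN : n ≤ N) (k : κ) (l : List (Fin n)) (hl : l.length ≤ n) :
    Dc (K k) q (ld v3 (l.map Sum.inl) (am (R k) L (p + m) m (a k))) := by
  have f1 := FB_am hR hd hL sa Fa
  have f2 : FB v3 g3 (0 + (l.map (Sum.inl (β := Fin n ⊕ Fin n))).length) _ _ :=
    f1.le (by simp; omega)
  have f3 := FB.ld _ f2
  have hw : ∀ k (z : Z3 n), 0 ≤ rh (R k) z.1 ^ (2 * n + 1) * jap z.2.1 ^ q := fun k z =>
    mul_nonneg (pow_nonneg (rh_pos (hR k) _).le _) (Real.rpow_nonneg (jap_pos _).le _)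
  obtain ⟨C, hC, hb⟩ := f3.bound (fun k z => by
    rw [gl_inl]; exact mul_nonneg (pow_nonneg (inv_nonneg.2 (jap_pos _).le) _) (hw k z))
  refine ⟨(Sm_am (hR k) L _ m (sa k)).ld, Vn3.ld (hK k) ((va k).mul _) _,
    C * R k, (mul_pos hC (hR k)).le, fun z => (hb k z).trans ?_⟩
  rw [gl_inl]
  have h1 : (jap z.1)⁻¹ ^ l.length ≤ 1 :=
    pow_le_one₀ (inv_nonneg.2 (jap_pos _).le) (inv_le_one_of_one_le₀ (jap_one_le _))
  have h2 : rh (R k) z.1 ^ (2 * n + 1) ≤ R k * (jap z.1)⁻¹ := by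
    refine (pow_le_of_le_one (rh_pos (hR k) _).le (rh_le_one (hR k) _) (by omega)).trans ?_
    exact rh_le_b (hR k) z.1
  have h3 := Real.rpow_nonneg (jap_pos z.2.1).le q
  calc C * ((jap z.1)⁻¹ ^ l.length * (rh (R k) z.1 ^ (2 * n + 1) * jap z.2.1 ^ q))
      ≤ C * (1 * (R k * (jap z.1)⁻¹ * jap z.2.1 ^ q)) := by
        refine mul_le_mul_of_nonneg_left ?_ hC.le
        exact mul_le_mul h1 (mul_le_mul_of_nonneg_right h2 h3) (hw k z) zero_le_one
    _ = _ := by ring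

theorem JJ_iter {K : Set (En n)} {q : ℝ} {v : En n → ℂ} {c : Z3 n → ℂ} {φ : En n × En n → ℝ}
    (hK : IsCompact K) (hφ : Sm φ) (hc : Dc K q c) (hv : RD v) (x z : En n) :
    JJ φ c v x z = ∫ ξ, ∫ y, ex (Psi φ (x, y, ξ)) * c (z, y, ξ) * v y :=
  integral_prod _ (jj_int hK hφ hc hv x z)

theorem JJ_Ft {K : Set (En n)} {q : ℝ} {v : En n → ℂ} {c : Z3 n → ℂ} {φ : En n × En n → ℝ}
    (hK : IsCompact K) (hφ : Sm φ) (hc : Dc K q c) (hv : RD v) (x z : En n) :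
    JJ φ c v x z = Ft (So φ (fun p => c (z, p)) v) x := by
  rw [JJ_iter hK hφ hc hv]
  unfold Ft So
  refine integral_congr_ae (Filter.Eventually.of_forall fun ξ => ?_)
  simp only
  rw [← integral_const_mul]
  refine integral_congr_ae (Filter.Eventually.of_forall fun y => ?_)
  simp only [Psi, ex_add]
  ring

theorem JJ_am {K : Set (En n)} {q R s m : ℝ} {L : ℕ} {v : En n → ℂ} {a : Z3 n → ℂ}
    {φ : En n × En n → ℝ}
    (hK : IsCompact K) (hφ : Sm φ) (hc : Dc K q (am R L s m a)) (hv : RD v) (x : En n) :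
    JJ φ (am R L s m a) v x x =
      ((R ^ (-s) : ℝ) : ℂ) * (((rh R x ^ L * jap x ^ m : ℝ) : ℂ) * TT φ a v x) := by
  rw [JJ_iter hK hφ hc hv]
  unfold TT
  rw [← mul_assoc, ← integral_const_mul]
  refine integral_congr_ae (Filter.Eventually.of_forall fun ξ => ?_)
  simp only
  rw [← integral_const_mul]
  refine integral_congr_ae (Filter.Eventually.of_forall fun y => ?_)
  simp only [am]
  push_cast
  ring

/-- dominated amplitude size -/
def lmw (R : ℝ) (z : En n) : ℝ := ((jap z)⁻¹) ^ n * rh R z ^ (2 * n + 1)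

theorem lmw_pos {R : ℝ} (hR : 0 < R) (z : En n) : 0 < lmw R z :=
  mul_pos (pow_pos (inv_pos.2 (jap_pos z)) _) (pow_pos (rh_pos hR z) _)

theorem lmw_meas {R : ℝ} (hR : 0 < R) : Measurable (lmw (n := n) R) := by
  unfold lmw
  exact ((jap_cont.inv₀ fun z => (jap_pos z).ne').pow n |>.mul ((Sm_rh hR).cont.pow _)).measurable

theorem lmw_int : ∃ I : ℝ, 0 < I ∧ ∀ R : ℝ, 0 < R →
    ∫⁻ z : En n, ENNReal.ofReal (lmw R z) ≤ ENNReal.ofReal I := by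
  let w : En n → ℝ := fun z => 2 ^ (n + 1) * jap (z - 0) ^ (-((n : ℝ) + 1))
  have iw : Integrable w := (integrable_jap (by linarith) 0).const_mul _
  have w0 : ∀ z, 0 ≤ w z := fun z => mul_nonneg (by positivity) (Real.rpow_nonneg (jap_pos _).le _)
  have wi : 0 ≤ ∫ z, w z := integral_nonneg (f := w) (fun z => w0 z)
  refine ⟨(∫ z, w z) + 1, by linarith, fun R hR => ?_⟩
  have mw : Measurable (fun z => ENNReal.ofReal (w z)) := by
    refine Measurable.ennreal_ofReal (Continuous.measurable ?_)
    exact continuous_const.mul ((Sm_jap_rpow (n := n) (-((n : ℝ) + 1))).cont.comp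
      (continuous_id.sub continuous_const))
  have h1 : ∀ z : En n, lmw R z ≤ (R ^ n)⁻¹ * w (R⁻¹ • z) := fun z => by
    have a1 : ((jap z)⁻¹) ^ n * rh R z ^ n ≤ (R ^ n)⁻¹ := by
      rw [← mul_pow, ← inv_pow]
      refine pow_le_pow_left₀ (mul_nonneg (inv_nonneg.2 (jap_pos z).le) (rh_pos hR z).le) ?_ n
      have := mul_le_mul_of_nonneg_left (rh_le_a hR z) (inv_nonneg.2 (jap_pos z).le)
      refine this.trans (le_of_eq ?_)
      have := (jap_pos z).ne'
      field_simp
    have a2 : rh R z ^ (n + 1) ≤ w (R⁻¹ • z) := by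
      refine (pow_le_pow_left₀ (rh_pos hR z).le (rh_le_c hR z) (n + 1)).trans (le_of_eq ?_)
      simp only [w, sub_zero]
      rw [mul_pow, Real.rpow_neg (jap_pos _).le, inv_pow, ← Real.rpow_natCast (jap _)]
      push_cast
      rfl
    have e : lmw R z = (((jap z)⁻¹) ^ n * rh R z ^ n) * rh R z ^ (n + 1) := by
      unfold lmw; rw [show 2 * n + 1 = n + (n + 1) by ring, pow_add]; ring
    rw [e]
    exact mul_le_mul a1 a2 (pow_nonneg (rh_pos hR z).le _) (by positivity)
  calc ∫⁻ z : En n, ENNReal.ofReal (lmw R z)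
      ≤ ∫⁻ z : En n, ENNReal.ofReal ((R ^ n)⁻¹) * ENNReal.ofReal (w (R⁻¹ • z)) := by
        refine lintegral_mono fun z => ?_
        rw [← ENNReal.ofReal_mul (by positivity)]
        exact ENNReal.ofReal_le_ofReal (h1 z)
    _ = ENNReal.ofReal ((R ^ n)⁻¹) * (ENNReal.ofReal |((R⁻¹) ^ n)⁻¹| *
          ∫⁻ z, ENNReal.ofReal (w z)) := by
        rw [lintegral_const_mul' _ _ ENNReal.ofReal_ne_top]
        congr 1
        exact lint_scale mw (inv_ne_zero hR.ne')
    _ = ENNReal.ofReal (∫ z, w z) := by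
        rw [← mul_assoc, ← ENNReal.ofReal_mul (by positivity),
          ofReal_integral_eq_lintegral_ofReal iw (Filter.Eventually.of_forall w0)]
        have : (R ^ n)⁻¹ * |((R⁻¹) ^ n)⁻¹| = 1 := by
          rw [inv_pow, inv_inv, abs_of_pos (by positivity)]
          field_simp
        rw [this]; simp
    _ ≤ _ := ENNReal.ofReal_le_ofReal (by linarith)
end LdTools

section StageX
variable {n : ℕ} {κ : Type*}

theorem So_memLp' {K : Set (En n)} {q B : ℝ} {v : En n → ℂ} {b : En n × En n → ℂ}
    {φ : En n × En n → ℝ} (hK : IsCompact K) (hφ : Continuous φ) (sb : Sm b) (vb : Vn K b)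
    (hB : ∀ z, ‖b z‖ ≤ B * jap z.1 ^ q) (hv : RD v) (r : ℝ≥0∞) : MemLp (So φ b v) r := by
  have sj : Sm (fun z : En n × En n => ((jap (z.1 - 0) ^ (-q) : ℝ) : ℂ)) :=
    Sm_ofReal (Sm_japY (-q) 0)
  have hA : Am K (fun z => ((jap (z.1 - 0) ^ (-q) : ℝ) : ℂ) * b z) := by
    refine ⟨(sj.mul sb).cont, ⟨B, fun z => ?_⟩, vb.mul _⟩
    rw [norm_mul, Complex.norm_real, Real.norm_of_nonneg (Real.rpow_nonneg (jap_pos _).le _),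
      sub_zero]
    have := mul_le_mul_of_nonneg_left (hB z) (Real.rpow_nonneg (jap_pos z.1).le (-q))
    refine this.trans (le_of_eq ?_)
    rw [Real.rpow_neg (jap_pos _).le]
    have := (Real.rpow_pos_of_pos (jap_pos z.1) q).ne'
    field_simp
  have := So_memLp hK hφ hA (hv.i1 q) r
  convert this using 1
  funext ξ
  unfold So
  refine integral_congr_ae (Filter.Eventually.of_forall fun y => ?_)
  simp only [sub_zero]
  have e : ((jap y ^ (-q) : ℝ) : ℂ) * ((jap y ^ q : ℝ) : ℂ) = 1 := by
    rw [← Complex.ofReal_mul, ← Real.rpow_add (jap_pos _)]; simp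
  linear_combination (-(ex (φ (y, ξ)) * b (y, ξ) * v y)) * e

theorem slice {N : ℕ} {w : κ → Z3 n → ℝ} {c : κ → Z3 n → ℂ} (hc : ∀ k, Sm (c k))
    (hw : ∀ k z, 0 ≤ w k z) (h : FB v3 g3 N w c) :
    FB v2 g1 N (fun (k : κ × En n) z => w k.1 (k.2, z)) (fun (k : κ × En n) z => c k.1 (k.2, z)) := by
  have hA : ∀ (k : κ × En n) (z : En n × En n), HasFDerivAt (fun z : En n × En n => (k.2, z))
      (ContinuousLinearMap.inr ℝ (En n) (En n × En n)) z := fun k z =>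
    hasFDerivAt_prodMk_right k.2 z
  have hσ : ∀ j : Fin n ⊕ Fin n, (ContinuousLinearMap.inr ℝ (En n) (En n × En n)) (v2 j) =
      v3 (Sum.inr j) := fun j => by
    rcases j with j | j
    · simp [v2, v3, dX, d3Y]
    · simp [v2, v3, dY, d3Xi]
  have hgg : ∀ (k : κ × En n) (j : Fin n ⊕ Fin n) (z : En n × En n),
      g3 (Sum.inr j) (k.2, z) ≤ g1 j z := fun k j z => le_refl (1 : ℝ)
  exact FB.comp (v' := v2) (g' := g1) hc h hw g3_nonneg g1_nonneg (fun k : κ × En n => k.1)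
    (fun k z => (k.2, z)) (ContinuousLinearMap.inr ℝ (En n) (En n × En n)) hA Sum.inr hσ hgg

theorem stageX {d L : ℕ} {R : κ → ℝ} (hR : ∀ k, 0 < R k) {p q m : ℝ} {a : κ → Z3 n → ℂ}
    {K : κ → Set (En n)} (hK : ∀ k, IsCompact (K k)) {φ : κ → En n × En n → ℝ}
    (hφ : Ph (2 * n + 3) φ) (hd : |p + m| ≤ d) (hL : 2 * n + 1 + d ≤ L)
    (sa : ∀ k, Sm (a k)) (va : ∀ k, Vn3 (K k) (a k))
    (Fa : FB v3 g3 (3 * n + 2) (fun _ => w3 p q) a) :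
    ∃ C : ℝ, 0 < C ∧ ∀ k v, RD v →
      ∫⁻ x, ‖((rh (R k) x ^ L * jap x ^ m : ℝ) : ℂ) * TT (φ k) (a k) v x‖ₑ ^ 2 ≤
        ENNReal.ofReal (C * R k ^ (p + m)) ^ 2 *
          ∫⁻ y, ‖((jap y ^ q : ℝ) : ℂ) * v y‖ₑ ^ 2 := by
  let c : κ → Z3 n → ℂ := fun k => ld v3 ((List.finRange n).map Sum.inl) (am (R k) L (p + m) m (a k))
  have sc : ∀ k, Sm (c k) := fun k => (Sm_am (hR k) L _ m (sa k)).ld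
  have vc : ∀ k, Vn3 (K k) (c k) := fun k => Vn3.ld (hK k) ((va k).mul _) _
  have dc := Dc_ld hR hK hd hL sa va Fa (by omega)
  have dcc : ∀ k, Dc (K k) q (c k) := fun k => dc k (List.finRange n) (by simp)
  have Fc : FB v3 g3 (2 * n + 2) (fun k z => lmw (R k) z.1 * jap z.2.1 ^ q) c := by
    have f1 := FB_am hR hd hL sa Fa
    have f2 : FB v3 g3 (2 * n + 2 +
      ((List.finRange n).map (Sum.inl (β := Fin n ⊕ Fin n))).length) _ _ := f1.le (by simp; omega)
    refine (FB.ld _ f2).congrw fun k z => ?_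
    rw [gl_inl, List.length_finRange]
    unfold lmw
    ring
  have hw : ∀ k (z : Z3 n), 0 ≤ lmw (R k) z.1 * jap z.2.1 ^ q := fun k z =>
    mul_nonneg (lmw_pos (hR k) _).le (Real.rpow_nonneg (jap_pos _).le _)
  have Fs := slice sc hw Fc
  have ss : ∀ k : κ × En n, Sm (fun z : En n × En n => c k.1 (k.2, z)) := fun k =>
    (sc k.1).compA (fun z => hasFDerivAt_prodMk_right k.2 z)
  have vs : ∀ k : κ × En n, Vn (K k.1) (fun z : En n × En n => c k.1 (k.2, z)) := fun k y ξ hξ =>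
    vc k.1 k.2 y ξ hξ
  obtain ⟨C, hC, H⟩ := Y3q (le_refl _) (hφ.reindex (fun k : κ × En n => k.1)) ss
    (fun k => hK k.1) vs (fun k : κ × En n => (lmw_pos (hR k.1) k.2).le) Fs
  obtain ⟨B, hB, hFs⟩ := Fs.bound (fun k z => hw k.1 (k.2, z))
  obtain ⟨I, hI, hlI⟩ := lmw_int (n := n)
  have hpi : (0 : ℝ) < (2 * π) ^ n := by positivity
  refine ⟨Real.sqrt ((2 * π) ^ n) * C * I, by positivity, fun k v hv => ?_⟩
  set V := ∫⁻ y, ‖((jap y ^ q : ℝ) : ℂ) * v y‖ₑ ^ 2 with hV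
  have sφ := (hφ.sm k)
  have e1 : ∀ z, ∫⁻ x, ‖JJ (φ k) (c k) v x z‖ₑ ^ 2 ≤
      (ENNReal.ofReal ((2 * π) ^ n) * ENNReal.ofReal C ^ 2 * V) *
        ENNReal.ofReal (lmw (R k) z) ^ 2 := fun z => by
    have hb : ∀ p : En n × En n, ‖c k (z, p)‖ ≤ (B * lmw (R k) z) * jap p.1 ^ q := fun p =>
      (hFs (k, z) p).trans (le_of_eq (by ring))
    have m1 : ∀ r, MemLp (So (φ k) (fun p => c k (z, p)) v) r := fun r =>
      So_memLp' (hK k) sφ.cont (ss (k, z)) (vs (k, z)) hb hv r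
    simp_rw [fun x => JJ_Ft (hK k) sφ (dcc k) hv x z]
    rw [planch (memLp_one_iff_integrable.1 (m1 1)) (m1 2)]
    have h1 := pow_le_pow_left' (H (k, z) v hv) 2
    rw [mul_pow, eL_sq (fun y => ((jap y ^ q : ℝ) : ℂ) * v y), ← hV, ENNReal.ofReal_mul hC.le,
      mul_pow] at h1
    refine (mul_le_mul_right h1 _).trans (le_of_eq ?_)
    ring
  have mJ : Measurable (Function.uncurry fun x z => ‖JJ (φ k) (c k) v x z‖ₑ) :=
    (jj_cont (hK k) sφ (dcc k) hv).measurable.enorm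
  have e2 := mink volume mJ (lmw_meas (hR k)) (lmw_pos (hR k)) e1
  have e3 : ∀ x, ‖JJ (φ k) (am (R k) L (p + m) m (a k)) v x x‖ₑ ≤
      ∫⁻ z, ‖JJ (φ k) (c k) v x z‖ₑ := fun x => jj_all (hK k) sφ (dc k) hv x x
  have d0 : Dc (K k) q (am (R k) L (p + m) m (a k)) := dc k [] (by simp)
  have hRp := Real.rpow_pos_of_pos (hR k) (p + m)
  have e4 : ∀ x, ‖((rh (R k) x ^ L * jap x ^ m : ℝ) : ℂ) * TT (φ k) (a k) v x‖ₑ =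
      ENNReal.ofReal (R k ^ (p + m)) * ‖JJ (φ k) (am (R k) L (p + m) m (a k)) v x x‖ₑ := fun x => by
    rw [JJ_am (hK k) sφ d0 hv x]
    generalize ((rh (R k) x ^ L * jap x ^ m : ℝ) : ℂ) * TT (φ k) (a k) v x = Q
    rw [enorm_mul, ← mul_assoc, ← ofReal_norm ((R k ^ (-(p + m)) : ℝ) : ℂ), Complex.norm_real,
      Real.norm_of_nonneg (Real.rpow_nonneg (hR k).le _), ← ENNReal.ofReal_mul hRp.le,
      ← Real.rpow_add (hR k)]
    simp
  calc ∫⁻ x, ‖((rh (R k) x ^ L * jap x ^ m : ℝ) : ℂ) * TT (φ k) (a k) v x‖ₑ ^ 2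
      ≤ ∫⁻ x, ENNReal.ofReal (R k ^ (p + m)) ^ 2 * (∫⁻ z, ‖JJ (φ k) (c k) v x z‖ₑ) ^ 2 := by
        refine lintegral_mono fun x => ?_
        simp only
        rw [e4, mul_pow]
        exact mul_le_mul_right (pow_le_pow_left' (e3 x) 2) _
    _ = ENNReal.ofReal (R k ^ (p + m)) ^ 2 * ∫⁻ x, (∫⁻ z, ‖JJ (φ k) (c k) v x z‖ₑ) ^ 2 :=
        lintegral_const_mul' _ _ (ENNReal.pow_ne_top ENNReal.ofReal_ne_top)
    _ ≤ ENNReal.ofReal (R k ^ (p + m)) ^ 2 * ((ENNReal.ofReal ((2 * π) ^ n) *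
          ENNReal.ofReal C ^ 2 * V) * ENNReal.ofReal I ^ 2) := by
        refine mul_le_mul_right (e2.trans ?_) _
        exact mul_le_mul_right (pow_le_pow_left' (hlI (R k) (hR k)) 2) _
    _ = _ := by
        clear e2 e1
        generalize (2 * π) ^ n = P at hpi ⊢
        rw [ENNReal.ofReal_mul (by positivity), ENNReal.ofReal_mul (by positivity),
          ENNReal.ofReal_mul (by positivity), mul_pow, mul_pow, mul_pow,
          ← ENNReal.ofReal_pow (Real.sqrt_nonneg _), Real.sq_sqrt hpi.le]
        ring
end StageX

section TTprop
variable {n : ℕ}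

theorem RD.ind {v : En n → ℂ} (hv : RD v) {S : Set (En n)} (hS : MeasurableSet S) :
    RD (S.indicator v) := by
  have e : ∀ q : ℝ, (fun y => ((jap y ^ q : ℝ) : ℂ) * S.indicator v y) =
      S.indicator (fun y => ((jap y ^ q : ℝ) : ℂ) * v y) := fun q => by
    funext y
    by_cases h : y ∈ S <;> simp [h]
  exact ⟨hv.ms.indicator hS, fun q => by rw [e]; exact (hv.i1 q).indicator hS,
    fun q => by rw [e]; exact (hv.i2 q).indicator hS⟩

variable {φ : En n × En n → ℝ} {a : Z3 n → ℂ} {K : Set (En n)} {C p q : ℝ} {v : En n → ℂ}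

theorem TT_int (hφ : Sm φ) (sa : Sm a) (hK : IsCompact K) (va : Vn3 K a)
    (hC : ∀ z, ‖a z‖ ≤ C * w3 p q z) (hv : RD v) (x : En n) :
    Integrable (fun s : En n × En n => ex (Psi φ (x, s.2, s.1)) * a (x, s.2, s.1) * v s.2) := by
  refine (dm_int (q := q) (B := C * jap x ^ p) hK hv).mono' (jj_asm hφ sa hv x x)
    (Filter.Eventually.of_forall fun s => ?_)
  unfold dm
  rw [norm_mul, norm_mul, norm_ex, one_mul, norm_mul, Complex.norm_real, Real.norm_of_nonneg
    (Real.rpow_nonneg (jap_pos _).le _)]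
  by_cases h : s.1 ∈ K
  · simp only [h, Set.indicator_of_mem]
    have := mul_le_mul_of_nonneg_right (hC (x, s.2, s.1)) (norm_nonneg (v s.2))
    refine this.trans (le_of_eq ?_)
    unfold w3
    ring
  · simp [va x s.2 s.1 h, h]

theorem TT_prod (hφ : Sm φ) (sa : Sm a) (hK : IsCompact K) (va : Vn3 K a)
    (hC : ∀ z, ‖a z‖ ≤ C * w3 p q z) (hv : RD v) (x : En n) :
    TT φ a v x = ∫ s : En n × En n, ex (Psi φ (x, s.2, s.1)) * a (x, s.2, s.1) * v s.2 :=
  (integral_prod _ (TT_int hφ sa hK va hC hv x)).symm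

theorem TT_meas (hφ : Sm φ) (sa : Sm a) (hK : IsCompact K) (va : Vn3 K a)
    (hC : ∀ z, ‖a z‖ ≤ C * w3 p q z) (hv : RD v) : Measurable (TT φ a v) := by
  have e : TT φ a v = fun x => ∫ s : En n × En n,
      ex (Psi φ (x, s.2, s.1)) * a (x, s.2, s.1) * v s.2 := by
    funext x; exact TT_prod hφ sa hK va hC hv x
  rw [e]
  have cc : Continuous (fun t : En n × (En n × En n) => ((t.1, t.2.2, t.2.1) : Z3 n)) := by fun_prop
  have c1 : Continuous (fun t : En n × (En n × En n) =>
      ex (Psi φ (t.1, t.2.2, t.2.1)) * a (t.1, t.2.2, t.2.1)) :=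
    (ex_cont.comp ((Sm_Psi hφ).cont.comp cc)).mul (sa.cont.comp cc)
  have m2 : Measurable (fun t : En n × (En n × En n) => v t.2.2) :=
    hv.ms.comp (measurable_snd.comp measurable_snd)
  have m1 : StronglyMeasurable (fun t : En n × (En n × En n) =>
      ex (Psi φ (t.1, t.2.2, t.2.1)) * a (t.1, t.2.2, t.2.1) * v t.2.2) :=
    (c1.measurable.mul m2).stronglyMeasurable
  exact (m1.integral_prod_right').measurable

theorem TT_split (hφ : Sm φ) (sa : Sm a) (hK : IsCompact K) (va : Vn3 K a)
    (hC : ∀ z, ‖a z‖ ≤ C * w3 p q z) (hv : RD v) {S : Set (En n)} (hS : MeasurableSet S) (x : En n) :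
    TT φ a v x = TT φ a (S.indicator v) x + TT φ a (Sᶜ.indicator v) x := by
  rw [TT_prod hφ sa hK va hC hv, TT_prod hφ sa hK va hC (hv.ind hS),
    TT_prod hφ sa hK va hC (hv.ind hS.compl),
    ← integral_add (TT_int hφ sa hK va hC (hv.ind hS) x) (TT_int hφ sa hK va hC (hv.ind hS.compl) x)]
  refine integral_congr_ae (Filter.Eventually.of_forall fun s => ?_)
  simp only
  rw [← mul_add]
  congr 1
  by_cases h : s.2 ∈ S <;> simp [h]

end TTprop

section Kern
variable {n : ℕ}

theorem rh_ge {R : ℝ} (x : En n) (h1 : jap x < R) (h2 : R ≤ 2 * jap x) : 1 / 5 ≤ rh R x := by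
  have := jap_pos x
  rw [rh_eq, div_le_div_iff₀ (by norm_num) (by positivity)]
  nlinarith

theorem kerLow (L : ℕ) (x : En n) :
    ENNReal.ofReal ((1 / 5) ^ (2 * L) / 2) ≤
      ∫⁻ R in Set.Ioi (0 : ℝ), ENNReal.ofReal (R⁻¹ * rh R x ^ (2 * L)) := by
  have hs := jap_pos x
  have h1 : ∫⁻ R in Set.Ioc (jap x) (2 * jap x), ENNReal.ofReal ((2 * jap x)⁻¹ * (1 / 5) ^ (2 * L)) ≤
      ∫⁻ R in Set.Ioi (0 : ℝ), ENNReal.ofReal (R⁻¹ * rh R x ^ (2 * L)) := by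
    refine le_trans (setLIntegral_mono' measurableSet_Ioc fun R hR => ?_)
      (lintegral_mono_set (fun R hR => hs.trans hR.1))
    have hR0 : 0 < R := hs.trans hR.1
    refine ENNReal.ofReal_le_ofReal (mul_le_mul ?_ ?_ (by positivity) (by positivity))
    · exact inv_anti₀ hR0 hR.2
    · exact pow_le_pow_left₀ (by norm_num) (rh_ge x hR.1 hR.2) _
  refine le_trans (le_of_eq ?_) h1
  rw [setLIntegral_const, Real.volume_Ioc, ← ENNReal.ofReal_mul (by positivity)]
  congr 1
  field_simp
  ring

theorem kerUp (x : En n) :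
    ∫⁻ R in Set.Ioi (0 : ℝ), ENNReal.ofReal (R⁻¹ * rh R x ^ 2) ≤ ENNReal.ofReal 2 := by
  have hs := jap_pos x
  have hu : Set.Ioi (0 : ℝ) = Set.Ioc 0 (jap x) ∪ Set.Ioi (jap x) :=
    (Set.Ioc_union_Ioi_eq_Ioi hs.le).symm
  rw [hu]
  refine (lintegral_union_le _ _ _).trans ?_
  have h1 : ∫⁻ R in Set.Ioc 0 (jap x), ENNReal.ofReal (R⁻¹ * rh R x ^ 2) ≤ ENNReal.ofReal 1 := by
    calc _ ≤ ∫⁻ R in Set.Ioc 0 (jap x), ENNReal.ofReal ((jap x)⁻¹) := by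
          refine setLIntegral_mono' measurableSet_Ioc fun R hR => ENNReal.ofReal_le_ofReal ?_
          have a1 := pow_le_pow_left₀ (rh_pos hR.1 x).le (rh_le_b hR.1 x) 2
          have a2 := mul_le_mul_of_nonneg_left a1 (inv_pos.2 hR.1).le
          refine a2.trans ?_
          have e : R⁻¹ * (R / jap x) ^ 2 = (jap x)⁻¹ * (R / jap x) := by
            have := hR.1.ne'
            field_simp
          rw [e]
          exact mul_le_of_le_one_right (inv_pos.2 hs).le ((div_le_one hs).2 hR.2)
      _ = _ := by
          rw [setLIntegral_const, Real.volume_Ioc, ← ENNReal.ofReal_mul (by positivity), sub_zero,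
            inv_mul_cancel₀ hs.ne']
  have h2 : ∫⁻ R in Set.Ioi (jap x), ENNReal.ofReal (R⁻¹ * rh R x ^ 2) ≤ ENNReal.ofReal 1 := by
    calc _ ≤ ∫⁻ R in Set.Ioi (jap x), ENNReal.ofReal (jap x ^ 2 * R ^ (-3 : ℝ)) := by
          refine setLIntegral_mono' measurableSet_Ioi fun R hR => ENNReal.ofReal_le_ofReal ?_
          have hR0 : 0 < R := hs.trans hR
          have a1 := pow_le_pow_left₀ (rh_pos hR0 x).le (rh_le_a hR0 x) 2
          have a2 := mul_le_mul_of_nonneg_left a1 (inv_pos.2 hR0).le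
          refine a2.trans (le_of_eq ?_)
          rw [Real.rpow_neg hR0.le, show (3 : ℝ) = ((3 : ℕ) : ℝ) by norm_num, Real.rpow_natCast]
          field_simp
      _ = ENNReal.ofReal (∫ R in Set.Ioi (jap x), jap x ^ 2 * R ^ (-3 : ℝ)) := by
          refine (ofReal_integral_eq_lintegral_ofReal
            ((integrableOn_Ioi_rpow_of_lt (by norm_num) hs).const_mul _) ?_).symm
          refine (ae_restrict_iff' measurableSet_Ioi).2 (Filter.Eventually.of_forall fun R hR => ?_)
          have hR0 : 0 < R := hs.trans hR
          have := Real.rpow_pos_of_pos hR0 (-3)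
          simp only [Pi.zero_apply]
          positivity
      _ ≤ _ := by
          refine ENNReal.ofReal_le_ofReal ?_
          rw [integral_const_mul, integral_Ioi_rpow_of_lt (by norm_num) hs,
            show (-3 + 1 : ℝ) = -((2 : ℕ) : ℝ) by norm_num, Real.rpow_neg hs.le, Real.rpow_natCast]
          field_simp
          norm_num
  refine (add_le_add h1 h2).trans (le_of_eq ?_)
  rw [← ENNReal.ofReal_add (by norm_num) (by norm_num)]; norm_num

theorem ker_meas (L : ℕ) : Measurable (fun t : En n × ℝ => ENNReal.ofReal (t.2⁻¹ * rh t.2 t.1 ^ L)) := by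
  have h1 : Measurable (fun t : En n × ℝ => jap t.1) := jap_cont.measurable.comp measurable_fst
  simp only [rh_eq]
  exact (measurable_snd.inv.mul (((measurable_snd.mul h1).div
    ((measurable_snd.pow_const 2).add (h1.pow_const 2))).pow_const L)).ennreal_ofReal

theorem tonelli_sum {F G : En n → ℝ≥0∞} (hF : Measurable F) (hG : Measurable G) (L : ℕ) {B : ℝ≥0∞}
    (H : ∀ R : ℝ, 0 < R → ∫⁻ x, ENNReal.ofReal (rh R x ^ (2 * L)) * F x ≤
      B * ∫⁻ y, ENNReal.ofReal (rh R y ^ 2) * G y) :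
    ENNReal.ofReal ((1 / 5) ^ (2 * L) / 2) * ∫⁻ x, F x ≤ B * (ENNReal.ofReal 2 * ∫⁻ y, G y) := by
  have mF : ∀ (L : ℕ) {F : En n → ℝ≥0∞}, Measurable F → Measurable (Function.uncurry
      fun (x : En n) (R : ℝ) => ENNReal.ofReal (R⁻¹ * rh R x ^ L) * F x) := fun L F hF =>
    Measurable.mul (M := ℝ≥0∞) (ker_meas L) (hF.comp measurable_fst)
  have kl : ∀ (L : ℕ) {F : En n → ℝ≥0∞}, Measurable F →
      ∫⁻ x, (∫⁻ R in Set.Ioi (0 : ℝ), ENNReal.ofReal (R⁻¹ * rh R x ^ L)) * F x =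
      ∫⁻ R in Set.Ioi (0 : ℝ), ENNReal.ofReal (R⁻¹) * ∫⁻ x, ENNReal.ofReal (rh R x ^ L) * F x := by
    intro L F hF
    have m0 : ∀ x : En n, Measurable (fun R : ℝ => ENNReal.ofReal (R⁻¹ * rh R x ^ L)) := fun x =>
      (ker_meas L).comp measurable_prodMk_left
    calc _ = ∫⁻ x, ∫⁻ R in Set.Ioi (0 : ℝ), ENNReal.ofReal (R⁻¹ * rh R x ^ L) * F x := by
          refine lintegral_congr fun x => ?_
          rw [lintegral_mul_const _ (m0 x)]
      _ = ∫⁻ R in Set.Ioi (0 : ℝ), ∫⁻ x, ENNReal.ofReal (R⁻¹ * rh R x ^ L) * F x :=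
          lintegral_lintegral_swap (mF L hF).aemeasurable
      _ = _ := by
          refine setLIntegral_congr_fun measurableSet_Ioi fun R hR => ?_
          have hR' : (0 : ℝ) < R := hR
          rw [← lintegral_const_mul' _ _ ENNReal.ofReal_ne_top]
          refine lintegral_congr fun x => ?_
          rw [ENNReal.ofReal_mul (inv_pos.2 hR').le, mul_assoc]
  calc _ = ∫⁻ x, ENNReal.ofReal ((1 / 5) ^ (2 * L) / 2) * F x :=
        (lintegral_const_mul' _ _ ENNReal.ofReal_ne_top).symm
    _ ≤ ∫⁻ x, (∫⁻ R in Set.Ioi (0 : ℝ), ENNReal.ofReal (R⁻¹ * rh R x ^ (2 * L))) * F x :=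
        lintegral_mono fun x => mul_le_mul_left (kerLow L x) _
    _ = ∫⁻ R in Set.Ioi (0 : ℝ), ENNReal.ofReal (R⁻¹) *
          ∫⁻ x, ENNReal.ofReal (rh R x ^ (2 * L)) * F x := kl _ hF
    _ ≤ ∫⁻ R in Set.Ioi (0 : ℝ), ENNReal.ofReal (R⁻¹) *
          (B * ∫⁻ y, ENNReal.ofReal (rh R y ^ 2) * G y) :=
        setLIntegral_mono' measurableSet_Ioi fun R hR => mul_le_mul_right (H R hR) _
    _ = ∫⁻ R in Set.Ioi (0 : ℝ), B * (ENNReal.ofReal (R⁻¹) *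
          ∫⁻ y, ENNReal.ofReal (rh R y ^ 2) * G y) := by
        refine lintegral_congr fun R => by ring
    _ = B * ∫⁻ R in Set.Ioi (0 : ℝ), (ENNReal.ofReal (R⁻¹) *
          ∫⁻ y, ENNReal.ofReal (rh R y ^ 2) * G y) := by
        refine lintegral_const_mul _ ?_
        refine Measurable.mul (M := ℝ≥0∞) measurable_inv.ennreal_ofReal ?_
        have h1 : Measurable (fun t : ℝ × En n => jap t.2) := jap_cont.measurable.comp measurable_snd
        have : Measurable (fun t : ℝ × En n => ENNReal.ofReal (rh t.1 t.2 ^ 2) * G t.2) := by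
          simp only [rh_eq]
          refine Measurable.mul (M := ℝ≥0∞) ?_ (hG.comp measurable_snd)
          exact (((measurable_fst.mul h1).div
            ((measurable_fst.pow_const 2).add (h1.pow_const 2))).pow_const 2).ennreal_ofReal
        exact this.lintegral_prod_right'
    _ = B * ∫⁻ y, (∫⁻ R in Set.Ioi (0 : ℝ), ENNReal.ofReal (R⁻¹ * rh R y ^ 2)) * G y := by
        rw [kl 2 hG]
    _ ≤ B * ∫⁻ y, ENNReal.ofReal 2 * G y := by
        gcongr with y
        exact kerUp y
    _ = _ := by rw [lintegral_const_mul' _ _ ENNReal.ofReal_ne_top]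
end Kern

section Main
variable {n : ℕ} {κ : Type*}

theorem rpow_small {R s t : ℝ} (hR : 0 < R) (hs : 0 < s) (h : s ≤ R) (ht : 1 ≤ t) :
    R ^ (-t) * s ^ t ≤ 2 * (R * s / (R ^ 2 + s ^ 2)) := by
  have e : R ^ (-t) * s ^ t = (s / R) ^ t := by
    rw [Real.div_rpow hs.le hR.le, Real.rpow_neg hR.le]; ring
  have h1 : (s / R) ^ t ≤ (s / R) ^ (1 : ℝ) :=
    Real.rpow_le_rpow_of_exponent_ge (div_pos hs hR) ((div_le_one hR).2 h) ht
  rw [e]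
  refine h1.trans ?_
  rw [Real.rpow_one, ← mul_div_assoc, div_le_div_iff₀ hR (by positivity)]
  nlinarith [mul_pos hs hR]

theorem sqadd (x y : ℂ) : ‖x + y‖ₑ ^ 2 ≤ 2 * (‖x‖ₑ ^ 2 + ‖y‖ₑ ^ 2) := by
  have h1 : ‖x + y‖ₑ ^ 2 ≤ (‖x‖ₑ + ‖y‖ₑ) ^ 2 := pow_le_pow_left' (enorm_add_le x y) 2
  refine h1.trans ?_
  have h2 := ENNReal.rpow_add_le_mul_rpow_add_rpow ‖x‖ₑ ‖y‖ₑ (p := 2) (by norm_num)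
  have e : (2 : ℝ≥0∞) ^ ((2 : ℝ) - 1) = 2 := by norm_num
  rw [e] at h2
  simpa using h2

theorem wcomp {R : ℝ} (hR : 0 < R) {C q q' t : ℝ} (hC : 0 ≤ C) (v : En n → ℂ) {S : Set (En n)}
    (hS : ∀ y ∈ S, R ^ (-t) * jap y ^ t ≤ 2 * rh R y) (hq : q = q' + t) :
    ENNReal.ofReal (C * R ^ (-t)) ^ 2 * ∫⁻ y, ‖((jap y ^ q : ℝ) : ℂ) * S.indicator v y‖ₑ ^ 2 ≤
      ENNReal.ofReal (2 * C) ^ 2 *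
        ∫⁻ y, ENNReal.ofReal (rh R y ^ 2) * ‖((jap y ^ q' : ℝ) : ℂ) * v y‖ₑ ^ 2 := by
  rw [← lintegral_const_mul' _ _ (ENNReal.pow_ne_top ENNReal.ofReal_ne_top),
    ← lintegral_const_mul' _ _ (ENNReal.pow_ne_top ENNReal.ofReal_ne_top)]
  refine lintegral_mono fun y => ?_
  simp only
  by_cases h : y ∈ S
  · rw [Set.indicator_of_mem h, ENNReal.ofReal_pow (rh_pos hR y).le, ← mul_pow, ← mul_assoc,
      ← mul_pow, ← mul_pow]
    refine pow_le_pow_left' ?_ 2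
    rw [enorm_mul, enorm_mul, ← mul_assoc, ← mul_assoc]
    refine mul_le_mul_left ?_ _
    have hj : ∀ q : ℝ, ‖((jap y ^ q : ℝ) : ℂ)‖ₑ = ENNReal.ofReal (jap y ^ q) := fun q => by
      rw [← ofReal_norm, Complex.norm_real,
        Real.norm_of_nonneg (Real.rpow_nonneg (jap_pos _).le _)]
    have p1 := Real.rpow_pos_of_pos hR (-t)
    have p2 := Real.rpow_pos_of_pos (jap_pos y) q'
    have p3 := rh_pos hR y
    rw [hj, hj, ← ENNReal.ofReal_mul (by positivity), ← ENNReal.ofReal_mul (by positivity),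
      ← ENNReal.ofReal_mul (by positivity)]
    refine ENNReal.ofReal_le_ofReal ?_
    rw [hq, Real.rpow_add (jap_pos y)]
    have := mul_le_mul_of_nonneg_left (hS y h) (mul_nonneg hC p2.le)
    calc _ = C * jap y ^ q' * (R ^ (-t) * jap y ^ t) := by ring
      _ ≤ _ := this
      _ = _ := by ring
  · simp [h]

theorem family_main (m m₁ m₂ : ℝ) : ∃ N : ℕ, ∀ {κ : Type} {a : κ → Z3 n → ℂ}
    {K : κ → Set (En n)} (_ : ∀ k, IsCompact (K k)) {φ : κ → En n × En n → ℝ}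
    (_ : Ph N φ) (_ : ∀ k, Sm (a k)) (_ : ∀ k, Vn3 (K k) (a k))
    (_ : FB v3 g3 N (fun _ => w3 m₁ m₂) a),
    ∃ C : ℝ, 0 < C ∧ ∀ k v, RD v →
      eLpNorm (fun x => ((jap x ^ m : ℝ) : ℂ) * TT (φ k) (a k) v x) 2 volume ≤
        ENNReal.ofReal C * eLpNorm (fun y => ((jap y ^ (m + m₁ + m₂) : ℝ) : ℂ) * v y) 2 volume := by
  obtain ⟨D, hD⟩ := exists_nat_ge (|m + m₁| + 1)
  refine ⟨3 * n + 3 + D, ?_⟩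
  intro κ a K hK φ hφ sa va Fa
  have hD1 := le_abs_self (m + m₁)
  have hD2 := neg_abs_le (m + m₁)
  obtain ⟨aA, sA, vA, FA, eA⟩ := shiftA hK D hφ sa va Fa
  obtain ⟨aB, sB, vB, FB', eB⟩ := shiftB hK D hφ sa va Fa
  obtain ⟨d1, hd1⟩ := exists_nat_ge (|(m₁ - D) + m|)
  obtain ⟨d2, hd2⟩ := exists_nat_ge (|(m₁ + D) + m|)
  let L : ℕ := 2 * n + 1 + (d1 + d2)
  let R : κ × {R : ℝ // 0 < R} → ℝ := fun k => k.2.1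
  have hR : ∀ k, 0 < R k := fun k => k.2.2
  have hφ' : Ph (2 * n + 3) (fun k : κ × {R : ℝ // 0 < R} => φ k.1) :=
    (hφ.le (by omega)).reindex _
  obtain ⟨C1, hC1, H1⟩ := stageX (L := L) (m := m) hR (fun k => hK k.1) hφ' hd1 (by omega)
    (fun k => sA k.1) (fun k => vA k.1) ((FA.le (by omega)).reindex fun k : κ × {R : ℝ // 0 < R} => k.1)
  obtain ⟨C2, hC2, H2⟩ := stageX (L := L) (m := m) hR (fun k => hK k.1) hφ' hd2 (by omega)
    (fun k => sB k.1) (fun k => vB k.1) ((FB'.le (by omega)).reindex fun k : κ × {R : ℝ // 0 < R} => k.1)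
  obtain ⟨B0, hB0⟩ := Fa.zero
  obtain ⟨BA, hBA⟩ := FA.zero
  obtain ⟨BB, hBB⟩ := FB'.zero
  let c0 : ℝ := (1 / 5) ^ (2 * L) / 2
  have hc0 : 0 < c0 := by positivity
  let M : ℝ := 2 * ((2 * C1) ^ 2 + (2 * C2) ^ 2)
  have hM : 0 < M := by positivity
  refine ⟨Real.sqrt (c0⁻¹ * (M * 2)), by positivity, fun k v hv => ?_⟩
  set q := m + m₁ + m₂ with hq
  have sφ := hφ.sm k
  have hTA : ∀ {w : En n → ℂ}, RD w → ∀ x, TT (φ k) (a k) w x = TT (φ k) (aA k) w x := fun hw x => by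
    rw [TT_eq_Is sφ (sa k) (hK k) (va k) (hB0 k) hw, TT_eq_Is sφ (sA k) (hK k) (vA k) (hBA k) hw]
    simp only [eA]
  have hTB : ∀ {w : En n → ℂ}, RD w → ∀ x, TT (φ k) (a k) w x = TT (φ k) (aB k) w x := fun hw x => by
    rw [TT_eq_Is sφ (sa k) (hK k) (va k) (hB0 k) hw, TT_eq_Is sφ (sB k) (hK k) (vB k) (hBB k) hw]
    simp only [eB]
  let F : En n → ℝ≥0∞ := fun x => ‖((jap x ^ m : ℝ) : ℂ) * TT (φ k) (a k) v x‖ₑ ^ 2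
  let G : En n → ℝ≥0∞ := fun y => ‖((jap y ^ q : ℝ) : ℂ) * v y‖ₑ ^ 2
  have mj : ∀ q : ℝ, Measurable (fun y : En n => ((jap y ^ q : ℝ) : ℂ)) := fun q =>
    (Complex.continuous_ofReal.comp (Sm_jap_rpow q).cont).measurable
  have mF : Measurable F :=
    ((mj m).mul (TT_meas sφ (sa k) (hK k) (va k) (hB0 k) hv)).enorm.pow_const 2
  have mG : Measurable G := ((mj q).mul hv.ms).enorm.pow_const 2
  have key : ∀ r : ℝ, 0 < r → ∫⁻ x, ENNReal.ofReal (rh r x ^ (2 * L)) * F x ≤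
      ENNReal.ofReal M * ∫⁻ y, ENNReal.ofReal (rh r y ^ 2) * G y := by
    intro r hr
    let S : Set (En n) := {y | jap y ≤ r}
    have hS : MeasurableSet S := measurableSet_le jap_cont.measurable measurable_const
    have i1 := H1 (k, ⟨r, hr⟩) _ (hv.ind hS)
    have i2 := H2 (k, ⟨r, hr⟩) _ (hv.ind hS.compl)
    simp only [R] at i1 i2
    have w1 := wcomp (q := m₂ + D) (q' := q) (t := D - (m + m₁)) hr hC1.le v (S := S)
      (fun y hy => by
        rw [rh_eq]; exact rpow_small hr (jap_pos y) hy (by linarith)) (by rw [hq]; ring)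
    have w2 := wcomp (q := m₂ - D) (q' := q) (t := -(D + (m + m₁))) hr hC2.le v (S := Sᶜ)
      (fun y hy => by
        have hy' : r ≤ jap y := (not_le.1 (show ¬ jap y ≤ r from hy)).le
        have := rpow_small (t := D + (m + m₁)) (jap_pos y) hr hy' (by linarith)
        rw [rh_eq, neg_neg, mul_comm (r ^ _)]
        refine this.trans (le_of_eq ?_)
        rw [mul_comm (jap y) r, add_comm (jap y ^ 2)]) (by rw [hq]; ring)
    rw [show -(D - (m + m₁)) = m₁ - D + m by ring] at w1
    rw [show -(-(D + (m + m₁))) = m₁ + D + m by ring] at w2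
    have j1 := i1.trans w1
    have j2 := i2.trans w2
    calc ∫⁻ x, ENNReal.ofReal (rh r x ^ (2 * L)) * F x
        ≤ ∫⁻ x, 2 * (‖((rh r x ^ L * jap x ^ m : ℝ) : ℂ) * TT (φ k) (aA k) (S.indicator v) x‖ₑ ^ 2 +
            ‖((rh r x ^ L * jap x ^ m : ℝ) : ℂ) * TT (φ k) (aB k) (Sᶜ.indicator v) x‖ₑ ^ 2) := by
          refine lintegral_mono fun x => ?_
          refine le_trans (le_of_eq ?_) (sqadd _ _)
          rw [← mul_add, ← hTA (hv.ind hS), ← hTB (hv.ind hS.compl),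
            ← TT_split sφ (sa k) (hK k) (va k) (hB0 k) hv hS x]
          simp only [F]
          have hp := rh_pos hr x
          rw [mul_comm 2 L, pow_mul, ENNReal.ofReal_pow (by positivity), ← mul_pow,
            Complex.ofReal_mul, mul_assoc, enorm_mul ((rh r x ^ L : ℝ) : ℂ),
            ← ofReal_norm ((rh r x ^ L : ℝ) : ℂ), Complex.norm_real,
            Real.norm_of_nonneg (by positivity)]
      _ = 2 * ((∫⁻ x, ‖((rh r x ^ L * jap x ^ m : ℝ) : ℂ) *
              TT (φ k) (aA k) (S.indicator v) x‖ₑ ^ 2) +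
            ∫⁻ x, ‖((rh r x ^ L * jap x ^ m : ℝ) : ℂ) *
              TT (φ k) (aB k) (Sᶜ.indicator v) x‖ₑ ^ 2) := by
          rw [lintegral_const_mul' _ _ (by norm_num)]
          congr 1
          refine lintegral_add_left ?_ _
          have m1 : Measurable (fun x : En n => ((rh r x ^ L * jap x ^ m : ℝ) : ℂ)) :=
            (Complex.continuous_ofReal.comp ((Sm_rhp hr L).mul (Sm_jap_rpow m)).cont).measurable
          exact (m1.mul (TT_meas sφ (sA k) (hK k) (vA k) (hBA k) (hv.ind hS))).enorm.pow_const 2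
      _ ≤ 2 * (ENNReal.ofReal (2 * C1) ^ 2 * (∫⁻ y, ENNReal.ofReal (rh r y ^ 2) * G y) +
            ENNReal.ofReal (2 * C2) ^ 2 * ∫⁻ y, ENNReal.ofReal (rh r y ^ 2) * G y) :=
          mul_le_mul_right (add_le_add j1 j2) _
      _ = _ := by
          rw [← add_mul, ← mul_assoc, ← ENNReal.ofReal_pow (by positivity),
            ← ENNReal.ofReal_pow (by positivity), ← ENNReal.ofReal_add (by positivity) (by positivity)]
          congr 1
          rw [show (2 : ℝ≥0∞) = ENNReal.ofReal 2 by simp, ← ENNReal.ofReal_mul (by norm_num)]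
  have fin := tonelli_sum mF mG L key
  have h2 : eLpNorm (fun x => ((jap x ^ m : ℝ) : ℂ) * TT (φ k) (a k) v x) 2 volume ^ 2 ≤
      (ENNReal.ofReal (Real.sqrt (c0⁻¹ * (M * 2))) *
        eLpNorm (fun y => ((jap y ^ q : ℝ) : ℂ) * v y) 2 volume) ^ 2 := by
    rw [mul_pow, eL_sq, eL_sq, ← ENNReal.ofReal_pow (Real.sqrt_nonneg _),
      Real.sq_sqrt (by positivity)]
    have h3 : ∫⁻ x, F x = ENNReal.ofReal c0⁻¹ * (ENNReal.ofReal c0 * ∫⁻ x, F x) := by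
      rw [← mul_assoc, ← ENNReal.ofReal_mul (by positivity), inv_mul_cancel₀ hc0.ne']; simp
    change ∫⁻ x, F x ≤ _
    rw [h3]
    refine (mul_le_mul_right fin _).trans (le_of_eq ?_)
    rw [← mul_assoc, ← mul_assoc, ← ENNReal.ofReal_mul (by positivity),
      ← ENNReal.ofReal_mul (by positivity), mul_assoc c0⁻¹]
  exact (ENNReal.pow_le_pow_left_iff (by norm_num)).1 h2
end Main

section Final
variable {n : ℕ}

theorem schw_decay (u : 𝓢(En n, ℂ)) (q : ℝ) : ∃ C : ℝ, 0 ≤ C ∧ ∀ y, jap y ^ q * ‖u y‖ ≤ C := by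
  obtain ⟨k, hk⟩ := exists_nat_ge q
  have h := fun y => SchwartzMap.one_add_le_sup_seminorm_apply (𝕜 := ℝ) (m := (k, 0)) (k := k) (n := 0)
    le_rfl le_rfl u y
  simp only [norm_iteratedFDeriv_zero] at h
  have key : ∀ y, jap y ^ q * ‖u y‖ ≤ (1 + ‖y‖) ^ k * ‖u y‖ := fun y => by
    refine mul_le_mul_of_nonneg_right ?_ (norm_nonneg _)
    calc jap y ^ q ≤ jap y ^ (k : ℝ) := Real.rpow_le_rpow_of_exponent_le (jap_one_le y) hk
      _ = jap y ^ k := Real.rpow_natCast _ _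
      _ ≤ _ := pow_le_pow_left₀ (jap_pos y).le (jap_le y) k
  refine ⟨_, ?_, fun y => (key y).trans (h y)⟩
  exact le_trans (mul_nonneg (by positivity) (norm_nonneg _)) (h 0)

theorem schw_RD (u : 𝓢(En n, ℂ)) : RD (fun y => u y) := by
  have hc : ∀ q : ℝ, Continuous (fun y : En n => ((jap y ^ q : ℝ) : ℂ) * u y) := fun q =>
    (Complex.continuous_ofReal.comp (jap_cont.rpow_const fun y => Or.inl (jap_pos y).ne')).mul
      u.continuous
  have hn : ∀ (q : ℝ) y, ‖((jap y ^ q : ℝ) : ℂ) * u y‖ = jap y ^ q * ‖u y‖ := fun q y => by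
    rw [norm_mul, Complex.norm_real, Real.norm_of_nonneg (Real.rpow_nonneg (jap_pos y).le _)]
  have i1 : ∀ q : ℝ, Integrable (fun y : En n => ((jap y ^ q : ℝ) : ℂ) * u y) := fun q => by
    obtain ⟨C, hC0, hC⟩ := schw_decay u (q + (n + 1))
    have hi : Integrable (fun y : En n => jap y ^ (-((n : ℝ) + 1))) := by
      simpa using integrable_jap (n := n) (r := (n : ℝ) + 1) (by linarith) 0
    refine (hi.const_mul C).mono' (hc q).aestronglyMeasurable (Filter.Eventually.of_forall fun y => ?_)
    rw [hn]
    have e : jap y ^ q = jap y ^ (q + (n + 1)) * jap y ^ (-((n : ℝ) + 1)) := by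
      rw [← Real.rpow_add (jap_pos y)]; congr 1; ring
    rw [e]
    have := mul_le_mul_of_nonneg_right (hC y) (Real.rpow_nonneg (jap_pos y).le (-((n : ℝ) + 1)))
    linarith
  refine ⟨u.continuous.measurable, i1, fun q => ?_⟩
  obtain ⟨C, hC0, hC⟩ := schw_decay u q
  rw [memLp_two_iff_integrable_sq_norm (hc q).aestronglyMeasurable]
  refine ((i1 q).norm.const_mul C).mono' ((hc q).norm.pow 2).aestronglyMeasurable
    (Filter.Eventually.of_forall fun y => ?_)
  rw [Real.norm_of_nonneg (sq_nonneg _), sq]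
  refine mul_le_mul_of_nonneg_right ?_ (norm_nonneg _)
  rw [hn]; exact hC y

theorem ld_dLine {W F J : Type*} [NormedAddCommGroup W] [NormedSpace ℝ W]
    [NormedAddCommGroup F] [NormedSpace ℝ F] {v : J → W} {f : W → F} (hf : Sm f) (l : List J) (w : W) :
    ld v l (dLine w f) = dLine w (ld v l f) := by
  induction l with
  | nil => rfl
  | cons j l ih =>
    have e1 : ld v (j :: l) (dLine w f) = dLine (v j) (ld v l (dLine w f)) := rfl
    have e2 : ld v (j :: l) f = dLine (v j) (ld v l f) := rfl
    rw [e1, e2, ih, dLine_comm hf.ld]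

theorem gl_g1 {W J : Type*} (l : List J) (z : W) : gl g1 l z = 1 := by
  simp [gl, g1]

theorem mdeg_eq_zero {α : Fin n → ℕ} (h : mdeg α = 0) : α = 0 := by
  funext i
  have := (Finset.sum_eq_zero_iff_of_nonneg (s := Finset.univ) (f := α) (fun _ _ => Nat.zero_le _)).1 h i
    (Finset.mem_univ i)
  simpa using this

/-- the hypotheses of the theorem, bundled -/
structure Hyp (m₁ m₂ C₀ A : ℝ) (N : ℕ) (φ : En n × En n → ℝ) (a : Z3 n → ℂ) (K : Set (En n)) :
    Prop where
  cK : IsCompact K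
  sφ : Sm φ
  sa : Sm a
  det : ∀ z, C₀ ≤ |Matrix.det (Matrix.of fun i j => mixedHessXY φ i j z)|
  van : Vn3 K a
  ba : ∀ α β γ : Fin n → ℕ, mdeg α ≤ N → mdeg β ≤ N → mdeg γ ≤ N →
          ∀ x y ξ, ‖mderiv d3X α (mderiv d3Y β (mderiv d3Xi γ a)) (x, y, ξ)‖ ≤
            A * jap x ^ (m₁ - (mdeg α : ℝ)) * jap y ^ m₂
  b1 : ∀ β : Fin n → ℕ, 1 ≤ mdeg β → mdeg β ≤ N → ∀ z : En n × En n,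
            |mderiv dY β φ z| ≤ A * jap z.1
  b2 : ∀ α β : Fin n → ℕ, 1 ≤ mdeg α → 1 ≤ mdeg β → mdeg α ≤ N → mdeg β ≤ N →
          ∀ z, |mderiv dX α (mderiv dY β φ) z| ≤ A

theorem Hyp.main (m m₁ m₂ C₀ : ℝ) (hC₀ : 0 < C₀) : ∃ N : ℕ, ∀ A : ℝ, ∃ C : ℝ, 0 < C ∧
    ∀ (φ : En n × En n → ℝ) (a : Z3 n → ℂ) (K : Set (En n)), Hyp m₁ m₂ C₀ A N φ a K →
    ∀ v, RD v → eLpNorm (fun x => ((jap x ^ m : ℝ) : ℂ) * TT φ a v x) 2 volume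
      ≤ ENNReal.ofReal C * eLpNorm (fun y => ((jap y ^ (m + m₁ + m₂) : ℝ) : ℂ) * v y) 2 volume := by
  obtain ⟨N, hN⟩ := family_main (n := n) m m₁ m₂
  refine ⟨N + 2, fun A => ?_⟩
  let κ : Type := {t : (En n × En n → ℝ) × (Z3 n → ℂ) × Set (En n) //
    Hyp m₁ m₂ C₀ A (N + 2) t.1 t.2.1 t.2.2}
  have key := hN (κ := κ) (a := fun t => t.1.2.1) (K := fun t => t.1.2.2) (fun t => t.2.cK)
    (φ := fun t => t.1.1) ?_ (fun t => t.2.sa) (fun t => t.2.van) ?_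
  · obtain ⟨C, hC, h⟩ := key
    exact ⟨C, hC, fun φ a K hh v hv => h ⟨(φ, a, K), hh⟩ v hv⟩
  · refine ⟨fun t => t.2.sφ, fun j => ?_, fun k j => ?_, C₀, hC₀, fun t z => t.2.det z⟩
    · refine FB_of_ld fun l hl => ⟨|A|, fun t z => ?_⟩
      obtain ⟨α, β, h1, h2, h3, h4⟩ := ld2_eq t.2.sφ l j
      rw [gl_g1, one_mul, h4, Real.norm_eq_abs]
      by_cases h0 : mdeg α = 0
      · rw [mdeg_eq_zero h0, mderiv_zero]
        exact (t.2.b1 β h2 (by omega) z).trans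
          (mul_le_mul_of_nonneg_right (le_abs_self A) (jap_pos _).le)
      · refine (t.2.b2 α β (by omega) h2 (by omega) (by omega) z).trans ((le_abs_self A).trans ?_)
        exact le_mul_of_one_le_right (abs_nonneg A) (jap_one_le _)
    · refine FB_of_ld fun l hl => ⟨|A|, fun t z => ?_⟩
      obtain ⟨α, β, h1, h2, h3, h4⟩ := ld2_eq t.2.sφ l j
      rw [gl_g1, one_mul, mul_one, ld_dLine (t.2.sφ.dLine _), h4, mderiv_succ k t.2.sφ.mderiv,
        Real.norm_eq_abs]
      have hd := mdeg_update α k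
      exact (t.2.b2 _ β (by omega) h2 (by omega) (by omega) z).trans (le_abs_self A)
  · refine FB_of_ld fun l hl => ⟨|A|, fun t z => ?_⟩
    obtain ⟨α, β, γ, h1, h2, h3, h4, h5⟩ := ld3_eq t.2.sa l
    rw [h4, h5]
    refine (t.2.ba α β γ (by omega) (by omega) (by omega) z.1 z.2.1 z.2.2).trans ?_
    rw [w3, ← mul_assoc (jap z.1 ^ _), ← Real.rpow_add (jap_pos _), neg_add_eq_sub, mul_assoc]
    exact mul_le_mul_of_nonneg_right (le_abs_self A)
      (mul_nonneg (Real.rpow_nonneg (jap_pos _).le _) (Real.rpow_nonneg (jap_pos _).le _))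

end Final

/-- (Theorem 3.1, case (1).) The operator
`Tu(x) = ∫∫ e^{i(x·ξ+φ(y,ξ))} a(x,y,ξ) u(y) dy dξ` is bounded from `L²_{m+m₁+m₂}` to
`L²_m` when `|det ∂_y∂_ξ φ| ≥ C₀`, `|∂_x^α∂_y^β∂_ξ^γ a| ≤ C_{αβγ}⟨x⟩^{m₁-|α|}⟨y⟩^{m₂}`,
`|∂_ξ^β φ| ≤ C_β⟨y⟩` for `|β| ≥ 1` and `|∂_y^α∂_ξ^β φ| ≤ C_{αβ}` for `|α|, |β| ≥ 1`;
the constant depends only on `n`, `m`, `m₁`, `m₂`, `C₀` and finitely many (order `≤ N`)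
of the constants (all bounded by `A`), and is independent of the compact set `K`. -/
theorem statement12 (n : ℕ) (m m₁ m₂ : ℝ) (C₀ : ℝ) (hC₀ : 0 < C₀) :
    ∃ N : ℕ, ∀ A : ℝ, ∃ C : ℝ, 0 < C ∧
      ∀ (φ : EuclideanSpace ℝ (Fin n) × EuclideanSpace ℝ (Fin n) → ℝ)
        (a : EuclideanSpace ℝ (Fin n) × EuclideanSpace ℝ (Fin n) ×
              EuclideanSpace ℝ (Fin n) → ℂ)
        (K : Set (EuclideanSpace ℝ (Fin n))), IsCompact K →
        ContDiff ℝ (⊤ : ℕ∞) φ → ContDiff ℝ (⊤ : ℕ∞) a →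
        -- nondegeneracy of the mixed Hessian `∂_y∂_ξ φ`:
        (∀ z, C₀ ≤ |Matrix.det (Matrix.of fun i j => mixedHessXY φ i j z)|) →
        -- `|∂_x^α∂_y^β∂_ξ^γ a| ≤ C_{αβγ} ⟨x⟩^{m₁-|α|} ⟨y⟩^{m₂}` for all `α, β, γ`:
        (∀ α β γ : Fin n → ℕ, ∃ Cb : ℝ,
          ∀ x y ξ, ‖mderiv d3X α (mderiv d3Y β (mderiv d3Xi γ a)) (x, y, ξ)‖ ≤
            Cb * jap x ^ (m₁ - (mdeg α : ℝ)) * jap y ^ m₂) →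
        -- `|∂_ξ^β φ(y,ξ)| ≤ C_β ⟨y⟩` for all `|β| ≥ 1`:
        (∀ β : Fin n → ℕ, 1 ≤ mdeg β → ∃ Cb : ℝ,
          ∀ z : EuclideanSpace ℝ (Fin n) × EuclideanSpace ℝ (Fin n),
            |mderiv dY β φ z| ≤ Cb * jap z.1) →
        -- `|∂_y^α∂_ξ^β φ| ≤ C_{αβ}` for all `|α| ≥ 1`, `|β| ≥ 1`:
        (∀ α β : Fin n → ℕ, 1 ≤ mdeg α → 1 ≤ mdeg β → ∃ Cb : ℝ,
          ∀ z, |mderiv dX α (mderiv dY β φ) z| ≤ Cb) →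
        -- `a` vanishes for `ξ` outside the compact set `K`:
        (∀ x y ξ, ξ ∉ K → a (x, y, ξ) = 0) →
        -- the quantitative bounds of order `≤ N`, with constant `A`:
        (∀ α β γ : Fin n → ℕ, mdeg α ≤ N → mdeg β ≤ N → mdeg γ ≤ N →
          ∀ x y ξ, ‖mderiv d3X α (mderiv d3Y β (mderiv d3Xi γ a)) (x, y, ξ)‖ ≤
            A * jap x ^ (m₁ - (mdeg α : ℝ)) * jap y ^ m₂) →
        (∀ β : Fin n → ℕ, 1 ≤ mdeg β → mdeg β ≤ N →
          ∀ z : EuclideanSpace ℝ (Fin n) × EuclideanSpace ℝ (Fin n),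
            |mderiv dY β φ z| ≤ A * jap z.1) →
        (∀ α β : Fin n → ℕ, 1 ≤ mdeg α → 1 ≤ mdeg β → mdeg α ≤ N → mdeg β ≤ N →
          ∀ z, |mderiv dX α (mderiv dY β φ) z| ≤ A) →
        ∀ u : 𝓢(EuclideanSpace ℝ (Fin n), ℂ),
          eLpNorm (fun x => ((jap x ^ m : ℝ) : ℂ) * ∫ ξ, ∫ y,
              Complex.exp (Complex.I * ((⟪x, ξ⟫ + φ (y, ξ) : ℝ) : ℂ)) * a (x, y, ξ) * u y)
              2 volume
            ≤ ENNReal.ofReal C *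
              eLpNorm (fun y => ((jap y ^ (m + m₁ + m₂) : ℝ) : ℂ) * u y) 2 volume := by
  obtain ⟨N, hN⟩ := Hyp.main (n := n) m m₁ m₂ C₀ hC₀
  refine ⟨N, fun A => ?_⟩
  obtain ⟨C, hC, h⟩ := hN A
  refine ⟨C, hC, fun φ a K hK hφ ha hdet _ _ _ hv hba hb1 hb2 u => ?_⟩
  exact h φ a K ⟨hK, hφ, ha, hdet, hv, hba, hb1, hb2⟩ (fun y => u y) (schw_RD u)
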